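/- There exist a polynomial P₁ in three variables and a polynomial P₂ in four variables, both with nonnegative coefficients and depending only on d, ν and λ, such that the following holds. Let h be a classical solution on [0,T] of the homogeneous KPZ equation ∂ₜh = νΔh + λV(∇h) with h₀ ∈ W^{3,∞}(ℝ^d), which is moreover C³ in the space variable with spatial derivatives of order ≤ 3 bounded on [0,T] × ℝ^d. Then for every t ∈ (0,T], ‖∇²h(t,·)‖_∞ ≤ P₁(‖h₀‖_∞, ‖∇h₀‖_∞, ‖∇²h₀‖_∞) · ln(1+t)/t, and for every t ∈ [1,T], ‖∇³h(t,·)‖_∞ ≤ P₂(‖h₀‖_∞, ‖∇h₀‖_∞, ‖∇²h₀‖_∞, ‖∇³h₀‖_∞) · ln²(1+t)/t^{3/2}. -/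

import Mathlib

open MeasureTheory Real Set
open scoped ENNReal

noncomputable section

/-- The Laplacian of a function `f : ℝ^d → ℝ` at `x`, as the trace of the second derivative. -/
def lapl {d : ℕ} (f : EuclideanSpace ℝ (Fin d) → ℝ) (x : EuclideanSpace ℝ (Fin d)) : ℝ :=
  ∑ i : Fin d,
    iteratedFDeriv ℝ 2 f x ![EuclideanSpace.single i (1:ℝ), EuclideanSpace.single i (1:ℝ)]

/-- Standing assumptions on the deposition rate `V` (with radial profile `W`):
`V` is `C²`, isotropic, convex, `W 0 = 0`, `W ≥ 0` and `W y ≤ y²` on `[0,∞)`. -/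
structure IsDepositionRate (d : ℕ) (V : EuclideanSpace ℝ (Fin d) → ℝ) (W : ℝ → ℝ) : Prop where
  smooth : ContDiff ℝ 2 V
  isotropic : ∀ p, V p = W ‖p‖
  convex : ConvexOn ℝ Set.univ V
  zero : W 0 = 0
  nonneg : ∀ y : ℝ, 0 ≤ y → 0 ≤ W y
  quadGrowth : ∀ y : ℝ, 0 ≤ y → W y ≤ y ^ 2

/-- `h₀ ∈ W^{1,∞}(ℝ^d)`: differentiable, bounded, with bounded gradient. -/
structure MemW1inf {d : ℕ} (h₀ : EuclideanSpace ℝ (Fin d) → ℝ) : Prop where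
  diff : Differentiable ℝ h₀
  bdd : ∃ C, ∀ x, |h₀ x| ≤ C
  grad_bdd : ∃ C, ∀ x, ‖gradient h₀ x‖ ≤ C

/-- A classical solution on `[0,T]` of the homogeneous KPZ equation
`∂ₜ h = ν Δ h + λ V (∇ h)` with initial condition `h₀`: continuous on `[0,T] × ℝ^d`,
`C¹` in time and `C²` in space on `(0,T] × ℝ^d`, bounded together with its spatial
gradient, and satisfying the equation pointwise on `(0,T] × ℝ^d`. -/
structure IsClassicalSolution {d : ℕ} (ν lam T : ℝ)
    (V : EuclideanSpace ℝ (Fin d) → ℝ)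
    (h₀ : EuclideanSpace ℝ (Fin d) → ℝ)
    (h : ℝ → EuclideanSpace ℝ (Fin d) → ℝ) : Prop where
  cont : ContinuousOn (fun p : ℝ × EuclideanSpace ℝ (Fin d) => h p.1 p.2)
      (Set.Icc 0 T ×ˢ Set.univ)
  space_reg : ∀ t ∈ Set.Ioc (0:ℝ) T, ContDiff ℝ 2 (h t)
  time_reg : ∀ (x : EuclideanSpace ℝ (Fin d)), ∀ t ∈ Set.Ioc (0:ℝ) T,
      DifferentiableAt ℝ (fun s => h s x) t
  bdd : ∃ C, ∀ t ∈ Set.Icc (0:ℝ) T, ∀ x, |h t x| ≤ C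
  grad_bdd : ∃ C, ∀ t ∈ Set.Icc (0:ℝ) T, ∀ x, ‖gradient (h t) x‖ ≤ C
  pde : ∀ t ∈ Set.Ioc (0:ℝ) T, ∀ x, deriv (fun s => h s x) t
      = ν * lapl (h t) x + lam * V (gradient (h t) x)
  init : ∀ x, h 0 x = h₀ x


open MeasureTheory Real Set
open scoped ENNReal
noncomputable section

abbrev ES (d : ℕ) := EuclideanSpace ℝ (Fin d)

def bv {d : ℕ} (i : Fin d) : ES d := EuclideanSpace.single i (1:ℝ)

lemma bv_norm {d : ℕ} (i : Fin d) : ‖bv i‖ = 1 := by simp [bv]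

lemma lapl_eq {d : ℕ} (f : ES d → ℝ) (x : ES d) :
    lapl f x = ∑ i : Fin d, fderiv ℝ (fderiv ℝ f) x (bv i) (bv i) := by
  unfold lapl
  refine Finset.sum_congr rfl fun i _ => ?_
  rw [iteratedFDeriv_two_apply]; rfl

lemma norm_it2 {d : ℕ} (f : ES d → ℝ) (x : ES d) :
    ‖iteratedFDeriv ℝ 2 f x‖ = ‖fderiv ℝ (fderiv ℝ f) x‖ := by
  rw [← norm_iteratedFDeriv_fderiv, norm_iteratedFDeriv_one]

lemma lip_gen {E F : Type*} [NormedAddCommGroup E] [NormedSpace ℝ E] [NormedAddCommGroup F]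
    [NormedSpace ℝ F] (G : E → F) (hG : ContDiff ℝ 2 G) (N : ℝ)
    (hN : ∀ x, ‖iteratedFDeriv ℝ 2 G x‖ ≤ N) (x y : E) :
    ‖fderiv ℝ G x - fderiv ℝ G y‖ ≤ N * ‖x - y‖ := by
  have h1 : Differentiable ℝ (fderiv ℝ G) :=
    (hG.fderiv_right (m := 1) (by norm_num)).differentiable (by norm_num)
  refine Convex.norm_image_sub_le_of_norm_fderiv_le (𝕜 := ℝ) (s := Set.univ) (fun z _ => h1 z) ?_
    convex_univ (Set.mem_univ _) (Set.mem_univ _)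
  intro z _
  rw [← norm_iteratedFDeriv_one, norm_iteratedFDeriv_fderiv]
  exact hN z

lemma lip_of_it3 {d : ℕ} (f : ES d → ℝ) (hf : ContDiff ℝ 3 f) (N : ℝ)
    (hN : ∀ x, ‖iteratedFDeriv ℝ 3 f x‖ ≤ N) (x y : ES d) :
    ‖fderiv ℝ (fderiv ℝ f) x - fderiv ℝ (fderiv ℝ f) y‖ ≤ N * ‖x - y‖ := by
  refine lip_gen (fderiv ℝ f) (hf.fderiv_right (m := 2) (by norm_num)) N (fun z => ?_) x y
  rw [norm_iteratedFDeriv_fderiv]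
  exact hN z

lemma norm_grad {d : ℕ} (f : ES d → ℝ) (x : ES d) : ‖gradient f x‖ = ‖fderiv ℝ f x‖ := by
  simp [gradient]

lemma inner_grad {d : ℕ} (f : ES d → ℝ) (x e : ES d) : inner ℝ (gradient f x) e = fderiv ℝ f x e := by
  simp [gradient]

lemma sum_bv_sq {d : ℕ} (x : ES d) : ∑ i : Fin d, (inner ℝ x (bv i)) ^ 2 = ‖x‖ ^ 2 := by
  rw [EuclideanSpace.norm_sq_eq]
  refine Finset.sum_congr rfl fun i _ => ?_
  simp [bv, EuclideanSpace.inner_single_right]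

lemma sum_bv_mul {d : ℕ} (x y : ES d) :
    ∑ i : Fin d, (inner ℝ x (bv i)) * (inner ℝ y (bv i)) = inner ℝ x y := by
  simp only [bv, PiLp.inner_apply]
  refine Finset.sum_congr rfl fun i _ => ?_
  simp [mul_comm]

lemma sum_fderiv_bv_sq {d : ℕ} (f : ES d → ℝ) (x : ES d) :
    ∑ i : Fin d, (fderiv ℝ f x (bv i)) ^ 2 = ‖fderiv ℝ f x‖ ^ 2 := by
  rw [← norm_grad, ← sum_bv_sq]; simp

lemma abs_lapl_le {d : ℕ} (f : ES d → ℝ) (x : ES d) (M : ℝ) (hM : ‖fderiv ℝ (fderiv ℝ f) x‖ ≤ M) :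
    |lapl f x| ≤ d * M := by
  rw [lapl_eq]
  refine (Finset.abs_sum_le_sum_abs _ _).trans ?_
  have : ∀ i ∈ Finset.univ, |fderiv ℝ (fderiv ℝ f) x (bv i) (bv i)| ≤ M := by
    intro i _
    have := (fderiv ℝ (fderiv ℝ f) x).le_opNorm₂ (bv i) (bv i)
    rw [bv_norm, Real.norm_eq_abs] at this
    linarith
  refine (Finset.sum_le_sum this).trans ?_
  simp

/-- line derivatives -/
lemma hasDerivAt_line {d : ℕ} {f : ES d → ℝ} (hf : Differentiable ℝ f) (x e : ES d) (r : ℝ) :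
    HasDerivAt (fun r : ℝ => f (x + r • e)) (fderiv ℝ f (x + r • e) e) r := by
  have h1 : HasDerivAt (fun r : ℝ => x + r • e) e r := by
    simpa using ((hasDerivAt_id r).smul_const e).const_add x
  exact (hf _).hasFDerivAt.comp_hasDerivAt r h1

lemma hasDerivAt_line' {d : ℕ} {F : Type*} [NormedAddCommGroup F] [NormedSpace ℝ F]
    {f : ES d → F} (hf : Differentiable ℝ f) (x e : ES d) (r : ℝ) :
    HasDerivAt (fun r : ℝ => f (x + r • e)) (fderiv ℝ f (x + r • e) e) r := by
  have h1 : HasDerivAt (fun r : ℝ => x + r • e) e r := by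
    simpa using ((hasDerivAt_id r).smul_const e).const_add x
  exact (hf _).hasFDerivAt.comp_hasDerivAt r h1

lemma diff_fderiv {d : ℕ} {f : ES d → ℝ} (hf : ContDiff ℝ 2 f) : Differentiable ℝ (fderiv ℝ f) :=
  (hf.fderiv_right (m := 1) (by norm_num)).differentiable (by norm_num)

lemma hasDerivAt_line2 {d : ℕ} {f : ES d → ℝ} (hf : ContDiff ℝ 2 f) (x e v : ES d) (r : ℝ) :
    HasDerivAt (fun r : ℝ => fderiv ℝ f (x + r • e) v) (fderiv ℝ (fderiv ℝ f) (x + r • e) e v) r := by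
  have := hasDerivAt_line' (diff_fderiv hf) x e r
  exact this.clm_apply (hasDerivAt_const r v) |>.congr_deriv (by simp)

lemma fderiv2_nonpos_of_max {d : ℕ} {f : ES d → ℝ} (hf : ContDiff ℝ 2 f) (x e : ES d)
    (hm : IsLocalMax f x) : fderiv ℝ (fderiv ℝ f) x e e ≤ 0 := by
  by_contra hcon
  push Not at hcon
  set φ : ℝ → ℝ := fun r => f (x + r • e) with hφ
  have hd1 : deriv φ = fun r => fderiv ℝ f (x + r • e) e := by
    ext r; exact (hasDerivAt_line (hf.differentiable (by norm_num)) x e r).deriv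
  have hd2 : deriv (deriv φ) 0 = fderiv ℝ (fderiv ℝ f) x e e := by
    rw [hd1, (hasDerivAt_line2 hf x e e 0).deriv]; simp
  have hmax : IsLocalMax φ 0 := by
    have hc : ContinuousAt (fun r : ℝ => x + r • e) 0 := by fun_prop
    have : Filter.Tendsto (fun r : ℝ => x + r • e) (nhds 0) (nhds x) := by
      simpa [ContinuousAt] using hc
    have h2 := this.eventually hm
    filter_upwards [h2] with r hr
    simpa [hφ] using hr
  have hmin : IsLocalMin φ 0 := by
    apply isLocalMin_of_deriv_deriv_pos (by rw [hd2]; exact hcon) hmax.deriv_eq_zero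
    exact (hasDerivAt_line (hf.differentiable (by norm_num)) x e 0).continuousAt
  have hconst : φ =ᶠ[nhds 0] fun _ => φ 0 := by
    filter_upwards [hmax, hmin] with r h1 h2
    exact le_antisymm h1 h2
  have := hconst.deriv.deriv
  have h3 := this.eq_of_nhds
  simp at h3
  rw [hd2] at h3
  linarith

lemma lapl_nonpos_of_max {d : ℕ} {f : ES d → ℝ} (hf : ContDiff ℝ 2 f) (x : ES d)
    (hm : IsLocalMax f x) : lapl f x ≤ 0 := by
  rw [lapl_eq]
  exact Finset.sum_nonpos fun i _ => fderiv2_nonpos_of_max hf x _ hm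

lemma contDiff_two_normsq {d : ℕ} : ContDiff ℝ 2 (fun x : ES d => ‖x‖ ^ 2) := contDiff_norm_sq ℝ

lemma fderiv_normsq {d : ℕ} (x v : ES d) : fderiv ℝ (fun x : ES d => ‖x‖ ^ 2) x v = 2 * inner ℝ x v := by
  rw [fderiv_norm_sq_apply]; simp

lemma lapl_add {d : ℕ} {f g : ES d → ℝ} (hf : ContDiff ℝ 2 f) (hg : ContDiff ℝ 2 g) (x : ES d) :
    lapl (fun x => f x + g x) x = lapl f x + lapl g x := by
  rw [lapl_eq, lapl_eq, lapl_eq, ← Finset.sum_add_distrib]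
  refine Finset.sum_congr rfl fun i _ => ?_
  have : fderiv ℝ (fun x => f x + g x) = fun x => fderiv ℝ f x + fderiv ℝ g x := by
    ext1 z
    exact fderiv_add (hf.differentiable (by norm_num) z) (hg.differentiable (by norm_num) z)
  rw [this, fderiv_fun_add (diff_fderiv hf x) (diff_fderiv hg x)]
  simp

lemma lapl_const_mul {d : ℕ} {f : ES d → ℝ} (hf : ContDiff ℝ 2 f) (c : ℝ) (x : ES d) :
    lapl (fun x => c * f x) x = c * lapl f x := by
  rw [lapl_eq, lapl_eq, Finset.mul_sum]
  refine Finset.sum_congr rfl fun i _ => ?_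
  have : fderiv ℝ (fun x => c * f x) = fun x => c • fderiv ℝ f x := by
    ext1 z
    exact fderiv_const_mul (hf.differentiable (by norm_num) z) c
  rw [this, fderiv_fun_const_smul (diff_fderiv hf x)]
  simp

lemma lapl_sub {d : ℕ} {f g : ES d → ℝ} (hf : ContDiff ℝ 2 f) (hg : ContDiff ℝ 2 g) (x : ES d) :
    lapl (fun x => f x - g x) x = lapl f x - lapl g x := by
  have h := lapl_add hf (contDiff_const.mul hg : ContDiff ℝ 2 fun x => (-1) * g x) x
  rw [lapl_const_mul hg] at h
  rw [show (fun x => f x - g x) = fun x => f x + (-1) * g x by ext; ring, h]; ring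

lemma lapl_sq {d : ℕ} {f : ES d → ℝ} (hf : ContDiff ℝ 2 f) (x : ES d) :
    lapl (fun x => f x ^ 2) x = 2 * f x * lapl f x + 2 * ‖fderiv ℝ f x‖ ^ 2 := by
  have hd := hf.differentiable (by norm_num)
  have : fderiv ℝ (fun x => f x ^ 2) = fun x => (2 * f x) • fderiv ℝ f x := by
    ext1 z
    have := ((hd z).hasFDerivAt.pow 2).fderiv
    simpa using this
  rw [lapl_eq, lapl_eq, ← sum_fderiv_bv_sq, Finset.mul_sum, Finset.mul_sum, ← Finset.sum_add_distrib]
  refine Finset.sum_congr rfl fun i _ => ?_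
  rw [this]
  have h1 : HasFDerivAt (fun z => 2 * f z) ((2:ℝ) • fderiv ℝ f x) x := (hd x).hasFDerivAt.const_mul 2
  have h2 := h1.fun_smul (diff_fderiv hf x).hasFDerivAt
  rw [h2.fderiv]
  simp
  ring

lemma lapl_normsq {d : ℕ} (x : ES d) : lapl (fun x : ES d => ‖x‖ ^ 2) x = 2 * d := by
  rw [lapl_eq]
  have : fderiv ℝ (fun x : ES d => ‖x‖ ^ 2) = fun x => (2:ℝ) • innerSL ℝ x := by
    ext x v; rw [fderiv_normsq]; simp
  rw [this]
  have h2 : fderiv ℝ (fun x : ES d => (2:ℝ) • innerSL ℝ x) x = (2:ℝ) • (innerSL ℝ (E := ES d)) := by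
    have := ((innerSL ℝ (E := ES d)).hasFDerivAt (x := x)).const_smul (2:ℝ)
    exact this.fderiv
  rw [h2]
  have : ∀ i : Fin d, ((2:ℝ) • (innerSL ℝ (E := ES d))) (bv i) (bv i) = 2 := by
    intro i
    simp [bv_norm]
  simp only [this]
  simp
  ring

lemma lapl_comp_add {d : ℕ} (f : ES d → ℝ) (y x : ES d) :
    lapl (fun x => f (x + y)) x = lapl f (x + y) := by
  unfold lapl
  rw [iteratedFDeriv_comp_add_right]

end

open MeasureTheory Real Set
open scoped ENNReal
noncomputable section

section Vlemmas
variable {d : ℕ} {V : ES d → ℝ} {W : ℝ → ℝ}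

lemma V_nonneg (hV : IsDepositionRate d V W) (p : ES d) : 0 ≤ V p := by
  rw [hV.isotropic]; exact hV.nonneg _ (norm_nonneg _)

lemma V_le (hV : IsDepositionRate d V W) (p : ES d) : V p ≤ ‖p‖ ^ 2 := by
  rw [hV.isotropic]; exact hV.quadGrowth _ (norm_nonneg _)

lemma V_zero (hV : IsDepositionRate d V W) : V 0 = 0 := by
  rw [hV.isotropic]; simpa using hV.zero

lemma V_lip_aux (hV : IsDepositionRate d V W) {R : ℝ} {p p' : ES d} (hp' : ‖p'‖ ≤ R) :
    V p' - V p ≤ 4 * R * ‖p - p'‖ := by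
  have hR : 0 ≤ R := (norm_nonneg _).trans hp'
  rcases eq_or_ne p p' with rfl | hne
  · simp
  set δ := ‖p - p'‖ with hδ
  have hδ0 : 0 < δ := norm_pos_iff.2 (sub_ne_zero.2 hne)
  rcases hR.eq_or_lt with hR0 | hR0
  · have : p' = 0 := by
      rw [← hR0] at hp'; exact norm_le_zero_iff.1 hp'
    rw [this, V_zero hV, ← hR0]
    have := V_nonneg hV p
    simp; linarith
  have hs : 0 < δ + R := by linarith
  set v := p' - p with hv
  have hvn : ‖v‖ = δ := by rw [hv, hδ, norm_sub_rev]
  set p'' := p' + (R / δ) • v with hp''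
  have hn : ‖p''‖ ≤ 2 * R := by
    refine (norm_add_le _ _).trans ?_
    rw [norm_smul, hvn, Real.norm_eq_abs, abs_of_nonneg (by positivity), div_mul_cancel₀ _ hδ0.ne']
    linarith
  have hc := hV.convex.2 (mem_univ p) (mem_univ p'') (show 0 ≤ R / (δ + R) by positivity)
    (show 0 ≤ δ / (δ + R) by positivity) (by field_simp; ring)
  have hpt : (R / (δ + R)) • p + (δ / (δ + R)) • p'' = p' := by
    rw [hp'', hv]
    have e1 : R / (δ + R) = 1 - δ / (δ + R) := by field_simp; ring
    have e2 : δ / (δ + R) * (R / δ) = 1 - δ / (δ + R) := by field_simp; ring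
    rw [smul_add, smul_smul, e2, e1]
    module
  rw [hpt] at hc
  simp only [smul_eq_mul] at hc
  have h1 : V p'' ≤ 4 * R ^ 2 := by
    refine (V_le hV _).trans ?_
    nlinarith [norm_nonneg p'']
  have h2 := V_nonneg hV p
  have h3 : R / (δ + R) * V p ≤ V p := by
    have : R / (δ + R) ≤ 1 := by rw [div_le_one hs]; linarith
    nlinarith
  have h4 : δ / (δ + R) * V p'' ≤ δ / R * (4 * R ^ 2) := by
    gcongr
    · exact V_nonneg hV _
    · linarith
  have h5 : δ / R * (4 * R ^ 2) = 4 * R * δ := by field_simp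
  linarith

lemma V_lip (hV : IsDepositionRate d V W) {R : ℝ} {p p' : ES d} (hp : ‖p‖ ≤ R) (hp' : ‖p'‖ ≤ R) :
    |V p - V p'| ≤ 4 * R * ‖p - p'‖ := by
  rw [abs_le]
  have h1 := V_lip_aux hV (p := p) hp'
  have h2 := V_lip_aux hV (p := p') hp
  rw [norm_sub_rev] at h2
  constructor <;> linarith

lemma V_iso (hV : IsDepositionRate d V W) (p n : ES d) (hn : ‖n‖ = 1) :
    |V p - V ((inner ℝ p n : ℝ) • n)| ≤ 4 * (‖p‖ ^ 2 - (inner ℝ p n : ℝ) ^ 2) := by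
  set r := ‖p‖ with hr
  set c := |(inner ℝ p n : ℝ)| with hc
  have hc0 : 0 ≤ c := abs_nonneg _
  have hcr : c ≤ r := by
    have := abs_real_inner_le_norm p n
    rwa [hn, mul_one] at this
  have e1 : V p = V (r • n) := by
    rw [hV.isotropic, hV.isotropic, norm_smul, hn, hr]; simp
  have e2 : V ((inner ℝ p n : ℝ) • n) = V (c • n) := by
    rw [hV.isotropic, hV.isotropic, norm_smul, norm_smul, hn, hc]; simp
  rw [e1, e2]
  have hr0 : 0 ≤ r := norm_nonneg _
  have := V_lip hV (R := r) (p := r • n) (p' := c • n) (by rw [norm_smul, hn]; simp [abs_of_nonneg hr0])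
    (by rw [norm_smul, hn]; simp [abs_of_nonneg hc0, hcr])
  refine this.trans ?_
  rw [← sub_smul, norm_smul, hn, Real.norm_eq_abs, abs_of_nonneg (by linarith), ← sq_abs (inner ℝ p n : ℝ)]
  nlinarith

lemma V_diff (hV : IsDepositionRate d V W) : Differentiable ℝ V :=
  hV.smooth.differentiable (by norm_num)

lemma V_tangent (hV : IsDepositionRate d V W) (P v : ES d) :
    fderiv ℝ V P v ≤ V (P + v) - V P := by
  have h := hasDerivAt_line (V_diff hV) P v 0
  simp only [zero_smul, add_zero] at h
  have h2 := h.tendsto_slope_zero_right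
  refine le_of_tendsto h2 ?_
  have : Ioc (0:ℝ) 1 ∈ nhdsWithin (0:ℝ) (Ioi 0) := Ioc_mem_nhdsGT (by norm_num)
  filter_upwards [this] with s hs
  have hc := hV.convex.2 (mem_univ P) (mem_univ (P + v)) (show 0 ≤ 1 - s by linarith [hs.2])
    hs.1.le (by ring)
  have e : (1 - s) • P + s • (P + v) = P + s • v := by module
  rw [e] at hc
  simp only [smul_eq_mul] at hc
  simp only [zero_add, zero_smul, add_zero, smul_eq_mul]
  rw [inv_mul_le_iff₀ hs.1]
  linarith

lemma V_le_fderiv (hV : IsDepositionRate d V W) (P : ES d) : V P ≤ fderiv ℝ V P P := by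
  have := V_tangent hV P (-P)
  simp [V_zero hV] at this
  linarith

lemma V_fderiv_norm (hV : IsDepositionRate d V W) {R : ℝ} {P : ES d} (hP : ‖P‖ ≤ R) :
    ‖fderiv ℝ V P‖ ≤ 4 * R := by
  have hR : 0 ≤ R := (norm_nonneg _).trans hP
  refine le_of_forall_pos_le_add fun η hη => ?_
  set R' := R + η / 4 with hR'
  have hR'0 : 0 < R' := by positivity
  have key : ∀ v : ES d, ‖v‖ = R' → fderiv ℝ V P v ≤ 4 * R' ^ 2 := by
    intro v hv
    refine (V_tangent hV P v).trans ?_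
    have h1 := V_le hV (P + v)
    have h2 := V_nonneg hV P
    have h3 : ‖P + v‖ ≤ 2 * R' := (norm_add_le _ _).trans (by rw [hv]; linarith)
    nlinarith [norm_nonneg (P + v)]
  refine ContinuousLinearMap.opNorm_le_bound _ (by positivity) fun v => ?_
  rcases eq_or_ne v 0 with rfl | hv
  · simp
  have hv0 : 0 < ‖v‖ := norm_pos_iff.2 hv
  have k1 := key ((R' / ‖v‖) • v) (by
    rw [norm_smul, Real.norm_eq_abs, abs_of_pos (by positivity)]; field_simp)
  have k2 := key (-((R' / ‖v‖) • v)) (by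
    rw [norm_neg, norm_smul, Real.norm_eq_abs, abs_of_pos (by positivity)]; field_simp)
  rw [map_neg, map_smul, smul_eq_mul] at k2
  rw [map_smul, smul_eq_mul] at k1
  have e : 4 * R + η = 4 * R' := by rw [hR']; ring
  rw [e, Real.norm_eq_abs, abs_le]
  have k1' : R' / ‖v‖ * (fderiv ℝ V P) v ≤ R' / ‖v‖ * (4 * R' * ‖v‖) := by
    refine k1.trans (le_of_eq ?_); field_simp
  have k2' : R' / ‖v‖ * (-(fderiv ℝ V P) v) ≤ R' / ‖v‖ * (4 * R' * ‖v‖) := by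
    refine (le_of_eq (by ring)).trans (k2.trans (le_of_eq ?_)); field_simp
  have hp : 0 < R' / ‖v‖ := by positivity
  have a1 := le_of_mul_le_mul_left k1' hp
  have a2 := le_of_mul_le_mul_left k2' hp
  constructor <;> linarith
end Vlemmas

theorem max_principle {d : ℕ} (ν T B κ M : ℝ) (hν : 0 < ν) (hB : 0 ≤ B)
    (u ut : ℝ → ES d → ℝ)
    (hc : ContinuousOn (fun p : ℝ × ES d => u p.1 p.2) (Icc 0 T ×ˢ univ))
    (hbd : ∃ C, ∀ t ∈ Icc (0:ℝ) T, ∀ x, u t x ≤ C)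
    (hx : ∀ t ∈ Ioc (0:ℝ) T, ContDiff ℝ 2 (u t))
    (ht : ∀ t ∈ Ioc (0:ℝ) T, ∀ x, HasDerivAt (fun s => u s x) (ut t x) t)
    (hle : ∀ t ∈ Ioc (0:ℝ) T, ∀ x, ut t x ≤ ν * lapl (u t) x + B * ‖fderiv ℝ (u t) x‖ + κ)
    (h0 : ∀ x, u 0 x ≤ M) : ∀ t ∈ Icc (0:ℝ) T, ∀ x, u t x ≤ M + κ * t := by
  intro t1 ht1 x1
  by_contra hcon
  push Not at hcon
  set gap := u t1 x1 - M - κ * t1 with hgap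
  have hgap0 : 0 < gap := by rw [hgap]; linarith
  have hT : 0 ≤ T := ht1.1.trans ht1.2
  obtain ⟨C, hC⟩ := hbd
  set C' := |C| + |M| + |κ| * T + 1 with hC'
  have hC'0 : 0 < C' := by positivity
  have hbound : ∀ s ∈ Icc (0:ℝ) T, ∀ x, u s x - M - κ * s < C' := by
    intro s hs x
    have h1 := hC s hs x
    have h2 := le_abs_self C
    have h3 := neg_abs_le M
    have h4 : -(κ * s) ≤ |κ| * T := by
      have : |κ * s| ≤ |κ| * T := by
        rw [abs_mul, abs_of_nonneg hs.1]; gcongr; exact hs.2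
      linarith [neg_abs_le (κ * s)]
    linarith
  set η := gap / (4 * (T + 1)) with hη
  have hη0 : 0 < η := by positivity
  have hηT : η * t1 ≤ gap / 4 := by
    have : η * t1 ≤ η * (T + 1) := by gcongr; linarith [ht1.2]
    have e : η * (T + 1) = gap / 4 := by rw [hη]; field_simp
    linarith
  -- choose ε
  obtain ⟨ε, hε0, hε1, hε2⟩ : ∃ ε : ℝ, 0 < ε ∧ ε * ‖x1‖ ^ 2 < gap / 4 ∧
      ν * (2 * d * ε) + B * (2 * √(ε * C')) < η := by
    have t1 : Filter.Tendsto (fun ε : ℝ => ε * ‖x1‖ ^ 2) (nhdsWithin 0 (Ioi 0)) (nhds 0) := by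
      have : Continuous fun ε : ℝ => ε * ‖x1‖ ^ 2 := by fun_prop
      simpa using (this.tendsto 0).mono_left nhdsWithin_le_nhds
    have t2 : Filter.Tendsto (fun ε : ℝ => ν * (2 * d * ε) + B * (2 * √(ε * C')))
        (nhdsWithin 0 (Ioi 0)) (nhds 0) := by
      have : Continuous fun ε : ℝ => ν * (2 * d * ε) + B * (2 * √(ε * C')) := by fun_prop
      simpa using (this.tendsto 0).mono_left nhdsWithin_le_nhds
    have e1 := t1.eventually (gt_mem_nhds (show (0:ℝ) < gap / 4 by positivity))
    have e2 := t2.eventually (gt_mem_nhds hη0)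
    obtain ⟨ε, h⟩ := ((e1.and e2).and self_mem_nhdsWithin).exists
    exact ⟨ε, h.2, h.1.1, h.1.2⟩
  set Φ : ℝ × ES d → ℝ := fun p => u p.1 p.2 - M - κ * p.1 - η * p.1 - ε * ‖p.2‖ ^ 2 with hΦ
  set R := √(C' / ε) with hR
  have hRsq : ε * R ^ 2 = C' := by
    rw [hR, Real.sq_sqrt (by positivity)]; field_simp
  have hΦ1 : 0 < Φ (t1, x1) := by
    simp only [hΦ]; linarith
  have hout : ∀ s ∈ Icc (0:ℝ) T, ∀ x, R < ‖x‖ → Φ (s, x) < 0 := by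
    intro s hs x hxR
    have h1 := hbound s hs x
    have h2 : ε * R ^ 2 ≤ ε * ‖x‖ ^ 2 := by gcongr
    have h3 : 0 ≤ η * s := mul_nonneg hη0.le hs.1
    simp only [hΦ]; linarith
  have hx1R : ‖x1‖ ≤ R := by
    by_contra h; push Not at h
    linarith [hout t1 ht1 x1 h]
  have hcomp : IsCompact (Icc (0:ℝ) T ×ˢ Metric.closedBall (0 : ES d) R) :=
    isCompact_Icc.prod (isCompact_closedBall _ _)
  have hΦc : ContinuousOn Φ (Icc (0:ℝ) T ×ˢ Metric.closedBall (0 : ES d) R) := by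
    have := hc.mono (show Icc (0:ℝ) T ×ˢ Metric.closedBall (0 : ES d) R ⊆ Icc 0 T ×ˢ univ from
      prod_mono le_rfl (subset_univ _))
    simp only [hΦ]
    have h2 : Continuous fun p : ℝ × ES d => M + κ * p.1 + η * p.1 + ε * ‖p.2‖ ^ 2 := by fun_prop
    refine (this.sub h2.continuousOn).congr fun p _ => ?_
    simp only [Pi.sub_apply]; ring
  obtain ⟨⟨s, x⟩, hsx, hmax⟩ := hcomp.exists_isMaxOn ⟨(t1, x1), ⟨ht1, by simpa using hx1R⟩⟩ hΦc
  have hpos : 0 < Φ (s, x) := hΦ1.trans_le (hmax (show (t1, x1) ∈ _ from ⟨ht1, by simpa using hx1R⟩))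
  have hsI : s ∈ Icc (0:ℝ) T := hsx.1
  have hs0 : 0 < s := by
    rcases hsI.1.eq_or_lt with h | h
    · exfalso
      have := h0 x
      simp only [hΦ, ← h] at hpos
      have h2 : 0 ≤ ε * ‖x‖ ^ 2 := by positivity
      linarith
    · exact h
  have hsI' : s ∈ Ioc (0:ℝ) T := ⟨hs0, hsI.2⟩
  have hmaxx : ∀ z, Φ (s, z) ≤ Φ (s, x) := by
    intro z
    by_cases hz : ‖z‖ ≤ R
    · exact hmax (show (s, z) ∈ _ from ⟨hsI, by simpa using hz⟩)
    · push Not at hz; linarith [hout s hsI z hz]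
  have hmaxt : ∀ r ∈ Icc (0:ℝ) s, Φ (r, x) ≤ Φ (s, x) := by
    intro r hr
    exact hmax (show (r, x) ∈ _ from ⟨⟨hr.1, hr.2.trans hsI.2⟩, hsx.2⟩)
  -- space
  have hlm : IsLocalMax (fun z => u s z - ε * ‖z‖ ^ 2) x := by
    refine Filter.Eventually.of_forall fun z => ?_
    have := hmaxx z
    simp only [hΦ] at this
    show u s z - ε * ‖z‖ ^ 2 ≤ u s x - ε * ‖x‖ ^ 2
    linarith
  have hCu := hx s hsI'
  have hCn : ContDiff ℝ 2 (fun z : ES d => ε * ‖z‖ ^ 2) := contDiff_const.mul contDiff_two_normsq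
  have hlap := lapl_nonpos_of_max (hCu.sub hCn) x hlm
  rw [lapl_sub hCu hCn, lapl_const_mul contDiff_two_normsq, lapl_normsq] at hlap
  have hgrad := hlm.fderiv_eq_zero
  rw [fderiv_fun_sub (hCu.differentiable (by norm_num) x) (hCn.differentiable (by norm_num) x)] at hgrad
  have hgn : ‖fderiv ℝ (u s) x‖ ≤ 2 * √(ε * C') := by
    rw [sub_eq_zero.1 hgrad]
    have hxb : ε * ‖x‖ ≤ √(ε * C') := by
      apply Real.le_sqrt_of_sq_le
      have : ‖x‖ ≤ R := by simpa using hsx.2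
      have h2 : ε * ‖x‖ ^ 2 ≤ C' := by rw [← hRsq]; gcongr
      nlinarith
    refine (ContinuousLinearMap.opNorm_le_bound _ (by positivity) (M := 2 * (ε * ‖x‖)) fun v => ?_).trans (by linarith)
    rw [fderiv_const_mul (contDiff_two_normsq.differentiable (by norm_num) x)]
    have := norm_inner_le_norm (𝕜 := ℝ) x v
    simp only [smul_apply, fderiv_normsq, smul_eq_mul, norm_mul]
    rw [Real.norm_of_nonneg hε0.le]
    simp only [Real.norm_ofNat]
    nlinarith
  -- time
  have htd : κ + η ≤ ut s x := by
    have hd : HasDerivAt (fun r => u r x - (κ + η) * r) (ut s x - (κ + η)) s := by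
      have := (ht s hsI' x).fun_sub ((hasDerivAt_id s).const_mul (κ + η))
      simpa using this
    have h2 := hd.tendsto_slope_zero_left
    have : 0 ≤ ut s x - (κ + η) := by
      refine ge_of_tendsto h2 ?_
      have : Ico (-s) (0:ℝ) ∈ nhdsWithin (0:ℝ) (Iio 0) := Ico_mem_nhdsLT (by linarith)
      filter_upwards [this] with r hr
      have h3 := hmaxt (s + r) ⟨by linarith [hr.1], by linarith [hr.2]⟩
      simp only [hΦ] at h3
      simp only [smul_eq_mul]
      apply mul_nonneg_of_nonpos_of_nonpos
      · exact inv_nonpos.2 hr.2.le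
      · linarith
    linarith
  have hfin := hle s hsI' x
  have h1 : ν * lapl (u s) x ≤ ν * (2 * d * ε) := by gcongr; linarith
  have h2 : B * ‖fderiv ℝ (u s) x‖ ≤ B * (2 * √(ε * C')) := by gcongr
  linarith
end

open MeasureTheory Real Set
open scoped ENNReal
noncomputable section

structure Sol {d : ℕ} (ν lam T : ℝ) (V : ES d → ℝ) (h : ℝ → ES d → ℝ) : Prop where
  c : ContinuousOn (fun p : ℝ × ES d => h p.1 p.2) (Icc 0 T ×ˢ univ)
  c3 : ∀ t ∈ Ioc (0:ℝ) T, ContDiff ℝ 3 (h t)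
  ht : ∀ t ∈ Ioc (0:ℝ) T, ∀ x, HasDerivAt (fun s => h s x)
    (ν * lapl (h t) x + lam * V (gradient (h t) x)) t
  b0 : ∃ C, 0 ≤ C ∧ ∀ t ∈ Icc (0:ℝ) T, ∀ x, |h t x| ≤ C
  b1 : ∃ C, 0 ≤ C ∧ ∀ t ∈ Ioc (0:ℝ) T, ∀ x, ‖fderiv ℝ (h t) x‖ ≤ C
  b2 : ∃ C, 0 ≤ C ∧ ∀ t ∈ Ioc (0:ℝ) T, ∀ x, ‖fderiv ℝ (fderiv ℝ (h t)) x‖ ≤ C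
  b3 : ∃ C, 0 ≤ C ∧ ∀ t ∈ Ioc (0:ℝ) T, ∀ x, ‖iteratedFDeriv ℝ 3 (h t) x‖ ≤ C

section
variable {d : ℕ} {V : ES d → ℝ} {W : ℝ → ℝ} {ν lam T : ℝ} {h : ℝ → ES d → ℝ}

lemma Sol.c2 (hS : Sol ν lam T V h) : ∀ t ∈ Ioc (0:ℝ) T, ContDiff ℝ 2 (h t) :=
  fun t ht => (hS.c3 t ht).of_le (by norm_num)

lemma sol_upper (hV : IsDepositionRate d V W) (hν : 0 < ν) (hlam : 0 < lam) (hS : Sol ν lam T V h)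
    {A : ℝ} (hA : ∀ x, |h 0 x| ≤ A) : ∀ t ∈ Icc (0:ℝ) T, ∀ x, h t x ≤ A := by
  obtain ⟨C, hC0, hC⟩ := hS.b0
  obtain ⟨K, hK0, hK⟩ := hS.b1
  have := max_principle ν T (lam * K) 0 A hν (by positivity) h _ hS.c
    ⟨C, fun t ht x => (le_abs_self _).trans (hC t ht x)⟩ hS.c2 hS.ht ?_ (fun x => (le_abs_self _).trans (hA x))
  · intro t ht x; simpa using this t ht x
  · intro t ht x
    have h1 := V_le hV (gradient (h t) x)
    rw [norm_grad] at h1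
    have h2 := hK t ht x
    have h3 : lam * V (gradient (h t) x) ≤ lam * (K * ‖fderiv ℝ (h t) x‖) := by
      gcongr; nlinarith [norm_nonneg (fderiv ℝ (h t) x)]
    linarith

lemma fderiv_neg_fun (f : ES d → ℝ) : (fderiv ℝ fun x => - f x) = fun x => - fderiv ℝ f x := by
  ext1 x; exact fderiv_fun_neg

lemma sol_lower (hV : IsDepositionRate d V W) (hν : 0 < ν) (hlam : 0 < lam) (hS : Sol ν lam T V h)
    {A : ℝ} (hA : ∀ x, |h 0 x| ≤ A) : ∀ t ∈ Icc (0:ℝ) T, ∀ x, -h t x ≤ A := by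
  obtain ⟨C, hC0, hC⟩ := hS.b0
  have := max_principle ν T 0 0 A hν le_rfl (fun t x => - h t x) _ hS.c.neg
    ⟨C, fun t ht x => (neg_le_abs _).trans (hC t ht x)⟩ (fun t ht => (hS.c2 t ht).neg)
    (fun t ht x => (hS.ht t ht x).neg) ?_ (fun x => (neg_le_abs _).trans (hA x))
  · intro t ht x; simpa using this t ht x
  · intro t ht x
    have h1 := V_nonneg hV (gradient (h t) x)
    have e : lapl (fun x => - h t x) x = - lapl (h t) x := by
      have := lapl_const_mul (hS.c2 t ht) (-1) x
      simpa using this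
    rw [e]
    have := mul_nonneg hlam.le h1
    linarith

lemma sol_abs (hV : IsDepositionRate d V W) (hν : 0 < ν) (hlam : 0 < lam) (hS : Sol ν lam T V h)
    {A : ℝ} (hA : ∀ x, |h 0 x| ≤ A) : ∀ t ∈ Icc (0:ℝ) T, ∀ x, |h t x| ≤ A := by
  intro t ht x
  rw [abs_le]
  have h1 := sol_upper hV hν hlam hS hA t ht x
  have h2 := sol_lower hV hν hlam hS hA t ht x
  constructor <;> linarith

lemma cont_shift (hS : Sol ν lam T V h) (y : ES d) :
    ContinuousOn (fun p : ℝ × ES d => h p.1 (p.2 + y)) (Icc 0 T ×ˢ univ) := by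
  have hc : Continuous fun p : ℝ × ES d => (p.1, p.2 + y) := by fun_prop
  exact hS.c.comp hc.continuousOn (fun p hp => ⟨hp.1, mem_univ _⟩)

lemma contDiff_shift {f : ES d → ℝ} {n : ℕ∞} (hf : ContDiff ℝ n f) (y : ES d) :
    ContDiff ℝ n fun x => f (x + y) := hf.comp (contDiff_id.add contDiff_const)

lemma fderiv_shift (f : ES d → ℝ) (y x : ES d) :
    fderiv ℝ (fun x => f (x + y)) x = fderiv ℝ f (x + y) := fderiv_comp_add_right y

lemma grad_sub_norm (f : ES d → ℝ) (x y : ES d) :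
    ‖gradient f x - gradient f y‖ = ‖fderiv ℝ f x - fderiv ℝ f y‖ := by
  simp only [gradient, ← map_sub, LinearIsometryEquiv.norm_map]

lemma fderiv_diff (hS : Sol ν lam T V h) {t : ℝ} (ht : t ∈ Ioc 0 T) (x y : ES d) :
    fderiv ℝ (fun x => h t (x + y) - h t x) x = fderiv ℝ (h t) (x + y) - fderiv ℝ (h t) x := by
  have hd := (hS.c2 t ht).differentiable (by norm_num)
  have hd2 : Differentiable ℝ (fun x => h t (x + y)) := hd.comp (differentiable_id.add_const y)
  rw [fderiv_fun_sub (hd2 x) (hd x), fderiv_shift]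

lemma sol_grad (hV : IsDepositionRate d V W) (hν : 0 < ν) (hlam : 0 < lam) (hS : Sol ν lam T V h)
    {G : ℝ} (h0 : Differentiable ℝ (h 0)) (hG : ∀ x, ‖fderiv ℝ (h 0) x‖ ≤ G) :
    ∀ t ∈ Ioc (0:ℝ) T, ∀ x, ‖fderiv ℝ (h t) x‖ ≤ G := by
  obtain ⟨C, hC0, hC⟩ := hS.b0
  obtain ⟨K, hK0, hK⟩ := hS.b1
  have hG0 : 0 ≤ G := (norm_nonneg _).trans (hG 0)
  have key : ∀ y : ES d, ∀ t ∈ Icc (0:ℝ) T, ∀ x, h t (x + y) - h t x ≤ G * ‖y‖ := by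
    intro y
    have := max_principle ν T (4 * lam * K) 0 (G * ‖y‖) hν (by positivity)
      (fun t x => h t (x + y) - h t x) _ ((cont_shift hS y).sub hS.c)
      ⟨2 * C, fun t ht x => by
        have h1 := abs_le.1 (hC t ht (x + y)); have h2 := abs_le.1 (hC t ht x); linarith [h1.2, h2.1]⟩
      (fun t ht => (contDiff_shift (n := 2) (hS.c2 t ht) y).sub (hS.c2 t ht))
      (fun t ht x => (hS.ht t ht (x + y)).sub (hS.ht t ht x)) ?_ ?_
    · intro t ht x; simpa using this t ht x
    · intro t ht x
      rw [lapl_sub (contDiff_shift (n := 2) (hS.c2 t ht) y) (hS.c2 t ht), lapl_comp_add, fderiv_diff hS ht]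
      have h1 := V_lip hV (R := K) (p := gradient (h t) (x + y)) (p' := gradient (h t) x)
        (by rw [norm_grad]; exact hK t ht _) (by rw [norm_grad]; exact hK t ht _)
      rw [grad_sub_norm] at h1
      have h2 := (abs_le.1 h1).2
      have h3 := mul_le_mul_of_nonneg_left h2 hlam.le
      linarith
    · intro x
      have := Convex.norm_image_sub_le_of_norm_fderiv_le (𝕜 := ℝ) (s := univ) (f := h 0) (C := G)
        (fun z _ => h0 z) (fun z _ => hG z) convex_univ (mem_univ x) (mem_univ (x + y))
      simp only [add_sub_cancel_left] at this
      exact (le_abs_self _).trans this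
  intro t ht x
  have ht' : t ∈ Icc (0:ℝ) T := ⟨ht.1.le, ht.2⟩
  have hd := ((hS.c2 t ht).differentiable (by norm_num) x).hasFDerivAt
  refine hd.le_of_lip' hG0 (Filter.Eventually.of_forall fun z => ?_)
  rw [Real.norm_eq_abs, abs_le]
  have h1 := key (z - x) t ht' x
  have h2 := key (x - z) t ht' z
  rw [add_sub_cancel] at h1 h2
  rw [norm_sub_rev] at h2
  constructor <;> linarith

lemma fderiv_lip {f : ES d → ℝ} (hf : ContDiff ℝ 2 f) {M : ℝ}
    (hM : ∀ x, ‖fderiv ℝ (fderiv ℝ f) x‖ ≤ M) (x z : ES d) :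
    ‖fderiv ℝ f z - fderiv ℝ f x‖ ≤ M * ‖z - x‖ :=
  Convex.norm_image_sub_le_of_norm_fderiv_le (𝕜 := ℝ) (s := univ) 
    (fun z _ => diff_fderiv hf z) (fun z _ => hM z) convex_univ (mem_univ x) (mem_univ z)

lemma diff_le_local {f : ES d → ℝ} (hf : ContDiff ℝ 2 f) {M : ℝ} (hM0 : 0 ≤ M)
    (hM : ∀ x, ‖fderiv ℝ (fderiv ℝ f) x‖ ≤ M) (x y : ES d) :
    |f (x + y) - f x| ≤ (‖fderiv ℝ f x‖ + M * ‖y‖) * ‖y‖ := by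
  have := Convex.norm_image_sub_le_of_norm_fderiv_le (𝕜 := ℝ) (s := Metric.closedBall x ‖y‖) (f := f)
    (C := ‖fderiv ℝ f x‖ + M * ‖y‖)
    (fun z _ => hf.differentiable (by norm_num) z) (fun z hz => ?_) (convex_closedBall _ _)
    (x := x) (y := x + y) (by simp) (by simp)
  · simpa using this
  · have h1 := fderiv_lip hf hM x z
    have h2 : ‖z - x‖ ≤ ‖y‖ := by simpa [dist_eq_norm] using hz
    have h3 : M * ‖z - x‖ ≤ M * ‖y‖ := by gcongr
    have h4 := norm_le_norm_add_norm_sub' (fderiv ℝ f z) (fderiv ℝ f x)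
    linarith

set_option maxHeartbeats 1000000 in
lemma bernstein_step (hV : IsDepositionRate d V W) (hν : 0 < ν) (hlam : 0 < lam)
    (hS : Sol ν lam T V h) {A K M : ℝ} (hA : ∀ x, |h 0 x| ≤ A) (hA0 : 0 ≤ A) (hK0 : 0 ≤ K) (hM0 : 0 ≤ M)
    (hK : ∀ t ∈ Ioc (0:ℝ) T, ∀ x, ‖fderiv ℝ (h t) x‖ ≤ K)
    (hM : ∀ t ∈ Ioc (0:ℝ) T, ∀ x, ‖fderiv ℝ (fderiv ℝ (h t)) x‖ ≤ M)
    (y : ES d) (hy : y ≠ 0) : ∀ t ∈ Ioc (0:ℝ) T, ∀ x,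
    t / ‖y‖ ^ 2 * (h t (x + y) - h t x) ^ 2 ≤ 2 * A ^ 2 / ν +
      (2 * K * M * ‖y‖ + M ^ 2 * ‖y‖ ^ 2 + 1 / ν * (2 * A) * (lam * (8 * K * M * ‖y‖))) * t := by
  have habs := sol_abs hV hν hlam hS hA
  set ρ := ‖y‖ with hρ
  have hρ0 : 0 < ρ := norm_pos_iff.2 hy
  set c := 1 / (2 * ν) with hc
  have hc0 : 0 < c := by positivity
  have hs1 : ∀ t ∈ Ioc (0:ℝ) T, ContDiff ℝ 2 (fun x => h t (x + y) - h t x) := fun t ht =>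
    (contDiff_shift (n := 2) (hS.c2 t ht) y).sub (hS.c2 t ht)
  have hs2 : ∀ t ∈ Ioc (0:ℝ) T, ContDiff ℝ 2 (fun x => h t x + A) := fun t ht =>
    (hS.c2 t ht).add contDiff_const
  have hTd : ∀ t ∈ Ioc (0:ℝ) T, ∀ x, HasDerivAt
      (fun t => t / ρ ^ 2 * (h t (x + y) - h t x) ^ 2 + c * (h t x + A) ^ 2)
      (1 / ρ ^ 2 * (h t (x + y) - h t x) ^ 2 + t / ρ ^ 2 * (2 * (h t (x + y) - h t x) *
        ((ν * lapl (h t) (x + y) + lam * V (gradient (h t) (x + y))) -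
          (ν * lapl (h t) x + lam * V (gradient (h t) x)))) +
        c * (2 * (h t x + A) * (ν * lapl (h t) x + lam * V (gradient (h t) x)))) t := by
    intro t ht x
    have e1 := ((hS.ht t ht (x + y)).fun_sub (hS.ht t ht x)).fun_pow 2
    have e2 := ((hS.ht t ht x).add_const A).fun_pow 2
    have e3 := (((hasDerivAt_id t).div_const (ρ ^ 2)).fun_mul e1).fun_add (e2.const_mul c)
    refine e3.congr_deriv ?_
    simp
  have hcont : ContinuousOn (fun p : ℝ × ES d => p.1 / ρ ^ 2 * (h p.1 (p.2 + y) - h p.1 p.2) ^ 2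
      + c * (h p.1 p.2 + A) ^ 2) (Icc 0 T ×ˢ univ) := by
    have e1 := cont_shift hS y
    have e2 := hS.c
    exact ((continuous_fst.continuousOn.div_const _).mul ((e1.sub e2).pow 2)).add
      (continuousOn_const.mul ((e2.add continuousOn_const).pow 2))
  have hmp := max_principle ν T (4 * lam * K)
    (2 * K * M * ρ + M ^ 2 * ρ ^ 2 + 1 / ν * (2 * A) * (lam * (8 * K * M * ρ))) (2 * A ^ 2 / ν) hν
    (by positivity) (fun t x => t / ρ ^ 2 * (h t (x + y) - h t x) ^ 2 + c * (h t x + A) ^ 2) _ hcont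
    ?_ (fun t ht => (contDiff_const.mul ((hs1 t ht).pow 2)).add (contDiff_const.mul ((hs2 t ht).pow 2)))
    hTd ?_ ?_
  · intro t ht x
    have := hmp t ⟨ht.1.le, ht.2⟩ x
    have h2 : 0 ≤ c * (h t x + A) ^ 2 := by positivity
    linarith
  · refine ⟨T / ρ ^ 2 * (2 * A) ^ 2 + c * (2 * A) ^ 2, fun t ht x => ?_⟩
    have h1 := abs_le.1 (habs t ht x)
    have h2 := abs_le.1 (habs t ht (x + y))
    have h3 : (h t (x + y) - h t x) ^ 2 ≤ (2 * A) ^ 2 := by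
      apply sq_le_sq'
      · linarith [h1.1, h1.2, h2.1, h2.2]
      · linarith [h1.1, h1.2, h2.1, h2.2]
    have h4 : (h t x + A) ^ 2 ≤ (2 * A) ^ 2 := by
      apply sq_le_sq'
      · linarith [h1.1, h1.2]
      · linarith [h1.1, h1.2]
    have h5 := ht.2
    have h6 := ht.1
    have hT0 : 0 ≤ T := h6.trans h5
    gcongr
  · intro t ht x
    set δ := h t (x + y) - h t x with hδ
    have htI : t ∈ Icc (0:ℝ) T := ⟨ht.1.le, ht.2⟩
    have ht0 := ht.1
    set p := gradient (h t) x with hp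
    set p' := gradient (h t) (x + y) with hp'
    have hpK : ‖p‖ ≤ K := by rw [hp, norm_grad]; exact hK t ht _
    have hp'K : ‖p'‖ ≤ K := by rw [hp', norm_grad]; exact hK t ht _
    have hqM : ‖p' - p‖ ≤ M * ρ := by
      rw [hp, hp', grad_sub_norm]
      have := fderiv_lip (hS.c2 t ht) (hM t ht) x (x + y)
      simpa using this
    obtain ⟨P, hPs, hPe⟩ := domain_mvt (f := V) (f' := fderiv ℝ V) (s := univ) (x := p) (y := p')
      (fun z _ => (V_diff hV z).hasFDerivAt.hasFDerivWithinAt) convex_univ (mem_univ _) (mem_univ _)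
    have hPK : ‖P‖ ≤ K := by
      have := (convex_closedBall (0 : ES d) K).segment_subset (x := p) (y := p') (by simpa using hpK) (by simpa using hp'K) hPs
      simpa using this
    have hPp : ‖P - p‖ ≤ M * ρ := by
      have := (convex_closedBall p (M * ρ)).segment_subset (x := p) (y := p') (by simp; positivity)
        (by simpa [dist_eq_norm] using hqM) hPs
      simpa [dist_eq_norm] using this
    -- fderiv of u
    have hfd : fderiv ℝ (fun x => t / ρ ^ 2 * (h t (x + y) - h t x) ^ 2 + c * (h t x + A) ^ 2) x =
        (t / ρ ^ 2 * (2 * δ)) • (fderiv ℝ (h t) (x + y) - fderiv ℝ (h t) x) +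
        (c * (2 * (h t x + A))) • fderiv ℝ (h t) x := by
      have e1 := ((hs1 t ht).differentiable (by norm_num) x).hasFDerivAt
      rw [fderiv_diff hS ht] at e1
      have e2 := ((hS.c2 t ht).differentiable (by norm_num) x).hasFDerivAt.add_const A
      have e1' : HasFDerivAt (fun x => (h t (x + y) - h t x) ^ 2) _ x := e1.pow 2
      have e2' : HasFDerivAt (fun x => (h t x + A) ^ 2) _ x := e2.pow 2
      have e3 := (e1'.const_mul (t / ρ ^ 2)).fun_add (e2'.const_mul c)
      rw [e3.fderiv]
      simp [smul_smul, hδ]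
      congr 1; ring
    set gu : ES d := (t / ρ ^ 2 * (2 * δ)) • (p' - p) + (c * (2 * (h t x + A))) • p with hgu
    have hgun : ‖gu‖ = ‖fderiv ℝ (fun x => t / ρ ^ 2 * (h t (x + y) - h t x) ^ 2 + c * (h t x + A) ^ 2) x‖ := by
      rw [hfd, ← LinearIsometryEquiv.norm_map (InnerProductSpace.toDual ℝ (ES d)) gu, hgu, hp, hp']
      simp [gradient]
    have hdrift : lam * fderiv ℝ V P gu ≤ 4 * lam * K * ‖gu‖ := by
      have h1 := (fderiv ℝ V P).le_opNorm gu
      have h2 := V_fderiv_norm hV hPK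
      have h3 : fderiv ℝ V P gu ≤ 4 * K * ‖gu‖ := by
        refine (le_abs_self _).trans (h1.trans ?_)
        gcongr
      nlinarith
    rw [← hgun]
    have hlap : lapl (fun x => t / ρ ^ 2 * (h t (x + y) - h t x) ^ 2 + c * (h t x + A) ^ 2) x =
        t / ρ ^ 2 * (2 * δ * (lapl (h t) (x + y) - lapl (h t) x) + 2 * ‖p' - p‖ ^ 2) +
        c * (2 * (h t x + A) * lapl (h t) x + 2 * ‖p‖ ^ 2) := by
      have eA : lapl (fun x => h t x + A) x = lapl (h t) x := by
        have e0 : (fderiv ℝ fun x => h t x + A) = fderiv ℝ (h t) := by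
          ext1 z; exact fderiv_add_const A
        rw [lapl_eq, lapl_eq, e0]
      have eB : fderiv ℝ (fun x => h t x + A) x = fderiv ℝ (h t) x := by simp
      rw [lapl_add (contDiff_const.mul ((hs1 t ht).pow 2)) (contDiff_const.mul ((hs2 t ht).pow 2)),
        lapl_const_mul ((hs1 t ht).pow 2), lapl_const_mul ((hs2 t ht).pow 2), lapl_sq (hs1 t ht),
        lapl_sq (hs2 t ht), eA, eB, fderiv_diff hS ht, ← grad_sub_norm,
        lapl_sub (contDiff_shift (n := 2) (hS.c2 t ht) y) (hS.c2 t ht), lapl_comp_add, ← norm_grad]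
    rw [hlap]
    have hgu_apply : fderiv ℝ V P gu = (t / ρ ^ 2 * (2 * δ)) * (V p' - V p) + (c * (2 * (h t x + A))) * fderiv ℝ V P p := by
      rw [hgu, map_add, map_smul, map_smul, hPe]; simp
    -- key inequalities
    have hδ2 : 1 / ρ ^ 2 * δ ^ 2 ≤ ‖p‖ ^ 2 + (2 * K * M * ρ + M ^ 2 * ρ ^ 2) := by
      have h1 := diff_le_local (hS.c2 t ht) hM0 (hM t ht) x y
      rw [← hδ, ← norm_grad, ← hp, ← hρ] at h1
      have h2 : δ ^ 2 ≤ ((‖p‖ + M * ρ) * ρ) ^ 2 := by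
        rw [← sq_abs δ]; gcongr
      have h3 : 1 / ρ ^ 2 * δ ^ 2 ≤ (‖p‖ + M * ρ) ^ 2 := by
        rw [one_div, inv_mul_le_iff₀ (by positivity)]; linarith
      have h4 : ‖p‖ * (M * ρ) ≤ K * (M * ρ) := by gcongr
      nlinarith
    have hVp : V p - fderiv ℝ V P p ≤ 8 * K * M * ρ := by
      have h1 := V_le_fderiv hV P
      have h2 : V p - V P ≤ 4 * K * (M * ρ) := by
        refine (le_abs_self _).trans ((V_lip hV hpK hPK).trans ?_)
        rw [norm_sub_rev]; gcongr
      have h3 : fderiv ℝ V P (P - p) ≤ 4 * K * (M * ρ) := by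
        refine (le_abs_self _).trans (((fderiv ℝ V P).le_opNorm _).trans ?_)
        gcongr
        exact V_fderiv_norm hV hPK
      rw [map_sub] at h3
      linarith
    have hhA := abs_le.1 (habs t htI x)
    have hlast : c * (2 * (h t x + A)) * (lam * (V p - fderiv ℝ V P p)) ≤
        1 / ν * (2 * A) * (lam * (8 * K * M * ρ)) := by
      have e : c * (2 * (h t x + A)) = 1 / ν * (h t x + A) := by rw [hc]; field_simp
      rw [e]
      have h1 : lam * (V p - fderiv ℝ V P p) ≤ lam * (8 * K * M * ρ) := by gcongr
      have h2 : 1 / ν * (h t x + A) ≤ 1 / ν * (2 * A) := by gcongr; linarith [hhA.2]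
      have h3 : 0 ≤ 1 / ν * (h t x + A) := mul_nonneg (by positivity) (by linarith [hhA.1])
      calc _ ≤ 1 / ν * (h t x + A) * (lam * (8 * K * M * ρ)) := mul_le_mul_of_nonneg_left h1 h3
        _ ≤ _ := mul_le_mul_of_nonneg_right h2 (by positivity)
    have hq0 : 0 ≤ ν * (t / ρ ^ 2 * (2 * ‖p' - p‖ ^ 2)) := by positivity
    have hcν : ν * (c * (2 * ‖p‖ ^ 2)) = ‖p‖ ^ 2 := by rw [hc]; field_simp
    rw [hgu_apply] at hdrift
    linarith
  · intro x
    have h1 := abs_le.1 (hA x)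
    have h4 : (h 0 x + A) ^ 2 ≤ (2 * A) ^ 2 := by
      apply sq_le_sq'
      · linarith [h1.1, h1.2]
      · linarith [h1.1, h1.2]
    simp only [zero_div, zero_mul, zero_add]
    calc c * (h 0 x + A) ^ 2 ≤ c * (2 * A) ^ 2 := by gcongr
      _ = 2 * A ^ 2 / ν := by rw [hc]; field_simp

lemma sol_decay (hV : IsDepositionRate d V W) (hν : 0 < ν) (hlam : 0 < lam)
    (hS : Sol ν lam T V h) {A : ℝ} (hA : ∀ x, |h 0 x| ≤ A) : ∀ t ∈ Ioc (0:ℝ) T, ∀ x,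
    ‖fderiv ℝ (h t) x‖ ≤ √(2 / ν) * A / √t := by
  have hA0 : 0 ≤ A := (abs_nonneg _).trans (hA 0)
  obtain ⟨K, hK0, hK⟩ := hS.b1
  obtain ⟨M, hM0, hM⟩ := hS.b2
  intro t ht x
  have ht0 := ht.1
  refine ContinuousLinearMap.opNorm_le_of_unit_norm (by positivity) fun e he => ?_
  have hd := hasDerivAt_line ((hS.c2 t ht).differentiable (by norm_num)) x e 0
  simp only [zero_smul, add_zero] at hd
  have hts := (hd.tendsto_slope_zero_right.pow 2).const_mul t
  have hlim : Filter.Tendsto (fun r : ℝ => 2 * A ^ 2 / ν +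
      (2 * K * M * r + M ^ 2 * r ^ 2 + 1 / ν * (2 * A) * (lam * (8 * K * M * r))) * t)
      (nhdsWithin 0 (Ioi 0)) (nhds (2 * A ^ 2 / ν)) := by
    have : Continuous (fun r : ℝ => 2 * A ^ 2 / ν +
      (2 * K * M * r + M ^ 2 * r ^ 2 + 1 / ν * (2 * A) * (lam * (8 * K * M * r))) * t) := by fun_prop
    simpa using (this.tendsto 0).mono_left nhdsWithin_le_nhds
  have hmain : t * (fderiv ℝ (h t) x e) ^ 2 ≤ 2 * A ^ 2 / ν := by
    refine le_of_tendsto_of_tendsto hts hlim ?_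
    filter_upwards [self_mem_nhdsWithin] with r hr
    have hr0 : 0 < r := hr
    have hne : r • e ≠ 0 := by
      rw [← norm_pos_iff, norm_smul, he, Real.norm_of_nonneg hr0.le]; linarith
    have := bernstein_step hV hν hlam hS hA hA0 hK0 hM0 hK hM (r • e) hne t ht x
    rw [norm_smul, he, Real.norm_of_nonneg hr0.le, mul_one] at this
    simp only [zero_add, zero_smul, add_zero, smul_eq_mul]
    refine (le_of_eq ?_).trans this
    field_simp
  rw [Real.norm_eq_abs]
  have e : √(2 / ν) * A / √t = √(2 * A ^ 2 / ν / t) := by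
    rw [Real.sqrt_div (show 0 ≤ 2 * A ^ 2 / ν by positivity) t, show 2 * A ^ 2 / ν = 2 / ν * A ^ 2 by ring,
      Real.sqrt_mul (by positivity), Real.sqrt_sq hA0]
  rw [e]
  apply Real.le_sqrt_of_sq_le
  rw [sq_abs, le_div_iff₀ ht0]; linarith
end
end

open MeasureTheory Real Set
open scoped ENNReal
noncomputable section

def kq : ℕ → ℝ → ℝ → ℝ
  | 0, _, _ => 1
  | 1, σ, p => -p / (2 * σ)
  | 2, σ, p => p ^ 2 / (4 * σ ^ 2) - 1 / (2 * σ)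
  | _, σ, p => -p ^ 3 / (8 * σ ^ 3) + 3 * p / (4 * σ ^ 2)

def kdq : ℕ → ℝ → ℝ → ℝ
  | 0, _, _ => 0
  | 1, σ, _ => -1 / (2 * σ)
  | 2, σ, p => p / (2 * σ ^ 2)
  | _, σ, p => -3 * p ^ 2 / (8 * σ ^ 3) + 3 / (4 * σ ^ 2)

def kddq : ℕ → ℝ → ℝ → ℝ
  | 0, _, _ => 0
  | 1, _, _ => 0
  | 2, σ, _ => 1 / (2 * σ ^ 2)
  | _, σ, p => -3 * p / (4 * σ ^ 3)

def gk {d : ℕ} (σ : ℝ) (y : ES d) : ℝ := σ ^ (-(d:ℝ) / 2) * exp (-(‖y‖ ^ 2 / (4 * σ)))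

def Kn {d : ℕ} (j : ℕ) (σ : ℝ) (e y : ES d) : ℝ := kq j σ (inner ℝ e y) * gk σ y

def Kb {d : ℕ} (j : ℕ) (σ : ℝ) (e b y : ES d) : ℝ :=
  (kdq j σ (inner ℝ e y) * inner ℝ e b - kq j σ (inner ℝ e y) * (inner ℝ y b / (2 * σ))) * gk σ y

def Kbb {d : ℕ} (j : ℕ) (σ : ℝ) (e b y : ES d) : ℝ :=
  (kddq j σ (inner ℝ e y) * (inner ℝ e b) ^ 2
    - kdq j σ (inner ℝ e y) * inner ℝ e b * (inner ℝ y b / σ)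
    + kq j σ (inner ℝ e y) * ((inner ℝ y b) ^ 2 / (4 * σ ^ 2) - ‖b‖ ^ 2 / (2 * σ))) * gk σ y

lemma kq_deriv {σ : ℝ} (hσ : 0 < σ) (j : ℕ) (p : ℝ) : HasDerivAt (kq j σ) (kdq j σ p) p := by
  match j with
  | 0 => exact hasDerivAt_const p (1:ℝ)
  | 1 =>
    show HasDerivAt (fun p => -p / (2 * σ)) (-1 / (2 * σ)) p
    exact (hasDerivAt_id p).neg.div_const _
  | 2 =>
    show HasDerivAt (fun p => p ^ 2 / (4 * σ ^ 2) - 1 / (2 * σ)) (p / (2 * σ ^ 2)) p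
    refine (((hasDerivAt_id p).pow 2).div_const (4 * σ ^ 2) |>.sub_const _).congr_deriv ?_
    simp; field_simp; ring
  | (n + 3) =>
    show HasDerivAt (fun p => -p ^ 3 / (8 * σ ^ 3) + 3 * p / (4 * σ ^ 2))
      (-3 * p ^ 2 / (8 * σ ^ 3) + 3 / (4 * σ ^ 2)) p
    refine ((((hasDerivAt_id p).pow 3).neg.div_const (8 * σ ^ 3)).add
      (((hasDerivAt_id p).const_mul 3).div_const (4 * σ ^ 2))).congr_deriv ?_
    simp

lemma kdq_deriv {σ : ℝ} (hσ : 0 < σ) (j : ℕ) (p : ℝ) : HasDerivAt (kdq j σ) (kddq j σ p) p := by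
  match j with
  | 0 => exact hasDerivAt_const p (0:ℝ)
  | 1 => exact hasDerivAt_const p (-1 / (2 * σ))
  | 2 =>
    show HasDerivAt (fun p => p / (2 * σ ^ 2)) (1 / (2 * σ ^ 2)) p
    exact (hasDerivAt_id p).div_const _
  | (n + 3) =>
    show HasDerivAt (fun p => -3 * p ^ 2 / (8 * σ ^ 3) + 3 / (4 * σ ^ 2))
      (-3 * p / (4 * σ ^ 3)) p
    refine (((((hasDerivAt_id p).pow 2).const_mul (-3)).div_const (8 * σ ^ 3)).add_const _).congr_deriv ?_
    simp; field_simp; ring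

lemma kq_sderiv {σ : ℝ} (hσ : 0 < σ) (j : ℕ) (p : ℝ) :
    HasDerivAt (fun σ => kq j σ p) (kddq j σ p - kdq j σ p * (p / σ)) σ := by
  have hne : σ ≠ 0 := hσ.ne'
  have hi := (hasDerivAt_id σ)
  match j with
  | 0 => simpa [kddq, kdq, kq] using hasDerivAt_const σ (1:ℝ)
  | 1 =>
    show HasDerivAt (fun σ => -p / (2 * σ)) (0 - -1 / (2 * σ) * (p / σ)) σ
    refine ((hasDerivAt_const σ (-p)).div (hi.const_mul 2) (by simpa using hne)).congr_deriv ?_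
    simp; field_simp
  | 2 =>
    show HasDerivAt (fun σ => p ^ 2 / (4 * σ ^ 2) - 1 / (2 * σ))
      (1 / (2 * σ ^ 2) - p / (2 * σ ^ 2) * (p / σ)) σ
    refine (((hasDerivAt_const σ (p ^ 2)).div ((hi.pow 2).const_mul 4) (by simpa using hne)).sub
      ((hasDerivAt_const σ (1:ℝ)).div (hi.const_mul 2) (by simpa using hne))).congr_deriv ?_
    simp; field_simp; ring
  | (n + 3) =>
    show HasDerivAt (fun σ => -p ^ 3 / (8 * σ ^ 3) + 3 * p / (4 * σ ^ 2))
      (-3 * p / (4 * σ ^ 3) - (-3 * p ^ 2 / (8 * σ ^ 3) + 3 / (4 * σ ^ 2)) * (p / σ)) σ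
    refine (((hasDerivAt_const σ (-p ^ 3)).div ((hi.pow 3).const_mul 8) (by simpa using hne)).add
      ((hasDerivAt_const σ (3 * p)).div ((hi.pow 2).const_mul 4) (by simpa using hne))).congr_deriv ?_
    simp; field_simp; ring

section
variable {d : ℕ}

lemma gk_pos {σ : ℝ} (hσ : 0 < σ) (y : ES d) : 0 < gk σ y := by
  unfold gk; positivity

lemma gk_line {σ : ℝ} (y b : ES d) :
    HasDerivAt (fun t : ℝ => gk σ (y + t • b)) (-(inner ℝ y b / (2 * σ)) * gk σ y) 0 := by
  have e : (fun t : ℝ => gk σ (y + t • b)) = fun t : ℝ => σ ^ (-(d:ℝ) / 2) *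
      exp (-((‖y‖ ^ 2 + 2 * (t * inner ℝ y b) + t ^ 2 * ‖b‖ ^ 2) / (4 * σ))) := by
    ext t
    unfold gk
    rw [norm_add_sq_real, inner_smul_right, norm_smul, mul_pow, Real.norm_eq_abs, sq_abs]
  rw [e]
  have hi := hasDerivAt_id (0:ℝ)
  refine (((((hi.mul_const (inner ℝ y b)).const_mul 2).const_add (‖y‖ ^ 2)).add
    ((hi.pow 2).mul_const (‖b‖ ^ 2))).div_const (4 * σ)).neg.exp.const_mul
      (σ ^ (-(d:ℝ) / 2)) |>.congr_deriv ?_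
  simp [gk]; ring

lemma inner_line (e y b : ES d) :
    HasDerivAt (fun t : ℝ => inner ℝ e (y + t • b)) (inner ℝ e b) 0 := by
  simp only [inner_add_right, inner_smul_right]
  simpa using ((hasDerivAt_id (0:ℝ)).mul_const (inner ℝ e b)).const_add (inner ℝ e y)

lemma inner_line' (y b : ES d) :
    HasDerivAt (fun t : ℝ => inner ℝ (y + t • b) b) (‖b‖ ^ 2) 0 := by
  simp only [inner_add_left, inner_smul_left, real_inner_self_eq_norm_sq]
  simpa using ((hasDerivAt_id (0:ℝ)).mul_const (‖b‖ ^ 2)).const_add (inner ℝ y b)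

lemma kq_line {σ : ℝ} (hσ : 0 < σ) (j : ℕ) (e y b : ES d) :
    HasDerivAt (fun t : ℝ => kq j σ (inner ℝ e (y + t • b))) (kdq j σ (inner ℝ e y) * inner ℝ e b) 0 := by
  refine HasDerivAt.comp (h₂ := kq j σ) 0 ?_ (inner_line e y b)
  simpa using kq_deriv hσ j (inner ℝ e y)

lemma kdq_line {σ : ℝ} (hσ : 0 < σ) (j : ℕ) (e y b : ES d) :
    HasDerivAt (fun t : ℝ => kdq j σ (inner ℝ e (y + t • b))) (kddq j σ (inner ℝ e y) * inner ℝ e b) 0 := by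
  refine HasDerivAt.comp (h₂ := kdq j σ) 0 ?_ (inner_line e y b)
  simpa using kdq_deriv hσ j (inner ℝ e y)

lemma Kn_line {σ : ℝ} (hσ : 0 < σ) (j : ℕ) (e b y : ES d) :
    HasLineDerivAt ℝ (Kn j σ e) (Kb j σ e b y) y b := by
  refine ((kq_line hσ j e y b).mul (gk_line y b)).congr_deriv ?_
  simp [Kb]; ring

lemma Kb_line {σ : ℝ} (hσ : 0 < σ) (j : ℕ) (e b y : ES d) :
    HasLineDerivAt ℝ (Kb j σ e b) (Kbb j σ e b y) y b := by
  refine ((((kdq_line hσ j e y b).mul_const (inner ℝ e b)).sub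
    ((kq_line hσ j e y b).mul ((inner_line' y b).div_const (2 * σ)))).mul (gk_line y b)).congr_deriv ?_
  simp [Kbb]; field_simp; ring

lemma Kb_self {σ : ℝ} (hσ : 0 < σ) {j : ℕ} (hj : j ≤ 2) (e : ES d) (he : ‖e‖ = 1) (y : ES d) :
    Kb j σ e e y = Kn (j + 1) σ e y := by
  have h1 : (inner ℝ e e : ℝ) = 1 := by rw [real_inner_self_eq_norm_sq, he]; norm_num
  unfold Kb Kn
  rw [h1, real_inner_comm]
  congr 1
  interval_cases j
  · simp [kq, kdq]; ring
  · simp [kq, kdq]; field_simp; ring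
  · simp [kq, kdq]; field_simp; ring

lemma gk_sderiv {σ : ℝ} (hσ : 0 < σ) (y : ES d) :
    HasDerivAt (fun σ => gk σ y) ((‖y‖ ^ 2 / (4 * σ ^ 2) - d / (2 * σ)) * gk σ y) σ := by
  have h1 : HasDerivAt (fun σ : ℝ => σ ^ (-(d:ℝ) / 2)) (-(d:ℝ) / 2 * σ ^ (-(d:ℝ) / 2 - 1)) σ :=
    Real.hasDerivAt_rpow_const (Or.inl hσ.ne')
  have h2 : HasDerivAt (fun σ : ℝ => exp (-(‖y‖ ^ 2 / (4 * σ))))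
      (exp (-(‖y‖ ^ 2 / (4 * σ))) * (‖y‖ ^ 2 / (4 * σ ^ 2))) σ := by
    refine ((hasDerivAt_const σ (‖y‖ ^ 2)).div ((hasDerivAt_id σ).const_mul 4)
      (by simpa using hσ.ne')).neg.exp.congr_deriv ?_
    simp; field_simp
  refine (h1.mul h2).congr_deriv ?_
  rw [Real.rpow_sub_one hσ.ne']
  unfold gk
  field_simp; ring

lemma sum_Kbb {σ : ℝ} (hσ : 0 < σ) (j : ℕ) (e y : ES d) (he : ‖e‖ = 1) :
    ∑ i : Fin d, Kbb j σ e (bv i) y = ((kddq j σ (inner ℝ e y) - kdq j σ (inner ℝ e y) * (inner ℝ e y / σ))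
      + kq j σ (inner ℝ e y) * (‖y‖ ^ 2 / (4 * σ ^ 2) - d / (2 * σ))) * gk σ y := by
  unfold Kbb
  rw [← Finset.sum_mul]
  congr 1
  have e1 := sum_bv_sq e
  have e2 := sum_bv_sq y
  have e3 := sum_bv_mul e y
  have key : ∀ a b c : ℝ, ∑ i : Fin d, (a * (inner ℝ e (bv i)) ^ 2 - b * inner ℝ e (bv i) * (inner ℝ y (bv i) / σ) +
      c * ((inner ℝ y (bv i)) ^ 2 / (4 * σ ^ 2) - ‖bv i‖ ^ 2 / (2 * σ))) =
      a * (∑ i : Fin d, (inner ℝ e (bv i)) ^ 2) - b / σ * (∑ i : Fin d, (inner ℝ e (bv i)) * (inner ℝ y (bv i))) +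
      c / (4 * σ ^ 2) * (∑ i : Fin d, (inner ℝ y (bv i)) ^ 2) - c / (2 * σ) * d := by
    intro a b c
    have : (d:ℝ) = ∑ i : Fin d, ‖(bv i : ES d)‖ ^ 2 := by simp [bv_norm]
    rw [this]
    simp only [Finset.mul_sum, ← Finset.sum_add_distrib, ← Finset.sum_sub_distrib]
    refine Finset.sum_congr rfl fun i _ => ?_
    field_simp; ring
  rw [key, e1, e2, e3, he]
  field_simp; ring

lemma Kn_sderiv {σ : ℝ} (hσ : 0 < σ) (j : ℕ) (e y : ES d) (he : ‖e‖ = 1) :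
    HasDerivAt (fun σ => Kn j σ e y) (∑ i : Fin d, Kbb j σ e (bv i) y) σ := by
  rw [sum_Kbb hσ j e y he]
  refine ((kq_sderiv hσ j (inner ℝ e y)).mul (gk_sderiv hσ y)).congr_deriv ?_
  ring

/-- dominating functions -/
def domf {d : ℕ} (a b : ℝ) (y : ES d) : ℝ :=
  a ^ (-(d:ℝ) / 2) * ((1 + ‖y‖ / √a) ^ 6 * exp (-(‖y‖ ^ 2 / (4 * b))))

lemma domf_mono {a b σ : ℝ} (ha : 0 < a) (h1 : a ≤ σ) (h2 : σ ≤ b) (y : ES d) :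
    domf σ σ y ≤ domf a b y := by
  have hσ : 0 < σ := ha.trans_le h1
  have h3 : σ ^ (-(d:ℝ) / 2) ≤ a ^ (-(d:ℝ) / 2) :=
    Real.rpow_le_rpow_of_nonpos ha h1 (by have := Nat.cast_nonneg (α := ℝ) d; linarith)
  have h5 : 0 < √a := by positivity
  unfold domf
  gcongr

lemma domf_nonneg {a b : ℝ} (ha : 0 < a) (y : ES d) : 0 ≤ domf a b y := by
  unfold domf; positivity

lemma domf_eq (σ : ℝ) (y : ES d) : domf σ σ y = (1 + ‖y‖ / √σ) ^ 6 * gk σ y := by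
  unfold domf gk; ring

lemma cont_gk (σ : ℝ) : Continuous (gk σ : ES d → ℝ) := by unfold gk; fun_prop

lemma cont_kq (j : ℕ) (σ : ℝ) : Continuous (kq j σ) := by
  match j with
  | 0 => exact continuous_const
  | 1 => show Continuous (fun p => -p / (2 * σ)); fun_prop
  | 2 => show Continuous (fun p => p ^ 2 / (4 * σ ^ 2) - 1 / (2 * σ)); fun_prop
  | (n + 3) => show Continuous (fun p => -p ^ 3 / (8 * σ ^ 3) + 3 * p / (4 * σ ^ 2)); fun_prop
lemma cont_kdq (j : ℕ) (σ : ℝ) : Continuous (kdq j σ) := by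
  match j with
  | 0 => exact continuous_const
  | 1 => exact continuous_const
  | 2 => show Continuous (fun p => p / (2 * σ ^ 2)); fun_prop
  | (n + 3) => show Continuous (fun p => -3 * p ^ 2 / (8 * σ ^ 3) + 3 / (4 * σ ^ 2)); fun_prop
lemma cont_kddq (j : ℕ) (σ : ℝ) : Continuous (kddq j σ) := by
  match j with
  | 0 => exact continuous_const
  | 1 => exact continuous_const
  | 2 => exact continuous_const
  | (n + 3) => show Continuous (fun p => -3 * p / (4 * σ ^ 3)); fun_prop

lemma cont_Kn (j : ℕ) (σ : ℝ) (e : ES d) : Continuous (Kn j σ e) := by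
  have h1 := cont_gk (d := d) σ
  have h2 := cont_kq j σ
  unfold Kn; fun_prop
lemma cont_Kb (j : ℕ) (σ : ℝ) (e b : ES d) : Continuous (Kb j σ e b) := by
  have h1 := cont_gk (d := d) σ
  have h2 := cont_kq j σ
  have h3 := cont_kdq j σ
  unfold Kb; fun_prop
lemma cont_Kbb (j : ℕ) (σ : ℝ) (e b : ES d) : Continuous (Kbb j σ e b) := by
  have h1 := cont_gk (d := d) σ
  have h2 := cont_kq j σ
  have h3 := cont_kdq j σ
  have h4 := cont_kddq j σ
  unfold Kbb; fun_prop

/-- bounds with scaling -/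
lemma kq_bd {s r p : ℝ} (hs : 0 < s) (hr : 0 ≤ r) (hp : |p| ≤ r * s) {j : ℕ} (hj : j ≤ 3) :
    |kq j (s ^ 2) p| ≤ (1 / s) ^ j * (1 + r) ^ 3 ∧ |kdq j (s ^ 2) p| ≤ (1 / s) ^ (j + 1) * (1 + r) ^ 2 ∧
    |kddq j (s ^ 2) p| ≤ (1 / s) ^ (j + 2) * (1 + r) := by
  obtain ⟨z, hz, rfl⟩ : ∃ z, |z| ≤ r ∧ p = z * s := by
    refine ⟨p / s, ?_, by field_simp⟩
    rw [abs_div, abs_of_pos hs, div_le_iff₀ hs]; exact hp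
  have hz0 := abs_nonneg z
  have e1 : ∀ (n : ℕ) (x c : ℝ), |x| ≤ c → |(1 / s) ^ n * x| ≤ (1 / s) ^ n * c := by
    intro n x c h
    rw [abs_mul, abs_of_nonneg (by positivity)]; gcongr
  have hr2 : |z| ^ 2 ≤ r ^ 2 := by gcongr
  have hr3 : |z| ^ 3 ≤ r ^ 3 := by gcongr
  have hp2 : 0 ≤ r ^ 2 := by positivity
  have hp3 : 0 ≤ r ^ 3 := by positivity
  have zz2 := sq_abs z
  have A1 : |(1:ℝ)| ≤ (1 + r) ^ 3 := by rw [abs_one]; nlinarith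
  have A2 : |-z / 2| ≤ (1 + r) ^ 3 := by rw [abs_div, abs_neg, abs_two]; nlinarith
  have A3 : |z ^ 2 / 4 - 1 / 2| ≤ (1 + r) ^ 3 := by rw [abs_le]; constructor <;> nlinarith
  have A4 : |-z ^ 3 / 8 + 3 * z / 4| ≤ (1 + r) ^ 3 := by
    have h1 : |-z ^ 3 / 8 + 3 * z / 4| ≤ |z| ^ 3 / 8 + 3 * |z| / 4 := by
      refine (abs_add_le _ _).trans (le_of_eq ?_)
      simp [abs_div, abs_mul, abs_pow]
    nlinarith
  have B1 : |(0:ℝ)| ≤ (1 + r) ^ 2 := by rw [abs_zero]; positivity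
  have B2 : |(-1 / 2 : ℝ)| ≤ (1 + r) ^ 2 := by rw [abs_le]; constructor <;> nlinarith
  have B3 : |z / 2| ≤ (1 + r) ^ 2 := by rw [abs_div, abs_two]; nlinarith
  have B4 : |-3 * z ^ 2 / 8 + 3 / 4| ≤ (1 + r) ^ 2 := by rw [abs_le]; constructor <;> nlinarith
  have C1 : |(0:ℝ)| ≤ 1 + r := by rw [abs_zero]; positivity
  have C3 : |(1 / 2 : ℝ)| ≤ 1 + r := by rw [abs_le]; constructor <;> linarith
  have C4 : |-3 * z / 4| ≤ 1 + r := by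
    rw [abs_div, abs_mul]; norm_num; linarith
  interval_cases j
  · refine ⟨?_, ?_, ?_⟩
    · simpa [kq] using A1
    · simpa [kdq] using e1 1 _ _ B1
    · simpa [kddq] using e1 2 _ _ C1
  · refine ⟨?_, ?_, ?_⟩
    · refine (le_of_eq ?_).trans (e1 1 _ _ A2); simp only [kq]; congr 1; field_simp
    · refine (le_of_eq ?_).trans (e1 2 _ _ B2); simp only [kdq]; congr 1; field_simp
    · refine (le_of_eq ?_).trans (e1 3 _ _ C1); simp only [kddq]; simp
  · refine ⟨?_, ?_, ?_⟩
    · refine (le_of_eq ?_).trans (e1 2 _ _ A3); simp only [kq]; congr 1; field_simp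
    · refine (le_of_eq ?_).trans (e1 3 _ _ B3); simp only [kdq]; congr 1; field_simp
    · refine (le_of_eq ?_).trans (e1 4 _ _ C3); simp only [kddq]; congr 1; field_simp
  · refine ⟨?_, ?_, ?_⟩
    · refine (le_of_eq ?_).trans (e1 3 _ _ A4); simp only [kq]; congr 1; field_simp
    · refine (le_of_eq ?_).trans (e1 4 _ _ B4); simp only [kdq]; congr 1; field_simp
    · refine (le_of_eq ?_).trans (e1 5 _ _ C4); simp only [kddq]; congr 1; field_simp

end
end

open MeasureTheory Real Set
open scoped ENNReal
noncomputable section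
section
variable {d : ℕ}

lemma ip_bd {s : ℝ} (hs : 0 < s) (y b : ES d) : |(inner ℝ y b : ℝ)| ≤ ‖b‖ * ((‖y‖ / s) * s) := by
  rw [div_mul_cancel₀ _ hs.ne', mul_comm]; exact abs_real_inner_le_norm y b

lemma Kn_bd {s : ℝ} (hs : 0 < s) {j : ℕ} (hj : j ≤ 3) {m : ℕ} (hm : m ≤ 2) (e : ES d) (he : ‖e‖ = 1) (y : ES d) :
    |Kn j (s ^ 2) e y| * ‖y‖ ^ m ≤ s ^ m * (1 / s) ^ j * domf (s ^ 2) (s ^ 2) y := by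
  rw [domf_eq, Real.sqrt_sq hs.le]
  set r := ‖y‖ / s with hr
  have hr0 : 0 ≤ r := by positivity
  have hy : ‖y‖ = s * r := by rw [hr]; field_simp
  have hp : |(inner ℝ e y : ℝ)| ≤ r * s := by
    have := abs_real_inner_le_norm e y
    rw [he, hy] at this; linarith
  have h1 := (kq_bd hs hr0 hp hj).1
  have hg := gk_pos (d := d) (show 0 < s ^ 2 by positivity) y
  unfold Kn
  rw [abs_mul, abs_of_pos hg]
  have h2 : r ^ m ≤ (1 + r) ^ 3 := by
    have h3 : r ^ m ≤ (1 + r) ^ m := by gcongr; linarith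
    exact h3.trans (pow_le_pow_right₀ (by linarith) (by omega))
  calc _ ≤ ((1 / s) ^ j * (1 + r) ^ 3) * gk (s ^ 2) y * (s * r) ^ m := by rw [hy]; gcongr
    _ = s ^ m * (1 / s) ^ j * (((1 + r) ^ 3 * r ^ m) * gk (s ^ 2) y) := by rw [mul_pow]; ring
    _ ≤ s ^ m * (1 / s) ^ j * (((1 + r) ^ 3 * (1 + r) ^ 3) * gk (s ^ 2) y) := by gcongr
    _ = _ := by ring

lemma Kb_bd {s : ℝ} (hs : 0 < s) {j : ℕ} (hj : j ≤ 3) (e b : ES d) (he : ‖e‖ = 1) (hb : ‖b‖ = 1) (y : ES d) :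
    |Kb j (s ^ 2) e b y| ≤ 2 * (1 / s) ^ (j + 1) * domf (s ^ 2) (s ^ 2) y := by
  rw [domf_eq, Real.sqrt_sq hs.le]
  set r := ‖y‖ / s with hr
  have hr0 : 0 ≤ r := by positivity
  have hy : ‖y‖ = s * r := by rw [hr]; field_simp
  have hp : |(inner ℝ e y : ℝ)| ≤ r * s := by
    have := abs_real_inner_le_norm e y
    rw [he, hy] at this; linarith
  have hp2 : |(inner ℝ y b : ℝ)| ≤ r * s := by
    have := abs_real_inner_le_norm y b
    rw [hb, hy] at this; linarith
  have hp3 : |(inner ℝ e b : ℝ)| ≤ 1 := by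
    have := abs_real_inner_le_norm e b
    rw [he, hb] at this; linarith
  obtain ⟨h1, h2, -⟩ := kq_bd hs hr0 hp hj
  have hg := gk_pos (d := d) (show 0 < s ^ 2 by positivity) y
  unfold Kb
  rw [abs_mul, abs_of_pos hg, ← mul_assoc]
  gcongr
  refine (abs_sub _ _).trans ?_
  rw [abs_mul, abs_mul, abs_div, abs_of_pos (show 0 < 2 * s ^ 2 by positivity)]
  have a1 : (1 + r) ^ 2 ≤ (1 + r) ^ 6 := pow_le_pow_right₀ (by linarith) (by omega)
  have a2 : (1 + r) ^ 3 * (r / 2) ≤ (1 + r) ^ 6 := by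
    calc _ ≤ (1 + r) ^ 3 * (1 + r) := by gcongr; linarith
      _ = (1 + r) ^ 4 := by ring
      _ ≤ _ := pow_le_pow_right₀ (by linarith) (by omega)
  calc _ ≤ (1 / s) ^ (j + 1) * (1 + r) ^ 2 * 1 + (1 / s) ^ j * (1 + r) ^ 3 * (r * s / (2 * s ^ 2)) := by
        gcongr
    _ = (1 / s) ^ (j + 1) * ((1 + r) ^ 2 + (1 + r) ^ 3 * (r / 2)) := by
        rw [pow_succ]; field_simp
    _ ≤ (1 / s) ^ (j + 1) * ((1 + r) ^ 6 + (1 + r) ^ 6) := by gcongr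
    _ = _ := by ring

lemma Kbb_bd {s : ℝ} (hs : 0 < s) {j : ℕ} (hj : j ≤ 3) (e b : ES d) (he : ‖e‖ = 1) (hb : ‖b‖ = 1) (y : ES d) :
    |Kbb j (s ^ 2) e b y| ≤ 3 * (1 / s) ^ (j + 2) * domf (s ^ 2) (s ^ 2) y := by
  rw [domf_eq, Real.sqrt_sq hs.le]
  set r := ‖y‖ / s with hr
  have hr0 : 0 ≤ r := by positivity
  have hy : ‖y‖ = s * r := by rw [hr]; field_simp
  have hp : |(inner ℝ e y : ℝ)| ≤ r * s := by
    have := abs_real_inner_le_norm e y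
    rw [he, hy] at this; linarith
  have hp2 : |(inner ℝ y b : ℝ)| ≤ r * s := by
    have := abs_real_inner_le_norm y b
    rw [hb, hy] at this; linarith
  have hp3 : |(inner ℝ e b : ℝ)| ≤ 1 := by
    have := abs_real_inner_le_norm e b
    rw [he, hb] at this; linarith
  obtain ⟨h1, h2, h3⟩ := kq_bd hs hr0 hp hj
  have hg := gk_pos (d := d) (show 0 < s ^ 2 by positivity) y
  unfold Kbb
  rw [abs_mul, abs_of_pos hg, ← mul_assoc]
  gcongr
  have hlast : |(inner ℝ y b) ^ 2 / (4 * (s ^ 2) ^ 2) - ‖b‖ ^ 2 / (2 * s ^ 2)| ≤ (r * s) ^ 2 / (4 * (s ^ 2) ^ 2) + 1 / (2 * s ^ 2) := by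
    refine (abs_sub _ _).trans ?_
    rw [hb, abs_of_nonneg (show 0 ≤ (inner ℝ y b) ^ 2 / (4 * (s ^ 2) ^ 2) by positivity), ← sq_abs,
      abs_of_nonneg (show 0 ≤ (1:ℝ) ^ 2 / (2 * s ^ 2) by positivity), one_pow]
    gcongr
  refine (abs_add_le _ _).trans ((add_le_add (abs_sub _ _) le_rfl).trans ?_)
  rw [abs_mul, abs_mul, abs_mul, abs_mul, abs_div, abs_of_pos (show 0 < s ^ 2 by positivity), abs_pow]
  have a1 : (1 + r) ≤ (1 + r) ^ 6 := le_self_pow₀ (by linarith) (by omega)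
  have a2 : (1 + r) ^ 2 * r ≤ (1 + r) ^ 6 := by
    calc _ ≤ (1 + r) ^ 2 * (1 + r) := by gcongr; linarith
      _ = (1 + r) ^ 3 := by ring
      _ ≤ _ := pow_le_pow_right₀ (by linarith) (by omega)
  have a3 : (1 + r) ^ 3 * (r ^ 2 / 4 + 1 / 2) ≤ (1 + r) ^ 6 := by
    calc _ ≤ (1 + r) ^ 3 * (1 + r) ^ 2 := by gcongr; nlinarith
      _ = (1 + r) ^ 5 := by ring
      _ ≤ _ := pow_le_pow_right₀ (by linarith) (by omega)
  calc _ ≤ (1 / s) ^ (j + 2) * (1 + r) * 1 ^ 2 + (1 / s) ^ (j + 1) * (1 + r) ^ 2 * 1 * (r * s / s ^ 2)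
        + (1 / s) ^ j * (1 + r) ^ 3 * ((r * s) ^ 2 / (4 * (s ^ 2) ^ 2) + 1 / (2 * s ^ 2)) := by
        gcongr
    _ = (1 / s) ^ (j + 2) * ((1 + r) + (1 + r) ^ 2 * r + (1 + r) ^ 3 * (r ^ 2 / 4 + 1 / 2)) := by
        rw [pow_succ, pow_succ]; field_simp
    _ ≤ (1 / s) ^ (j + 2) * ((1 + r) ^ 6 + (1 + r) ^ 6 + (1 + r) ^ 6) := by gcongr
    _ = _ := by ring

lemma int_gauss {b : ℝ} (hb : 0 < b) : Integrable (fun y : ES d => exp (-(b * ‖y‖ ^ 2))) := by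
  have h := (GaussianFourier.integrable_cexp_neg_mul_sq_norm_add (V := ES d) (b := (b:ℂ)) (by simpa using hb) 0 0).norm
  refine h.congr (Filter.Eventually.of_forall fun y => ?_)
  simp only [Complex.norm_exp]
  congr 1
  simp [← Complex.ofReal_pow, ← Complex.ofReal_mul, ← Complex.ofReal_neg]

lemma poly_exp {b c r : ℝ} (hb : 0 < b) (hc : 0 < c) (hr : 0 ≤ r) :
    (1 + r / c) ^ 6 * exp (-(2 * b * r ^ 2)) ≤ 8 * (6 * (1 / (b * c ^ 2)) ^ 3 * exp (b * c ^ 2)) * exp (-(b * r ^ 2)) := by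
  set z := r / c with hz
  have hz0 : 0 ≤ z := by positivity
  have hrz : r = z * c := by rw [hz]; field_simp
  have h1 : (1 + z) ^ 6 ≤ 8 * (1 + z ^ 2) ^ 3 := by
    have : (1 + z) ^ 2 ≤ 2 * (1 + z ^ 2) := by nlinarith [sq_nonneg (1 - z)]
    calc (1 + z) ^ 6 = ((1 + z) ^ 2) ^ 3 := by ring
      _ ≤ (2 * (1 + z ^ 2)) ^ 3 := by gcongr
      _ = _ := by ring
  have h2 := Real.pow_div_factorial_le_exp (b * c ^ 2 * (1 + z ^ 2)) (by positivity) 3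
  have h3 : (1 + z ^ 2) ^ 3 ≤ 6 * (1 / (b * c ^ 2)) ^ 3 * exp (b * c ^ 2 * (1 + z ^ 2)) := by
    have : (Nat.factorial 3 : ℝ) = 6 := by norm_num [Nat.factorial]
    rw [this, div_le_iff₀ (by norm_num)] at h2
    calc (1 + z ^ 2) ^ 3 = (1 / (b * c ^ 2)) ^ 3 * (b * c ^ 2 * (1 + z ^ 2)) ^ 3 := by field_simp
      _ ≤ (1 / (b * c ^ 2)) ^ 3 * (exp (b * c ^ 2 * (1 + z ^ 2)) * 6) := by gcongr
      _ = _ := by ring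
  calc _ ≤ 8 * (6 * (1 / (b * c ^ 2)) ^ 3 * exp (b * c ^ 2 * (1 + z ^ 2))) * exp (-(2 * b * r ^ 2)) := by
        gcongr; linarith
    _ = 8 * (6 * (1 / (b * c ^ 2)) ^ 3) * (exp (b * c ^ 2 * (1 + z ^ 2)) * exp (-(2 * b * r ^ 2))) := by ring
    _ = 8 * (6 * (1 / (b * c ^ 2)) ^ 3) * (exp (b * c ^ 2) * exp (-(b * r ^ 2))) := by
        rw [← exp_add, ← exp_add]; congr 2; rw [hrz]; ring
    _ = _ := by ring

lemma domf_int {a b : ℝ} (ha : 0 < a) (hb : 0 < b) : Integrable (domf a b : ES d → ℝ) := by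
  unfold domf
  refine Integrable.const_mul ?_ _
  refine Integrable.mono' ((int_gauss (d := d) (b := 1 / (8 * b)) (by positivity)).const_mul
    (8 * (6 * (1 / (1 / (8 * b) * (√a) ^ 2)) ^ 3 * exp (1 / (8 * b) * (√a) ^ 2)))) ?_ ?_
  · refine Continuous.aestronglyMeasurable ?_
    fun_prop
  · refine Filter.Eventually.of_forall fun y => ?_
    rw [Real.norm_of_nonneg (by positivity)]
    refine (le_of_eq ?_).trans (poly_exp (b := 1 / (8 * b)) (c := √a) (by positivity) (by positivity) (norm_nonneg y))
    congr 3
    field_simp; norm_num; ring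

def Zc (d : ℕ) : ℝ := ∫ y : ES d, domf 1 1 y
def Z0 (d : ℕ) : ℝ := ∫ y : ES d, gk 1 y

lemma scale_int (f : ES d → ℝ) {s : ℝ} (hs : 0 < s) :
    ∫ y, (s ^ 2) ^ (-(d:ℝ) / 2) * f (s⁻¹ • y) = ∫ y, f y := by
  rw [integral_const_mul, Measure.integral_comp_inv_smul]
  simp only [finrank_euclideanSpace, Fintype.card_fin, smul_eq_mul]
  rw [← mul_assoc, abs_of_pos (by positivity)]
  have : (s ^ 2) ^ (-(d:ℝ) / 2) * s ^ d = 1 := by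
    rw [← Real.rpow_natCast s 2, ← Real.rpow_mul hs.le, ← Real.rpow_natCast s d, ← Real.rpow_add hs]
    have : ((2:ℕ):ℝ) * (-(d:ℝ) / 2) + d = 0 := by push_cast; ring
    rw [this, Real.rpow_zero]
  rw [this, one_mul]

lemma domf_integral {s : ℝ} (hs : 0 < s) : ∫ y : ES d, domf (s ^ 2) (s ^ 2) y = Zc d := by
  rw [Zc, ← scale_int (domf 1 1) hs]
  congr 1
  ext y
  simp only [domf, Real.sqrt_sq hs.le, norm_smul, norm_inv, Real.norm_of_nonneg hs.le, Real.one_rpow, Real.sqrt_one]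
  have e1 : s⁻¹ * ‖y‖ / 1 = ‖y‖ / s := by field_simp
  have e2 : (s⁻¹ * ‖y‖) ^ 2 / (4 * 1) = ‖y‖ ^ 2 / (4 * s ^ 2) := by field_simp
  rw [e1, e2]; ring

lemma gk_scale {s : ℝ} (hs : 0 < s) (f : ES d → ℝ) : ∫ y, gk (s ^ 2) y * f y = ∫ y, gk 1 y * f (s • y) := by
  rw [← scale_int (fun y => gk 1 y * f (s • y)) hs]
  congr 1
  ext y
  simp only [gk, norm_smul, norm_inv, Real.norm_of_nonneg hs.le, Real.one_rpow, smul_smul, mul_inv_cancel₀ hs.ne', one_smul]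
  have : (s⁻¹ * ‖y‖) ^ 2 / (4 * 1) = ‖y‖ ^ 2 / (4 * s ^ 2) := by field_simp
  rw [this]; ring

lemma gk_le_domf {σ : ℝ} (hσ : 0 < σ) (y : ES d) : gk σ y ≤ domf σ σ y := by
  rw [domf_eq]
  have := gk_pos hσ y
  have h1 : 1 ≤ (1 + ‖y‖ / √σ) ^ 6 := one_le_pow₀ (by have : 0 ≤ ‖y‖ / √σ := by positivity
                                                      linarith)
  nlinarith

lemma gk_int {σ : ℝ} (hσ : 0 < σ) : Integrable (gk σ : ES d → ℝ) := by
  refine (domf_int (d := d) hσ hσ).mono' (cont_gk σ).aestronglyMeasurable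
    (Filter.Eventually.of_forall fun y => ?_)
  rw [Real.norm_of_nonneg (gk_pos hσ y).le]; exact gk_le_domf hσ y

lemma gk_integral {s : ℝ} (hs : 0 < s) : ∫ y : ES d, gk (s ^ 2) y = Z0 d := by
  have := gk_scale hs (fun _ : ES d => (1:ℝ))
  simpa [Z0] using this

lemma Z0_pos : 0 < Z0 d := by
  unfold Z0
  rw [integral_pos_iff_support_of_nonneg (fun y => (gk_pos one_pos y).le) (gk_int one_pos)]
  have : Function.support (gk 1 : ES d → ℝ) = univ := by
    ext y; simp [(gk_pos one_pos y).ne']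
  rw [this]; exact isOpen_univ.measure_pos _ univ_nonempty

lemma Z0_le : Z0 d ≤ Zc d := by
  unfold Z0 Zc
  exact integral_mono (gk_int one_pos) (domf_int one_pos one_pos) (fun y => gk_le_domf one_pos y)

lemma Zc_pos : 0 < Zc d := Z0_pos.trans_le Z0_le

end
end

open MeasureTheory Real Set
open scoped ENNReal
noncomputable section
section
variable {d : ℕ}

lemma int_mul_dom {k F : ES d → ℝ} (hk : Continuous k) (hF : Continuous F) {a b C B : ℝ} (ha : 0 < a) (hb : 0 < b)
    (hC : ∀ y, |k y| ≤ C * domf a b y) (hB : ∀ y, |F y| ≤ B) : Integrable (fun y => k y * F y) := by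
  refine ((domf_int (d := d) ha hb).const_mul (C * B)).mono' (hk.mul hF).aestronglyMeasurable
    (Filter.Eventually.of_forall fun y => ?_)
  rw [norm_mul, Real.norm_eq_abs, Real.norm_eq_abs]
  have h1 := hC y
  have h0 : 0 ≤ C * domf a b y := (abs_nonneg _).trans h1
  calc |k y| * |F y| ≤ (C * domf a b y) * B := by
        gcongr; exact hB y
    _ = _ := by ring

lemma Kn_bd' {σ : ℝ} (hσ : 0 < σ) {j : ℕ} (hj : j ≤ 3) (e : ES d) (he : ‖e‖ = 1) (y : ES d) :
    |Kn j σ e y| ≤ (1 / √σ) ^ j * domf σ σ y := by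
  have := Kn_bd (Real.sqrt_pos.2 hσ) hj (m := 0) (by norm_num) e he y
  rw [Real.sq_sqrt hσ.le] at this
  simpa using this

lemma Kb_bd' {σ : ℝ} (hσ : 0 < σ) {j : ℕ} (hj : j ≤ 3) (e b : ES d) (he : ‖e‖ = 1) (hb : ‖b‖ = 1) (y : ES d) :
    |Kb j σ e b y| ≤ 2 * (1 / √σ) ^ (j + 1) * domf σ σ y := by
  have := Kb_bd (Real.sqrt_pos.2 hσ) hj e b he hb y
  rwa [Real.sq_sqrt hσ.le] at this

lemma Kbb_bd' {σ : ℝ} (hσ : 0 < σ) {j : ℕ} (hj : j ≤ 3) (e b : ES d) (he : ‖e‖ = 1) (hb : ‖b‖ = 1) (y : ES d) :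
    |Kbb j σ e b y| ≤ 3 * (1 / √σ) ^ (j + 2) * domf σ σ y := by
  have := Kbb_bd (Real.sqrt_pos.2 hσ) hj e b he hb y
  rwa [Real.sq_sqrt hσ.le] at this

lemma Kn_int {σ : ℝ} (hσ : 0 < σ) {j : ℕ} (hj : j ≤ 3) (e : ES d) (he : ‖e‖ = 1) {F : ES d → ℝ}
    (hF : Continuous F) {B : ℝ} (hB : ∀ y, |F y| ≤ B) : Integrable (fun y => Kn j σ e y * F y) :=
  int_mul_dom (cont_Kn _ _ _) hF hσ hσ (Kn_bd' hσ hj e he) hB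

lemma ibp_gen {k k' F F' : ES d → ℝ} {b : ES d} {σ C C' B B' : ℝ} (hσ : 0 < σ) (hk : Continuous k)
    (hk' : Continuous k') (hF : Continuous F) (hF' : Continuous F')
    (hC : ∀ y, |k y| ≤ C * domf σ σ y) (hC' : ∀ y, |k' y| ≤ C' * domf σ σ y)
    (hB : ∀ y, |F y| ≤ B) (hB' : ∀ y, |F' y| ≤ B')
    (h1 : ∀ y, HasLineDerivAt ℝ k (k' y) y b) (h2 : ∀ y, HasLineDerivAt ℝ F (F' y) y b) :
    ∫ y, k' y * F y = - ∫ y, k y * F' y := by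
  have := integral_bilinear_hasLineDerivAt_right_eq_neg_left_of_integrable (μ := (volume : Measure (ES d)))
    (f := k) (f' := k') (g := F) (g' := F') (v := b) (B := ContinuousLinearMap.mul ℝ ℝ)
    (by simpa using int_mul_dom hk' hF hσ hσ hC' hB)
    (by simpa using int_mul_dom hk hF' hσ hσ hC hB')
    (by simpa using int_mul_dom hk hF hσ hσ hC hB) (fun y _ => h1 y) (fun y _ => h2 y)
  simp only [ContinuousLinearMap.mul_apply'] at this
  linarith

lemma ibp1 {F F' : ES d → ℝ} {e : ES d} {σ B B' : ℝ} (hσ : 0 < σ) {j : ℕ} (hj : j ≤ 2) (he : ‖e‖ = 1)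
    (hF : Continuous F) (hF' : Continuous F')
    (hB : ∀ y, |F y| ≤ B) (hB' : ∀ y, |F' y| ≤ B')
    (h2 : ∀ y, HasLineDerivAt ℝ F (F' y) y e) :
    ∫ y, Kn (j + 1) σ e y * F y = - ∫ y, Kn j σ e y * F' y := by
  have := ibp_gen hσ (cont_Kn j σ e) (cont_Kb j σ e e) hF hF' (Kn_bd' hσ (by omega) e he)
    (Kb_bd' hσ (by omega) e e he he) hB hB' (fun y => Kn_line hσ j e e y) h2
  simpa only [Kb_self hσ hj e he] using this

lemma int_Kn_const {e : ES d} {σ : ℝ} (hσ : 0 < σ) {j : ℕ} (hj : j ≤ 2) (he : ‖e‖ = 1) (c : ℝ) :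
    ∫ y, Kn (j + 1) σ e y * c = 0 := by
  rw [ibp1 (F := fun _ => c) (F' := fun _ => 0) (B := |c|) (B' := 0) hσ hj he continuous_const continuous_const
    (fun _ => le_rfl) (by simp) (fun y => hasDerivAt_const _ _)]
  simp

lemma lapl_cont {F : ES d → ℝ} (hF : ContDiff ℝ 2 F) : Continuous (lapl F) := by
  have : Continuous (fderiv ℝ (fderiv ℝ F)) := (hF.fderiv_right (m := 1) (by norm_num)).continuous_fderiv (by norm_num)
  have e : lapl F = fun x => ∑ i : Fin d, fderiv ℝ (fderiv ℝ F) x (bv i) (bv i) := by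
    ext x; exact lapl_eq F x
  rw [e]
  fun_prop

lemma ap1 {f : ES d → ℝ} {B : ℝ} {x b : ES d} (hB : ‖fderiv ℝ f x‖ ≤ B) (hb : ‖b‖ = 1) : |fderiv ℝ f x b| ≤ B := by
  have := (fderiv ℝ f x).le_opNorm b
  rw [hb, mul_one] at this
  exact this.trans hB

lemma ap2 {f : ES d → ℝ} {B : ℝ} {x b : ES d} (hB : ‖fderiv ℝ (fderiv ℝ f) x‖ ≤ B) (hb : ‖b‖ = 1) :
    |fderiv ℝ (fderiv ℝ f) x b b| ≤ B := by
  have := (fderiv ℝ (fderiv ℝ f) x).le_opNorm₂ b b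
  rw [hb, mul_one, mul_one] at this
  exact this.trans hB

lemma line1 {F : ES d → ℝ} (hF : Differentiable ℝ F) (b y : ES d) : HasLineDerivAt ℝ F (fderiv ℝ F y b) y b := by
  have := hasDerivAt_line hF y b 0
  simpa [HasLineDerivAt] using this
lemma line2 {F : ES d → ℝ} (hF : ContDiff ℝ 2 F) (b y : ES d) :
    HasLineDerivAt ℝ (fun y => fderiv ℝ F y b) (fderiv ℝ (fderiv ℝ F) y b b) y b := by
  have := hasDerivAt_line2 hF y b b 0
  simpa [HasLineDerivAt] using this

lemma cont_fd {F : ES d → ℝ} (hF : ContDiff ℝ 2 F) (b : ES d) : Continuous (fun y => fderiv ℝ F y b) := by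
  have := hF.continuous_fderiv (by norm_num)
  fun_prop
lemma cont_fdd {F : ES d → ℝ} (hF : ContDiff ℝ 2 F) (b : ES d) : Continuous (fun y => fderiv ℝ (fderiv ℝ F) y b b) := by
  have : Continuous (fderiv ℝ (fderiv ℝ F)) := (hF.fderiv_right (m := 1) (by norm_num)).continuous_fderiv (by norm_num)
  fun_prop

lemma ibp2 {F : ES d → ℝ} {e : ES d} {σ B0 B1 B2 : ℝ} (hσ : 0 < σ) {j : ℕ} (hj : j ≤ 3) (he : ‖e‖ = 1)
    (hF : ContDiff ℝ 2 F) (h0 : ∀ y, |F y| ≤ B0) (h1 : ∀ y, ‖fderiv ℝ F y‖ ≤ B1)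
    (h2 : ∀ y, ‖fderiv ℝ (fderiv ℝ F) y‖ ≤ B2) :
    ∫ y, (∑ i : Fin d, Kbb j σ e (bv i) y) * F y = ∫ y, Kn j σ e y * lapl F y := by
  simp only [lapl_eq, Finset.sum_mul, Finset.mul_sum]
  rw [integral_finsetSum, integral_finsetSum]
  · refine Finset.sum_congr rfl fun i _ => ?_
    rw [ibp_gen hσ (cont_Kb j σ e (bv i)) (cont_Kbb j σ e (bv i)) hF.continuous (cont_fd hF (bv i))
        (Kb_bd' hσ hj e (bv i) he (bv_norm i)) (Kbb_bd' hσ hj e (bv i) he (bv_norm i)) h0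
        (fun y => ap1 (h1 y) (bv_norm i)) (fun y => Kb_line hσ j e _ y)
        (fun y => line1 (hF.differentiable (by norm_num)) _ y),
      ibp_gen hσ (cont_Kn j σ e) (cont_Kb j σ e (bv i)) (cont_fd hF (bv i)) (cont_fdd hF (bv i))
        (Kn_bd' hσ hj e he) (Kb_bd' hσ hj e (bv i) he (bv_norm i))
        (fun y => ap1 (h1 y) (bv_norm i)) (fun y => ap2 (h2 y) (bv_norm i)) (fun y => Kn_line hσ j e _ y)
        (fun y => line2 hF _ y), neg_neg]
  · intro i _
    exact Kn_int hσ hj e he (cont_fdd hF (bv i)) (fun y => ap2 (h2 y) (bv_norm i))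
  · intro i _
    exact int_mul_dom (cont_Kbb j σ e (bv i)) hF.continuous hσ hσ (Kbb_bd' hσ hj e (bv i) he (bv_norm i)) h0

lemma int_bd {s : ℝ} (hs : 0 < s) {j : ℕ} (hj : j ≤ 3) {m : ℕ} (hm : m ≤ 2) (e : ES d) (he : ‖e‖ = 1)
    {F : ES d → ℝ} {B : ℝ} (hB0 : 0 ≤ B) (hB : ∀ y, |F y| ≤ B * ‖y‖ ^ m) :
    |∫ y, Kn j (s ^ 2) e y * F y| ≤ B * (s ^ m * (1 / s) ^ j) * Zc d := by
  rw [← domf_integral hs, ← integral_const_mul]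
  rw [← Real.norm_eq_abs]
  have hs2 : 0 < s ^ 2 := by positivity
  refine norm_integral_le_of_norm_le (μ := (volume : Measure (ES d))) ((domf_int (d := d) hs2 hs2).const_mul _)
    (Filter.Eventually.of_forall fun y => ?_)
  rw [norm_mul, Real.norm_eq_abs, Real.norm_eq_abs]
  have h1 := Kn_bd hs hj hm e he y
  calc |Kn j (s ^ 2) e y| * |F y| ≤ |Kn j (s ^ 2) e y| * (B * ‖y‖ ^ m) := by gcongr; exact hB y
    _ = B * (|Kn j (s ^ 2) e y| * ‖y‖ ^ m) := by ring
    _ ≤ B * (s ^ m * (1 / s) ^ j * domf (s ^ 2) (s ^ 2) y) := by gcongr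
    _ = _ := by ring

lemma heat_deriv {ν ε a t s₀ B0 B1 B2 Bt : ℝ} (hν : 0 < ν) (hε : 0 < ε) {u ut : ℝ → ES d → ℝ}
    (hs0 : s₀ ∈ Ioo a t) {j : ℕ} (hj : j ≤ 3) {e : ES d} (he : ‖e‖ = 1)
    (hu : ∀ s ∈ Ioo a t, ContDiff ℝ 2 (u s))
    (h0 : ∀ s ∈ Ioo a t, ∀ y, |u s y| ≤ B0)
    (h1 : ∀ s ∈ Ioo a t, ∀ y, ‖fderiv ℝ (u s) y‖ ≤ B1)
    (h2 : ∀ s ∈ Ioo a t, ∀ y, ‖fderiv ℝ (fderiv ℝ (u s)) y‖ ≤ B2)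
    (ht : ∀ s ∈ Ioo a t, ∀ y, |ut s y| ≤ Bt)
    (htc : ∀ s ∈ Ioo a t, Continuous (ut s))
    (hd : ∀ s ∈ Ioo a t, ∀ y, HasDerivAt (fun s => u s y) (ut s y) s) :
    HasDerivAt (fun s => ∫ y, Kn j (ν * (t - s) + ε) e y * u s y)
      (∫ y, Kn j (ν * (t - s₀) + ε) e y * (ut s₀ y - ν * lapl (u s₀) y)) s₀ := by
  have hσ : ∀ s ∈ Ioo a t, 0 < ν * (t - s) + ε := fun s hs => by
    have := mul_pos hν (sub_pos.2 hs.2); linarith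
  have hσa : ∀ s ∈ Ioo a t, ε ≤ ν * (t - s) + ε := fun s hs => by
    have := mul_pos hν (sub_pos.2 hs.2); linarith
  have hσb : ∀ s ∈ Ioo a t, ν * (t - s) + ε ≤ ν * (t - a) + ε := fun s hs => by
    have := hs.1; gcongr
  have hat : 0 < ν * (t - a) + ε := (hσ s₀ hs0).trans_le (hσb s₀ hs0)
  have hB00 : 0 ≤ B0 := (abs_nonneg _).trans (h0 s₀ hs0 0)
  have hBt0 : 0 ≤ Bt := (abs_nonneg _).trans (ht s₀ hs0 0)
  have hsq : ∀ s ∈ Ioo a t, 1 / √(ν * (t - s) + ε) ≤ 1 / √ε := fun s hs => by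
    have := hσa s hs
    gcongr
  have hsum : ∀ s ∈ Ioo a t, ∀ y, |∑ i : Fin d, Kbb j (ν * (t - s) + ε) e (bv i) y| ≤
      (d * (3 * (1 / √ε) ^ (j + 2))) * domf ε (ν * (t - a) + ε) y := by
    intro s hs y
    refine (Finset.abs_sum_le_sum_abs _ _).trans ?_
    have : ∀ i ∈ Finset.univ, |Kbb j (ν * (t - s) + ε) e (bv i) y| ≤ (3 * (1 / √ε) ^ (j + 2)) * domf ε (ν * (t - a) + ε) y := by
      intro i _
      refine (Kbb_bd' (hσ s hs) hj e (bv i) he (bv_norm i) y).trans ?_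
      have h3 := domf_mono hε (hσa s hs) (hσb s hs) y
      have h4 := hsq s hs
      have h5 := domf_nonneg (b := ν * (t - s) + ε) (hσ s hs) y
      gcongr
    refine (Finset.sum_le_card_nsmul _ _ _ this).trans (le_of_eq ?_)
    simp; ring
  have hK : ∀ s ∈ Ioo a t, ∀ y, |Kn j (ν * (t - s) + ε) e y| ≤
      (1 / √ε) ^ j * domf ε (ν * (t - a) + ε) y := by
    intro s hs y
    refine (Kn_bd' (hσ s hs) hj e he y).trans ?_
    have h3 := domf_mono hε (hσa s hs) (hσb s hs) y
    have h4 := hsq s hs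
    have h5 := domf_nonneg (b := ν * (t - s) + ε) (hσ s hs) y
    gcongr
  have hcs : ∀ s, Continuous fun y => ∑ i : Fin d, Kbb j (ν * (t - s) + ε) e (bv i) y := fun s =>
    continuous_finsetSum _ fun i _ => cont_Kbb j _ e (bv i)
  have hmain := hasDerivAt_integral_of_dominated_loc_of_deriv_le (μ := (volume : Measure (ES d)))
    (F := fun s y => Kn j (ν * (t - s) + ε) e y * u s y)
    (F' := fun s y => (-ν * ∑ i : Fin d, Kbb j (ν * (t - s) + ε) e (bv i) y) * u s y +
      Kn j (ν * (t - s) + ε) e y * ut s y) (x₀ := s₀) (s := Ioo a t)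
    (bound := fun y => (ν * (d * (3 * (1 / √ε) ^ (j + 2))) * B0 + (1 / √ε) ^ j * Bt) * domf ε (ν * (t - a) + ε) y)
    (Ioo_mem_nhds hs0.1 hs0.2)
    (Filter.mem_of_superset (Ioo_mem_nhds hs0.1 hs0.2) fun s hs =>
      ((cont_Kn j _ e).mul (hu s hs).continuous).aestronglyMeasurable)
    (Kn_int (hσ s₀ hs0) hj e he (hu s₀ hs0).continuous (h0 s₀ hs0))
    (((continuous_const.mul (hcs s₀)).mul (hu s₀ hs0).continuous).add
      ((cont_Kn j _ e).mul (htc s₀ hs0))).aestronglyMeasurable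
    (Filter.Eventually.of_forall fun y s hs => ?_)
    ((domf_int hε hat).const_mul _)
    (Filter.Eventually.of_forall fun y s hs => ?_)
  · refine hmain.2.congr_deriv ?_
    have i1 : Integrable (fun y => (∑ i : Fin d, Kbb j (ν * (t - s₀) + ε) e (bv i) y) * u s₀ y) :=
      int_mul_dom (hcs s₀) (hu s₀ hs0).continuous hε hat (hsum s₀ hs0) (h0 s₀ hs0)
    have i2 : Integrable (fun y => Kn j (ν * (t - s₀) + ε) e y * ut s₀ y) :=
      Kn_int (hσ s₀ hs0) hj e he (htc s₀ hs0) (ht s₀ hs0)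
    have i3 : Integrable (fun y => Kn j (ν * (t - s₀) + ε) e y * lapl (u s₀) y) :=
      Kn_int (hσ s₀ hs0) hj e he (lapl_cont (hu s₀ hs0)) (fun y => abs_lapl_le _ y _ (h2 s₀ hs0 y))
    have e1 : ∀ y, (-ν * ∑ i : Fin d, Kbb j (ν * (t - s₀) + ε) e (bv i) y) * u s₀ y +
      Kn j (ν * (t - s₀) + ε) e y * ut s₀ y = Kn j (ν * (t - s₀) + ε) e y * ut s₀ y -
        ν * ((∑ i : Fin d, Kbb j (ν * (t - s₀) + ε) e (bv i) y) * u s₀ y) := fun y => by ring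
    have e2 : ∀ y, Kn j (ν * (t - s₀) + ε) e y * (ut s₀ y - ν * lapl (u s₀) y) =
      Kn j (ν * (t - s₀) + ε) e y * ut s₀ y - ν * (Kn j (ν * (t - s₀) + ε) e y * lapl (u s₀) y) := fun y => by ring
    simp only [e1, e2]
    rw [integral_sub i2 (i1.const_mul _), integral_sub i2 (i3.const_mul _), integral_const_mul, integral_const_mul,
      ibp2 (hσ s₀ hs0) hj he (hu s₀ hs0) (h0 s₀ hs0) (h1 s₀ hs0) (h2 s₀ hs0)]
  · have b1 := hsum s hs y
    have b2 := hK s hs y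
    have hD := domf_nonneg (b := ν * (t - a) + ε) hε y
    have b3 := h0 s hs y
    have b4 := ht s hs y
    refine (norm_add_le _ _).trans ?_
    rw [norm_mul, norm_mul, norm_mul, norm_neg, Real.norm_of_nonneg hν.le]
    simp only [Real.norm_eq_abs]
    calc _ ≤ ν * ((d * (3 * (1 / √ε) ^ (j + 2))) * domf ε (ν * (t - a) + ε) y) * B0 +
          ((1 / √ε) ^ j * domf ε (ν * (t - a) + ε) y) * Bt := by gcongr
      _ = _ := by ring
  · have e1 : HasDerivAt (fun s => ν * (t - s) + ε) (-ν) s := by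
      simpa using (((hasDerivAt_id s).const_sub t).const_mul ν).add_const ε
    have e2 := HasDerivAt.comp (h₂ := fun σ => Kn j σ e y) s (Kn_sderiv (hσ s hs) j e y he) e1
    refine (e2.mul (hd s hs y)).congr_deriv ?_
    simp only [Function.comp_apply]; ring

lemma heat_cont {ν ε a t B0 : ℝ} (hν : 0 < ν) (hε : 0 < ε) {u : ℝ → ES d → ℝ}
    {j : ℕ} (hj : j ≤ 3) {e : ES d} (he : ‖e‖ = 1) (hat' : a ≤ t)
    (hu : ∀ s ∈ Icc a t, Continuous (u s))
    (h0 : ∀ s ∈ Icc a t, ∀ y, |u s y| ≤ B0)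
    (hc : ∀ y, ContinuousOn (fun s => u s y) (Icc a t)) :
    ContinuousOn (fun s => ∫ y, Kn j (ν * (t - s) + ε) e y * u s y) (Icc a t) := by
  have hσa : ∀ s ∈ Icc a t, ε ≤ ν * (t - s) + ε := fun s hs => by
    have := mul_nonneg hν.le (sub_nonneg.2 hs.2); linarith
  have hσ : ∀ s ∈ Icc a t, 0 < ν * (t - s) + ε := fun s hs => hε.trans_le (hσa s hs)
  have hσb : ∀ s ∈ Icc a t, ν * (t - s) + ε ≤ ν * (t - a) + ε := fun s hs => by
    have := hs.1; gcongr
  have hat : 0 < ν * (t - a) + ε := hσ a ⟨le_rfl, hat'⟩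
  refine continuousOn_of_dominated (bound := fun y => (1 / √ε) ^ j * domf ε (ν * (t - a) + ε) y * B0)
    (fun s hs => ((cont_Kn j _ e).mul (hu s hs)).aestronglyMeasurable)
    (fun s hs => Filter.Eventually.of_forall fun y => ?_)
    (((domf_int hε hat).const_mul _).mul_const _)
    (Filter.Eventually.of_forall fun y => ?_)
  · rw [norm_mul, Real.norm_eq_abs, Real.norm_eq_abs]
    have b1 := h0 s hs y
    have h3 := domf_mono hε (hσa s hs) (hσb s hs) y
    have h5 := domf_nonneg (b := ν * (t - s) + ε) (hσ s hs) y
    have h4 : 1 / √(ν * (t - s) + ε) ≤ 1 / √ε := by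
      have := hσa s hs
      gcongr
    have h6 := domf_nonneg (b := ν * (t - a) + ε) hε y
    have b2 : |Kn j (ν * (t - s) + ε) e y| ≤ (1 / √ε) ^ j * domf ε (ν * (t - a) + ε) y := by
      refine (Kn_bd' (hσ s hs) hj e he y).trans ?_
      gcongr
    gcongr
  · refine ContinuousOn.mul ?_ (hc y)
    intro s hs
    have e1 : ContinuousAt (fun s => ν * (t - s) + ε) s := by fun_prop
    exact (ContinuousAt.comp (f := fun s => ν * (t - s) + ε) (g := fun σ => Kn j σ e y)
      (Kn_sderiv (hσ s hs) j e y he).continuousAt e1).continuousWithinAt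

lemma gk_lim {f : ES d → ℝ} (hf : Continuous f) {B : ℝ} (hB : ∀ y, |f y| ≤ B) :
    Filter.Tendsto (fun s : ℝ => ∫ y, gk (s ^ 2) y * f y) (nhdsWithin 0 (Ioi 0)) (nhds (Z0 d * f 0)) := by
  have h1 : Filter.Tendsto (fun s : ℝ => ∫ y : ES d, gk 1 y * f (s • y)) (nhdsWithin 0 (Ioi 0)) (nhds (∫ y : ES d, gk 1 y * f 0)) := by
    refine tendsto_integral_filter_of_dominated_convergence (fun y : ES d => gk 1 y * B) ?_ ?_ ?_ ?_
    · refine Filter.Eventually.of_forall fun s => Continuous.aestronglyMeasurable ?_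
      have := cont_gk (d := d) 1
      fun_prop
    · refine Filter.Eventually.of_forall fun s => Filter.Eventually.of_forall fun y => ?_
      have := gk_pos one_pos y
      rw [norm_mul, Real.norm_of_nonneg this.le]
      gcongr; exact hB _
    · exact (gk_int one_pos).mul_const _
    · refine Filter.Eventually.of_forall fun y => ?_
      have : Continuous fun s : ℝ => gk 1 y * f (s • y) := by fun_prop
      simpa using (this.tendsto 0).mono_left nhdsWithin_le_nhds
  rw [integral_mul_const] at h1
  refine h1.congr' ?_
  filter_upwards [self_mem_nhdsWithin] with s hs
  exact (gk_scale hs f).symm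

/-- comparison -/
lemma duh_cmp {m m' : ℝ → ℝ} {a t ν ε D : ℝ} (hν : 0 < ν) (hε : 0 < ε) (hat : a ≤ t) (hD : 0 ≤ D)
    (hc : ContinuousOn m (Icc a t)) (hd : ∀ s ∈ Ioo a t, HasDerivAt m (m' s) s)
    (hb : ∀ s ∈ Ioo a t, |m' s| ≤ D * (1 / √(ν * (t - s) + ε))) :
    |m t - m a| ≤ 2 * D / ν * √(ν * (t - a) + ε) := by
  have hσa : ∀ s ∈ Icc a t, ε ≤ ν * (t - s) + ε := fun s hs => by
    have := mul_nonneg hν.le (sub_nonneg.2 hs.2); linarith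
  have key : ∀ (m m' : ℝ → ℝ), ContinuousOn m (Icc a t) → (∀ s ∈ Ioo a t, HasDerivAt m (m' s) s) →
      (∀ s ∈ Ioo a t, m' s ≤ D * (1 / √(ν * (t - s) + ε))) → m t - m a ≤ 2 * D / ν * √(ν * (t - a) + ε) := by
    intro m m' hc hd hb
    have hψ : ∀ s ∈ Icc a t, HasDerivAt (fun s => 2 * D / ν * √(ν * (t - s) + ε)) (- (D * (1 / √(ν * (t - s) + ε)))) s := by
      intro s hs
      have hp : 0 < ν * (t - s) + ε := hε.trans_le (hσa s hs)
      have e1 : HasDerivAt (fun s => ν * (t - s) + ε) (-ν) s := by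
        simpa using (((hasDerivAt_id s).const_sub t).const_mul ν).add_const ε
      refine ((e1.sqrt hp.ne').const_mul (2 * D / ν)).congr_deriv ?_
      have : 0 < √(ν * (t - s) + ε) := Real.sqrt_pos.2 hp
      field_simp
    have hanti : AntitoneOn (fun s => m s + 2 * D / ν * √(ν * (t - s) + ε)) (Icc a t) := by
      refine antitoneOn_of_deriv_nonpos (convex_Icc a t) (hc.add fun s hs => (hψ s hs).continuousAt.continuousWithinAt) ?_ ?_
      · rw [interior_Icc]
        intro s hs
        exact ((hd s hs).add (hψ s (Ioo_subset_Icc_self hs))).differentiableAt.differentiableWithinAt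
      · rw [interior_Icc]
        intro s hs
        have e := (hd s hs).add (hψ s (Ioo_subset_Icc_self hs))
        have e' := e.deriv
        have := hb s hs
        calc _ = _ := e'
          _ ≤ 0 := by linarith
    have := hanti (left_mem_Icc.2 hat) (right_mem_Icc.2 hat) hat
    simp only at this
    have h0 : 0 ≤ 2 * D / ν * √(ν * (t - t) + ε) := by positivity
    linarith
  rw [abs_le]
  constructor
  · have := key (fun s => - m s) (fun s => - m' s) hc.neg (fun s hs => (hd s hs).neg)
      (fun s hs => (neg_le_abs _).trans (hb s hs))
    linarith
  · exact key m m' hc hd (fun s hs => (le_abs_self _).trans (hb s hs))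
end
end

open MeasureTheory Real Set
open scoped ENNReal
noncomputable section
section
variable {d : ℕ} {V : ES d → ℝ} {W : ℝ → ℝ} {ν lam T : ℝ} {h : ℝ → ES d → ℝ}

lemma fdd_shift (f : ES d → ℝ) (y x : ES d) :
    fderiv ℝ (fderiv ℝ (fun x => f (x + y))) x = fderiv ℝ (fderiv ℝ f) (x + y) := by
  have : fderiv ℝ (fun x => f (x + y)) = fun x => fderiv ℝ f (x + y) := by
    ext1 x; exact fderiv_shift f y x
  rw [this]
  exact fderiv_comp_add_right y

lemma grad_cont {f : ES d → ℝ} (hf : ContDiff ℝ 2 f) : Continuous (gradient f) := by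
  have := hf.continuous_fderiv (by norm_num)
  unfold gradient
  fun_prop

lemma duh_cont (hS : Sol ν lam T V h) (hν : 0 < ν) {ε : ℝ} (hε : 0 < ε) {a t : ℝ} (ha : 0 ≤ a) (hat : a ≤ t)
    (htT : t ≤ T) {j : ℕ} (hj : j ≤ 3) {e : ES d} (he : ‖e‖ = 1) (x : ES d) :
    ContinuousOn (fun s => ∫ y, Kn j (ν * (t - s) + ε) e y * h s (y + x)) (Icc a t) := by
  obtain ⟨C, hC0, hC⟩ := hS.b0
  have hsub : ∀ s ∈ Icc a t, s ∈ Icc 0 T := fun s hs => ⟨ha.trans hs.1, hs.2.trans htT⟩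
  refine heat_cont (u := fun s y => h s (y + x)) hν hε hj he hat (B0 := C) (fun s hs => ?_)
    (fun s hs y => hC s (hsub s hs) _) (fun y => ?_)
  · have h1 : Continuous fun y : ES d => (s, y + x) := by fun_prop
    have := hS.c.comp h1.continuousOn (s := univ) (fun y _ => ⟨hsub s hs, mem_univ _⟩)
    exact continuousOn_univ.1 this
  · have h1 : Continuous fun s : ℝ => (s, y + x) := by fun_prop
    exact hS.c.comp h1.continuousOn (fun s hs => ⟨hsub s hs, mem_univ _⟩)

lemma duh_deriv (hV : IsDepositionRate d V W) (hS : Sol ν lam T V h) (hν : 0 < ν) (hlam : 0 < lam)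
    {ε : ℝ} (hε : 0 < ε) {a t : ℝ} (ha : 0 ≤ a)
    (htT : t ≤ T) {j : ℕ} (hj : j ≤ 3) {e : ES d} (he : ‖e‖ = 1) (x : ES d) {s : ℝ} (hs : s ∈ Ioo a t) :
    HasDerivAt (fun s => ∫ y, Kn j (ν * (t - s) + ε) e y * h s (y + x))
      (∫ y, Kn j (ν * (t - s) + ε) e y * (lam * V (gradient (h s) (y + x)))) s := by
  obtain ⟨C, hC0, hC⟩ := hS.b0
  obtain ⟨K, hK0, hK⟩ := hS.b1
  obtain ⟨M, hM0, hM⟩ := hS.b2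
  have hsub : ∀ s ∈ Ioo a t, s ∈ Ioc 0 T := fun s hs => ⟨ha.trans_lt hs.1, hs.2.le.trans htT⟩
  have := heat_deriv (u := fun s y => h s (y + x))
    (ut := fun s y => ν * lapl (h s) (y + x) + lam * V (gradient (h s) (y + x))) hν hε hs hj he (B0 := C) (B1 := K)
    (B2 := M) (Bt := ν * (d * M) + lam * K ^ 2)
    (fun s hs => contDiff_shift (n := 2) (hS.c2 s (hsub s hs)) x)
    (fun s hs y => hC s (Ioc_subset_Icc_self (hsub s hs)) _)
    (fun s hs y => by rw [fderiv_shift]; exact hK s (hsub s hs) _)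
    (fun s hs y => by rw [fdd_shift]; exact hM s (hsub s hs) _)
    (fun s hs y => ?_) (fun s hs => ?_) (fun s hs y => hS.ht s (hsub s hs) _)
  · refine this.congr_deriv ?_
    simp only [lapl_comp_add, add_sub_cancel_left]
  · have h1 := abs_lapl_le _ (y + x) _ (hM s (hsub s hs) (y + x))
    have h2 := V_le hV (gradient (h s) (y + x))
    have h3 := V_nonneg hV (gradient (h s) (y + x))
    have h4 := hK s (hsub s hs) (y + x)
    rw [← norm_grad] at h4
    refine (abs_add_le _ _).trans ?_
    rw [abs_mul, abs_mul, abs_of_pos hν, abs_of_pos hlam, abs_of_nonneg h3]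
    have h5 : ‖gradient (h s) (y + x)‖ ^ 2 ≤ K ^ 2 := by gcongr
    gcongr
    linarith
  · have h1 := lapl_cont (hS.c2 s (hsub s hs))
    have h2 := grad_cont (hS.c2 s (hsub s hs))
    have h3 := hV.smooth.continuous
    fun_prop

lemma Kn_zero (σ : ℝ) (e y : ES d) : Kn 0 σ e y = gk σ y := by simp [Kn, kq]

lemma int_Kn2 {f : ES d → ℝ} (hf : ContDiff ℝ 2 f) {B0 B1 B2 : ℝ} (h0 : ∀ y, |f y| ≤ B0)
    (h1 : ∀ y, ‖fderiv ℝ f y‖ ≤ B1) (h2 : ∀ y, ‖fderiv ℝ (fderiv ℝ f) y‖ ≤ B2) {j : ℕ} (hj : j ≤ 1)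
    {σ : ℝ} (hσ : 0 < σ) {e : ES d} (he : ‖e‖ = 1) (x : ES d) :
    ∫ y, Kn (j + 2) σ e y * f (y + x) = ∫ y, Kn j σ e y * fderiv ℝ (fderiv ℝ f) (y + x) e e := by
  have hf' : ContDiff ℝ 2 fun y => f (y + x) := contDiff_shift (n := 2) hf x
  have e1 := ibp1 (F := fun y => f (y + x)) (F' := fun y => fderiv ℝ f (y + x) e) hσ (show j + 1 ≤ 2 by omega) he
    hf'.continuous ((cont_fd hf e).comp (continuous_id.add continuous_const)) (fun y => h0 _)
    (fun y => ap1 (h1 (y + x)) he) (fun y => by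
      have := line1 (hf'.differentiable (by norm_num)) e y
      rwa [fderiv_shift] at this)
  have e2 := ibp1 (F := fun y => fderiv ℝ f (y + x) e) (F' := fun y => fderiv ℝ (fderiv ℝ f) (y + x) e e) hσ
    (show j ≤ 2 by omega) he
    ((cont_fd hf e).comp (continuous_id.add continuous_const))
    ((cont_fdd hf e).comp (continuous_id.add continuous_const))
    (fun y => ap1 (h1 (y + x)) he) (fun y => ap2 (h2 (y + x)) he) (fun y => by
      have := line2 hf' e y
      simpa only [fderiv_shift, fdd_shift] using this)
  rw [e1, e2, neg_neg]

lemma int_Kn1 {f : ES d → ℝ} (hf : ContDiff ℝ 2 f) {B0 B1 : ℝ} (h0 : ∀ y, |f y| ≤ B0)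
    (h1 : ∀ y, ‖fderiv ℝ f y‖ ≤ B1) {j : ℕ} (hj : j ≤ 2)
    {σ : ℝ} (hσ : 0 < σ) {e : ES d} (he : ‖e‖ = 1) (x : ES d) :
    ∫ y, Kn (j + 1) σ e y * f (y + x) = - ∫ y, Kn j σ e y * fderiv ℝ f (y + x) e := by
  have hf' : ContDiff ℝ 2 fun y => f (y + x) := contDiff_shift (n := 2) hf x
  exact ibp1 (F := fun y => f (y + x)) (F' := fun y => fderiv ℝ f (y + x) e) hσ hj he
    hf'.continuous ((cont_fd hf e).comp (continuous_id.add continuous_const)) (fun y => h0 _)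
    (fun y => ap1 (h1 (y + x)) he) (fun y => by
      have := line1 (hf'.differentiable (by norm_num)) e y
      rwa [fderiv_shift] at this)

lemma lim_bd {f : ES d → ℝ} (hf : Continuous f) {B S c b : ℝ} (hB : ∀ y, |f y| ≤ B)
    (hle : ∀ s : ℝ, 0 < s → |∫ y, gk (s ^ 2) y * f y| ≤ S + c * √(b + s ^ 2)) :
    Z0 d * |f 0| ≤ S + c * √b := by
  have h1 := (gk_lim hf hB).abs
  rw [abs_mul, abs_of_pos Z0_pos] at h1
  have h2 : Filter.Tendsto (fun s : ℝ => S + c * √(b + s ^ 2)) (nhdsWithin 0 (Ioi 0)) (nhds (S + c * √b)) := by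
    have : Continuous fun s : ℝ => S + c * √(b + s ^ 2) := by fun_prop
    simpa using (this.tendsto 0).mono_left nhdsWithin_le_nhds
  refine le_of_tendsto_of_tendsto h1 h2 ?_
  filter_upwards [self_mem_nhdsWithin] with s hs
  exact hle s hs

lemma int_bd' {σ : ℝ} (hσ : 0 < σ) {j : ℕ} (hj : j ≤ 3) {m : ℕ} (hm : m ≤ 2) (e : ES d) (he : ‖e‖ = 1)
    {F : ES d → ℝ} {B : ℝ} (hB0 : 0 ≤ B) (hB : ∀ y, |F y| ≤ B * ‖y‖ ^ m) :
    |∫ y, Kn j σ e y * F y| ≤ B * (√σ ^ m * (1 / √σ) ^ j) * Zc d := by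
  have := int_bd (Real.sqrt_pos.2 hσ) hj hm e he hB0 hB
  rwa [Real.sq_sqrt hσ.le] at this

lemma step2 (hV : IsDepositionRate d V W) (hS : Sol ν lam T V h) (hν : 0 < ν) (hlam : 0 < lam)
    {a t K M S : ℝ} (ha : 0 ≤ a) (hat : a < t) (htT : t ≤ T) {e : ES d} (he : ‖e‖ = 1) (x : ES d)
    (hK0 : 0 ≤ K) (hM0 : 0 ≤ M)
    (hK : ∀ s ∈ Ioo a t, ∀ y, ‖fderiv ℝ (h s) y‖ ≤ K)
    (hM : ∀ s ∈ Ioo a t, ∀ y, ‖fderiv ℝ (fderiv ℝ (h s)) y‖ ≤ M)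
    (hst : ∀ σ, ν * (t - a) ≤ σ → |∫ y, Kn 2 σ e y * h a (y + x)| ≤ S) :
    Z0 d * |fderiv ℝ (fderiv ℝ (h t)) x e e| ≤ S + 8 * lam * K * M * Zc d / ν * √(ν * (t - a)) := by
  obtain ⟨C, hC0, hC⟩ := hS.b0
  obtain ⟨K', hK0', hK'⟩ := hS.b1
  obtain ⟨M', hM0', hM'⟩ := hS.b2
  have ht : t ∈ Ioc 0 T := ⟨ha.trans_lt hat, htT⟩
  have hZ := Zc_pos (d := d)
  have := lim_bd (f := fun y => fderiv ℝ (fderiv ℝ (h t)) (y + x) e e) (B := M') (S := S)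
    (c := 8 * lam * K * M * Zc d / ν) (b := ν * (t - a))
    ((cont_fdd (hS.c2 t ht) e).comp (continuous_id.add continuous_const)) (fun y => ap2 (hM' t ht _) he) ?_
  · simpa using this
  intro s hs
  have hε : 0 < s ^ 2 := by positivity
  have e1 := int_Kn2 (hS.c2 t ht) (fun y => hC t (Ioc_subset_Icc_self ht) y) (hK' t ht) (hM' t ht) (j := 0) (by norm_num)
    hε he x
  simp only [Kn_zero, zero_add] at e1
  have hcmp := duh_cmp (D := 4 * lam * K * M * Zc d) hν hε hat.le (by positivity)
    (duh_cont hS hν hε ha hat.le htT (j := 2) (by norm_num) he x)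
    (fun r hr => duh_deriv hV hS hν hlam hε ha htT (by norm_num) he x hr) ?_
  · simp only [sub_self, mul_zero, zero_add, e1] at hcmp
    have h2 := hst (ν * (t - a) + s ^ 2) (by linarith)
    have h3 := abs_sub_abs_le_abs_sub (∫ y, gk (s ^ 2) y * fderiv ℝ (fderiv ℝ (h t)) (y + x) e e)
      (∫ y, Kn 2 (ν * (t - a) + s ^ 2) e y * h a (y + x))
    have h4 : 2 * (4 * lam * K * M * Zc d) / ν * √(ν * (t - a) + s ^ 2) =
      8 * lam * K * M * Zc d / ν * √(ν * (t - a) + s ^ 2) := by ring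
    linarith
  · intro r hr
    have hr' : r ∈ Ioc 0 T := ⟨ha.trans_lt hr.1, hr.2.le.trans htT⟩
    have hσ : 0 < ν * (t - r) + s ^ 2 := by have := mul_pos hν (sub_pos.2 hr.2); linarith
    set σ := ν * (t - r) + s ^ 2 with hσd
    have hgc := grad_cont (hS.c2 r hr')
    have hVc := hV.smooth.continuous
    have hb : ∀ p, |lam * V (gradient (h r) p)| ≤ lam * K ^ 2 := by
      intro p
      have h2 := V_le hV (gradient (h r) p)
      have h3 := V_nonneg hV (gradient (h r) p)
      have h4 := hK r hr p
      rw [← norm_grad] at h4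
      rw [abs_mul, abs_of_pos hlam, abs_of_nonneg h3]
      have h5 : ‖gradient (h r) p‖ ^ 2 ≤ K ^ 2 := by gcongr
      gcongr
      linarith
    have i1 := Kn_int hσ (j := 2) (by norm_num) e he (F := fun y => lam * V (gradient (h r) (y + x))) (by fun_prop)
      (fun y => hb _)
    have i2 := Kn_int hσ (j := 2) (by norm_num) e he (F := fun y => lam * V (gradient (h r) x)) (by fun_prop)
      (fun y => hb _)
    have e3 : ∫ y, Kn 2 σ e y * (lam * V (gradient (h r) (y + x))) =
        ∫ y, Kn 2 σ e y * (lam * V (gradient (h r) (y + x)) - lam * V (gradient (h r) x)) := by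
      simp only [mul_sub]
      rw [integral_sub i1 i2, int_Kn_const hσ (by norm_num) he, sub_zero]
    rw [e3]
    have h6 := int_bd' hσ (j := 2) (by norm_num) (m := 1) (by norm_num) e he
      (F := fun y => lam * V (gradient (h r) (y + x)) - lam * V (gradient (h r) x)) (B := lam * (4 * K * M)) (by positivity) ?_
    · refine h6.trans (le_of_eq ?_)
      have : 0 < √σ := Real.sqrt_pos.2 hσ
      field_simp
    · intro y
      rw [← mul_sub, abs_mul, abs_of_pos hlam, mul_assoc]
      have h7 := V_lip hV (p := gradient (h r) (y + x)) (p' := gradient (h r) x) (R := K)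
        (by rw [norm_grad]; exact hK r hr _) (by rw [norm_grad]; exact hK r hr _)
      have h8 := fderiv_lip (hS.c2 r hr') (hM r hr) x (y + x)
      rw [grad_sub_norm] at h7
      rw [add_sub_cancel_right] at h8
      have : |V (gradient (h r) (y + x)) - V (gradient (h r) x)| ≤ 4 * K * (M * ‖y‖) := by
        refine h7.trans ?_
        gcongr
      rw [pow_one]
      gcongr
      linarith

lemma absorb {ι : Type*} [Nonempty ι] {f : ι → ℝ} {a : ℝ} (hb : ∃ C, ∀ i, f i ≤ C)
    (h : ∀ N, (∀ i, f i ≤ N) → ∀ i, f i ≤ a + N / 2) : ∀ i, f i ≤ 2 * a := by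
  obtain ⟨C, hC⟩ := hb
  have hbd : BddAbove (range f) := ⟨C, by rintro _ ⟨i, rfl⟩; exact hC i⟩
  have h1 := h (⨆ i, f i) (fun i => le_ciSup hbd i)
  have h2 := ciSup_le h1
  intro i
  have := le_ciSup hbd i
  linarith

lemma bil_polar {B : ES d →L[ℝ] ES d →L[ℝ] ℝ} (hs : ∀ u v, B u v = B v u) {C : ℝ} (hC0 : 0 ≤ C)
    (hC : ∀ e, ‖e‖ = 1 → |B e e| ≤ C) : ‖B‖ ≤ C := by
  have h1 : ∀ v, |B v v| ≤ C * ‖v‖ ^ 2 := by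
    intro v
    rcases eq_or_ne v 0 with rfl | hv
    · simp
    have hn : 0 < ‖v‖ := norm_pos_iff.2 hv
    have := hC (‖v‖⁻¹ • v) (by rw [norm_smul, norm_inv, norm_norm, inv_mul_cancel₀ hn.ne'])
    simp only [map_smul, smul_apply, smul_eq_mul] at this
    rw [abs_mul, abs_mul, abs_inv, abs_of_pos hn] at this
    field_simp at this
    linarith
  refine ContinuousLinearMap.opNorm_le_of_unit_norm hC0 fun u hu => ?_
  refine ContinuousLinearMap.opNorm_le_of_unit_norm hC0 fun v hv => ?_
  have e1 : 4 * B u v = B (u + v) (u + v) - B (u - v) (u - v) := by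
    simp only [map_add, map_sub, add_apply, sub_apply, hs v u]
    ring
  have h2 := abs_le.1 (h1 (u + v))
  have h3 := abs_le.1 (h1 (u - v))
  have h4 := parallelogram_law_with_norm ℝ u v
  rw [hu, hv] at h4
  have h5 : C * ‖u + v‖ ^ 2 + C * ‖u - v‖ ^ 2 = 4 * C := by
    rw [← mul_add, h4]; ring
  rw [Real.norm_eq_abs, abs_le]
  constructor <;> linarith

lemma fdd_polar {f : ES d → ℝ} (hf : ContDiff ℝ 2 f) (x : ES d) {C : ℝ} (hC0 : 0 ≤ C)
    (hC : ∀ e, ‖e‖ = 1 → |fderiv ℝ (fderiv ℝ f) x e e| ≤ C) : ‖fderiv ℝ (fderiv ℝ f) x‖ ≤ C := by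
  refine bil_polar (fun u v => ?_) hC0 hC
  exact (hf.contDiffAt.isSymmSndFDerivAt (by simp)) u v

end
end

open MeasureTheory Real Set
open scoped ENNReal
noncomputable section
section
variable {d : ℕ} {V : ES d → ℝ} {W : ℝ → ℝ} {ν lam T : ℝ} {h : ℝ → ES d → ℝ}

lemma start2 {f : ES d → ℝ} (hf : ContDiff ℝ 2 f) {B0 B1 : ℝ} (h0 : ∀ y, |f y| ≤ B0)
    (h1 : ∀ y, ‖fderiv ℝ f y‖ ≤ B1) {r σ : ℝ} (hr : 0 < r) (hσ : r ^ 2 ≤ σ) {e : ES d} (he : ‖e‖ = 1) (x : ES d) :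
    |∫ y, Kn 2 σ e y * f (y + x)| ≤ B1 / r * Zc d := by
  have hσ0 : 0 < σ := lt_of_lt_of_le (by positivity) hσ
  have hB1 : 0 ≤ B1 := (norm_nonneg _).trans (h1 0)
  have hZ := Zc_pos (d := d)
  rw [int_Kn1 hf h0 h1 (by norm_num) hσ0 he x, abs_neg]
  have := int_bd' hσ0 (j := 1) (by norm_num) (m := 0) (by norm_num) e he (F := fun y => fderiv ℝ f (y + x) e)
    hB1 (fun y => by simpa using ap1 (h1 (y + x)) he)
  refine this.trans ?_
  have hs : r ≤ √σ := Real.le_sqrt_of_sq_le hσ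
  rw [pow_zero, one_mul, pow_one, div_eq_mul_one_div B1 r]
  gcongr

lemma start20 {f : ES d → ℝ} (hf : ContDiff ℝ 2 f) {B0 B1 B2 : ℝ} (h0 : ∀ y, |f y| ≤ B0)
    (h1 : ∀ y, ‖fderiv ℝ f y‖ ≤ B1) (h2 : ∀ y, ‖fderiv ℝ (fderiv ℝ f) y‖ ≤ B2) {σ : ℝ} (hσ : 0 < σ)
    {e : ES d} (he : ‖e‖ = 1) (x : ES d) :
    |∫ y, Kn 2 σ e y * f (y + x)| ≤ B2 * Zc d := by
  have hB : 0 ≤ B2 := (ContinuousLinearMap.opNorm_nonneg _).trans (h2 0)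
  rw [int_Kn2 hf h0 h1 h2 (j := 0) (by norm_num) hσ he x]
  have := int_bd' hσ (j := 0) (by norm_num) (m := 0) (by norm_num) e he (F := fun y => fderiv ℝ (fderiv ℝ f) (y + x) e e)
    hB (fun y => by simpa using ap2 (h2 (y + x)) he)
  simpa using this

lemma sol_d2a (hV : IsDepositionRate d V W) (hS : Sol ν lam T V h) (hν : 0 < ν) (hlam : 0 < lam) (hT : 0 < T)
    {G H κ ρ : ℝ} (hκ : κ = 8 * lam * Zc d / (ν * Z0 d)) (hρ : ρ = Zc d / Z0 d)
    (h0 : ContDiff ℝ 2 (h 0)) (hG0 : ∀ x, ‖fderiv ℝ (h 0) x‖ ≤ G) (hH : ∀ x, ‖fderiv ℝ (fderiv ℝ (h 0)) x‖ ≤ H) :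
    ∀ t ∈ Ioc (0:ℝ) T, ∀ x, ‖fderiv ℝ (fderiv ℝ (h t)) x‖ ≤ 2 * (ρ * (H + G * (1 + 2 * κ * G))) := by
  have hG := sol_grad hV hν hlam hS (h0.differentiable (by norm_num)) hG0
  have hZ := Zc_pos (d := d)
  have hZ0 := Z0_pos (d := d)
  have hκ0 : 0 < κ := by rw [hκ]; positivity
  have hρ0 : 0 < ρ := by rw [hρ]; positivity
  have hGp : 0 ≤ G := (norm_nonneg _).trans (hG0 0)
  have hHp : 0 ≤ H := (ContinuousLinearMap.opNorm_nonneg _).trans (hH 0)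
  obtain ⟨C, hC0, hC⟩ := hS.b0
  obtain ⟨M, hM0, hM⟩ := hS.b2
  set r := 1 / (1 + 2 * κ * G) with hr
  have hr0 : 0 < r := by positivity
  have hrG : κ * G * r ≤ 1 / 2 := by
    rw [hr, mul_one_div, div_le_div_iff₀ (by positivity) (by norm_num)]
    nlinarith
  have : Nonempty (Ioc (0:ℝ) T × ES d) := ⟨⟨⟨T, hT, le_rfl⟩, 0⟩⟩
  have := absorb (ι := Ioc (0:ℝ) T × ES d) (f := fun i => ‖fderiv ℝ (fderiv ℝ (h i.1)) i.2‖)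
    (a := ρ * (H + G * (1 + 2 * κ * G))) ⟨M, fun i => hM i.1 i.1.2 i.2⟩ ?_
  · intro t ht x
    exact this (⟨t, ht⟩, x)
  rintro N hN ⟨⟨t, ht⟩, x⟩
  have hN' : ∀ t ∈ Ioc (0:ℝ) T, ∀ x, ‖fderiv ℝ (fderiv ℝ (h t)) x‖ ≤ N := fun t ht x => hN (⟨t, ht⟩, x)
  have hN0 : 0 ≤ N := (ContinuousLinearMap.opNorm_nonneg _).trans (hN' t ht x)
  refine fdd_polar (hS.c2 t ht) x (by positivity) fun e he => ?_
  have fin : ∀ S q, 0 ≤ q → q ≤ r → S ≤ (H + G * (1 + 2 * κ * G)) * Zc d →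
      Z0 d * |fderiv ℝ (fderiv ℝ (h t)) x e e| ≤ S + 8 * lam * G * N * Zc d / ν * q →
      |fderiv ℝ (fderiv ℝ (h t)) x e e| ≤ ρ * (H + G * (1 + 2 * κ * G)) + N / 2 := by
    intro S q hq hqr hS h1
    have e1 : 8 * lam * G * N * Zc d / ν * q = Z0 d * (κ * G * q * N) := by
      rw [hκ]; field_simp
    have e2 : (H + G * (1 + 2 * κ * G)) * Zc d = Z0 d * (ρ * (H + G * (1 + 2 * κ * G))) := by
      rw [hρ]; field_simp
    have e3 : κ * G * q * N ≤ N / 2 := by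
      have : κ * G * q ≤ 1 / 2 := le_trans (by gcongr) hrG
      nlinarith
    have : Z0 d * |fderiv ℝ (fderiv ℝ (h t)) x e e| ≤ Z0 d * (ρ * (H + G * (1 + 2 * κ * G)) + N / 2) := by
      rw [mul_add, ← e2]
      have := mul_le_mul_of_nonneg_left e3 hZ0.le
      linarith
    exact le_of_mul_le_mul_left this hZ0
  rcases le_or_gt (ν * t) (r ^ 2) with hc | hc
  · have h1 := step2 hV hS hν hlam (a := 0) (t := t) (K := G) (M := N) (S := H * Zc d) le_rfl ht.1 ht.2 he x hGp hN0
      (fun s hs => hG s ⟨hs.1, hs.2.le.trans ht.2⟩) (fun s hs => hN' s ⟨hs.1, hs.2.le.trans ht.2⟩)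
      (fun σ hσ => start20 h0 (fun y => hC 0 ⟨le_rfl, hT.le⟩ y) hG0 hH
        (lt_of_lt_of_le (mul_pos hν (by linarith [ht.1])) hσ) he x)
    refine fin _ _ (Real.sqrt_nonneg _) ?_ ?_ h1
    · rw [sub_zero]; exact Real.sqrt_le_iff.2 ⟨hr0.le, hc⟩
    · gcongr; nlinarith [mul_nonneg hGp (show 0 ≤ 1 + 2 * κ * G by positivity)]
  · set a := t - r ^ 2 / ν with ha
    have hνa : ν * (t - a) = r ^ 2 := by rw [ha]; field_simp; ring
    have ha0 : 0 < a := by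
      rw [ha, sub_pos, div_lt_iff₀ hν]; linarith
    have hat : a < t := by rw [ha]; linarith [show 0 < r ^ 2 / ν by positivity]
    have haT : a ∈ Ioc 0 T := ⟨ha0, hat.le.trans ht.2⟩
    have h1 := step2 hV hS hν hlam (a := a) (t := t) (K := G) (M := N) (S := G / r * Zc d) ha0.le hat ht.2 he x hGp hN0
      (fun s hs => hG s ⟨ha0.trans hs.1, hs.2.le.trans ht.2⟩) (fun s hs => hN' s ⟨ha0.trans hs.1, hs.2.le.trans ht.2⟩)
      (fun σ hσ => start2 (hS.c2 a haT) (fun y => hC a (Ioc_subset_Icc_self haT) y) (hG a haT) hr0 (hνa ▸ hσ) he x)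
    refine fin _ _ (Real.sqrt_nonneg _) ?_ ?_ h1
    · rw [hνa, Real.sqrt_sq hr0.le]
    · gcongr
      rw [hr]; simp only [div_div_eq_mul_div, div_one]; linarith

lemma sqrt_half {a t : ℝ} (ht : 0 < t) (ha : t / 2 ≤ a) : 1 / √a ≤ 2 / √t := by
  have h1 : √t ≤ 2 * √a := by
    have : √t ≤ √(2 ^ 2 * a) := Real.sqrt_le_sqrt (by linarith)
    rwa [Real.sqrt_mul (by norm_num), Real.sqrt_sq (by norm_num)] at this
  have h2 : 0 < √t := Real.sqrt_pos.2 ht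
  have h3 : 0 < √a := Real.sqrt_pos.2 (by linarith)
  rw [div_le_div_iff₀ h3 h2]; linarith

lemma sol_d2b (hV : IsDepositionRate d V W) (hS : Sol ν lam T V h) (hν : 0 < ν) (hlam : 0 < lam) (hT : 0 < T)
    {k κ ρ : ℝ} (hκ : κ = 8 * lam * Zc d / (ν * Z0 d)) (hρ : ρ = Zc d / Z0 d) (hk : 0 ≤ k)
    (hG : ∀ t ∈ Ioc (0:ℝ) T, ∀ x, ‖fderiv ℝ (h t) x‖ ≤ k / √t) :
    ∀ t ∈ Ioc (0:ℝ) T, ∀ x, ‖fderiv ℝ (fderiv ℝ (h t)) x‖ ≤ 2 * (2 * ρ * k * (√(2 / ν) + 8 * κ * k)) / t := by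
  have hZ := Zc_pos (d := d)
  have hZ0 := Z0_pos (d := d)
  have hκ0 : 0 < κ := by rw [hκ]; positivity
  have hρ0 : 0 < ρ := by rw [hρ]; positivity
  obtain ⟨C, hC0, hC⟩ := hS.b0
  obtain ⟨M, hM0, hM⟩ := hS.b2
  have hsν : 0 < √(2 / ν) := Real.sqrt_pos.2 (by positivity)
  set r := 1 / (√(2 / ν) + 8 * κ * k) with hr
  have hr0 : 0 < r := by positivity
  have hrk : 4 * κ * k * r ≤ 1 / 2 := by
    rw [hr, mul_one_div, div_le_div_iff₀ (by positivity) (by norm_num)]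
    nlinarith
  have hrν : r ^ 2 / ν ≤ 1 / 2 := by
    have h1 : r * √(2 / ν) ≤ 1 := by
      rw [hr, one_div_mul_eq_div, div_le_one (by positivity)]
      nlinarith [mul_nonneg hκ0.le hk]
    have h2 : (r * √(2 / ν)) ^ 2 ≤ 1 := pow_le_one₀ (by positivity) h1
    rw [mul_pow, Real.sq_sqrt (by positivity)] at h2
    have : r ^ 2 * (2 / ν) = 2 * (r ^ 2 / ν) := by ring
    linarith
  have : Nonempty (Ioc (0:ℝ) T × ES d) := ⟨⟨⟨T, hT, le_rfl⟩, 0⟩⟩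
  have := absorb (ι := Ioc (0:ℝ) T × ES d) (f := fun i => i.1 * ‖fderiv ℝ (fderiv ℝ (h i.1)) i.2‖)
    (a := 2 * ρ * k * (√(2 / ν) + 8 * κ * k)) ⟨T * M, fun i => ?_⟩ ?_
  · intro t ht x
    rw [le_div_iff₀ ht.1, mul_comm]
    exact this (⟨t, ht⟩, x)
  · exact mul_le_mul i.1.2.2 (hM i.1 i.1.2 i.2) (ContinuousLinearMap.opNorm_nonneg _) hT.le
  rintro N hN ⟨⟨t, ht⟩, x⟩
  have ht0 := ht.1
  have hN' : ∀ t ∈ Ioc (0:ℝ) T, ∀ x, ‖fderiv ℝ (fderiv ℝ (h t)) x‖ ≤ N / t := fun t ht x => by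
    rw [le_div_iff₀ ht.1, mul_comm]
    exact hN (⟨t, ht⟩, x)
  have hN0 : 0 ≤ N := (mul_nonneg ht0.le (ContinuousLinearMap.opNorm_nonneg _)).trans (hN (⟨t, ht⟩, x))
  simp only
  rw [mul_comm, ← le_div_iff₀ ht0]
  refine fdd_polar (hS.c2 t ht) x (by positivity) fun e he => ?_
  set a := t - r ^ 2 / ν * t with ha
  have hst0 : 0 < √t := Real.sqrt_pos.2 ht0
  have hνa : ν * (t - a) = (r * √t) ^ 2 := by
    rw [ha, mul_pow, Real.sq_sqrt ht0.le]; field_simp; ring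
  have ha2 : t / 2 ≤ a := by rw [ha]; nlinarith
  have ha0 : 0 < a := by linarith
  have hat : a < t := by rw [ha]; linarith [show 0 < r ^ 2 / ν * t by positivity]
  have haT : a ∈ Ioc 0 T := ⟨ha0, hat.le.trans ht.2⟩
  have hKs : ∀ s ∈ Icc a t, ∀ x, ‖fderiv ℝ (h s) x‖ ≤ 2 * k / √t := by
    intro s hs y
    refine (hG s ⟨ha0.trans_le hs.1, hs.2.trans ht.2⟩ y).trans ?_
    have := mul_le_mul_of_nonneg_left (sqrt_half ht0 (ha2.trans hs.1)) hk
    calc k / √s = k * (1 / √s) := by ring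
      _ ≤ _ := this
      _ = _ := by ring
  have h1 := step2 hV hS hν hlam (a := a) (t := t) (K := 2 * k / √t) (M := 2 * N / t)
    (S := 2 * k / √t / (r * √t) * Zc d) ha0.le hat ht.2 he x (by positivity) (by positivity)
    (fun s hs => hKs s (Ioo_subset_Icc_self hs))
    (fun s hs y => by
      refine (hN' s ⟨ha0.trans hs.1, hs.2.le.trans ht.2⟩ y).trans ?_
      rw [div_le_div_iff₀ (ha0.trans hs.1) ht0]
      nlinarith [hs.1])
    (fun σ hσ => start2 (hS.c2 a haT) (fun y => hC a (Ioc_subset_Icc_self haT) y) (hKs a ⟨le_rfl, hat.le⟩)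
      (by positivity) (hνa ▸ hσ) he x)
  rw [hνa, Real.sqrt_sq (by positivity)] at h1
  have e0 : √t * √t = t := Real.mul_self_sqrt ht0.le
  have e1 : 8 * lam * (2 * k / √t) * (2 * N / t) * Zc d / ν * (r * √t) = Z0 d * (4 * κ * k * r * N / t) := by
    rw [hκ]; field_simp; ring
  have e2 : 2 * k / √t / (r * √t) * Zc d = Z0 d * (2 * ρ * k * (√(2 / ν) + 8 * κ * k) / t) := by
    have : √(2 / ν) + 8 * κ * k = 1 / r := by rw [hr, one_div_one_div]
    rw [this, hρ, div_div, show √t * (r * √t) = r * t by rw [show √t * (r * √t) = r * (√t * √t) by ring, e0]]; field_simp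
  rw [e1, e2, ← mul_add] at h1
  refine (le_of_mul_le_mul_left h1 hZ0).trans ?_
  rw [← add_div]
  gcongr
  nlinarith
end
end

open MeasureTheory Real Set
open scoped ENNReal
noncomputable section
section
variable {d : ℕ}

lemma tri_id {g : ES d → ES d → ES d → ℝ} (add1 : ∀ u u' v w, g (u + u') v w = g u v w + g u' v w)
    (neg1 : ∀ u v w, g (-u) v w = - g u v w) (s12 : ∀ u v w, g u v w = g v u w) (s23 : ∀ u v w, g u v w = g u w v)
    (a b c : ES d) : 24 * g a b c = g (a + b + c) (a + b + c) (a + b + c) - g (a + b + -c) (a + b + -c) (a + b + -c)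
      - g (a + -b + c) (a + -b + c) (a + -b + c) - g (-a + b + c) (-a + b + c) (-a + b + c) := by
  have add2 : ∀ u v v' w, g u (v + v') w = g u v w + g u v' w := fun u v v' w => by
    rw [s12, add1, s12 v, s12 v']
  have add3 : ∀ u v w w', g u v (w + w') = g u v w + g u v w' := fun u v w w' => by
    rw [s23, add2, s23 u w, s23 u w']
  have neg2 : ∀ u v w, g u (-v) w = - g u v w := fun u v w => by rw [s12, neg1, s12]
  have neg3 : ∀ u v w, g u v (-w) = - g u v w := fun u v w => by rw [s23, neg2, s23]
  simp only [add1, add2, add3, neg1, neg2, neg3]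
  linarith [s12 a b a, s23 a a b, s12 a c a, s23 a a c, s12 b a b, s23 b b a, s12 b c b, s23 b b c,
    s12 c a c, s23 c c a, s12 c b c, s23 c c b, s12 a b c, s23 a b c, s12 a c b, s23 b a c, s23 c a b, s12 b c a]

lemma it3_gen {f : ES d → ℝ} (hf : ContDiff ℝ 3 f) (x : ES d) (u v w : ES d) :
    fderiv ℝ (fun z => fderiv ℝ (fderiv ℝ f) z v w) x u = iteratedFDeriv ℝ 3 f x ![u, v, w] := by
  rw [iteratedFDeriv_succ_apply_left]
  have e1 : (fun z => fderiv ℝ (fderiv ℝ f) z v w) = fun z => iteratedFDeriv ℝ 2 f z ![v, w] := by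
    ext z; rw [iteratedFDeriv_two_apply]; rfl
  have h1 : DifferentiableAt ℝ (iteratedFDeriv ℝ 2 f) x :=
    hf.differentiable_iteratedFDeriv (m := 2) (by norm_num) x
  rw [e1]
  have h2 : HasFDerivAt (fun z => iteratedFDeriv ℝ 2 f z ![v, w])
    ((ContinuousMultilinearMap.apply ℝ (fun _ : Fin 2 => ES d) ℝ ![v, w]).comp (fderiv ℝ (iteratedFDeriv ℝ 2 f) x)) x :=
    (ContinuousMultilinearMap.apply ℝ (fun _ : Fin 2 => ES d) ℝ ![v, w]).hasFDerivAt.comp x h1.hasFDerivAt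
  rw [h2.fderiv]
  rfl

lemma it3_eq {f : ES d → ℝ} (hf : ContDiff ℝ 3 f) (x e : ES d) :
    fderiv ℝ (fun z => fderiv ℝ (fderiv ℝ f) z e e) x e = iteratedFDeriv ℝ 3 f x (fun _ => e) := by
  rw [it3_gen hf]
  congr 1; ext1 i; fin_cases i <;> rfl

lemma it3_s23 {f : ES d → ℝ} (hf : ContDiff ℝ 3 f) (x : ES d) (u v w : ES d) :
    iteratedFDeriv ℝ 3 f x ![u, v, w] = iteratedFDeriv ℝ 3 f x ![u, w, v] := by
  rw [← it3_gen hf, ← it3_gen hf]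
  have : (fun z => fderiv ℝ (fderiv ℝ f) z v w) = fun z => fderiv ℝ (fderiv ℝ f) z w v := by
    ext z
    have h2 : ContDiff ℝ 2 f := hf.of_le (by norm_num)
    exact (h2.contDiffAt.isSymmSndFDerivAt (by simp)) v w
  rw [this]

lemma it3_s12 {f : ES d → ℝ} (hf : ContDiff ℝ 3 f) (x : ES d) (u v w : ES d) :
    iteratedFDeriv ℝ 3 f x ![u, v, w] = iteratedFDeriv ℝ 3 f x ![v, u, w] := by
  rw [← it3_gen hf, ← it3_gen hf]
  have h2 : ContDiff ℝ 2 (fderiv ℝ f) := hf.fderiv_right (m := 2) (by norm_num)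
  set g : ES d → ℝ := fun z => fderiv ℝ f z w with hg
  have hgc : ContDiff ℝ 2 g := by rw [hg]; fun_prop
  have e1 : ∀ z v, fderiv ℝ g z v = fderiv ℝ (fderiv ℝ f) z v w := by
    intro z v
    have h3 : HasFDerivAt (fderiv ℝ f) (fderiv ℝ (fderiv ℝ f) z) z :=
      (h2.differentiable (by norm_num) z).hasFDerivAt
    have h4 := h3.clm_apply (hasFDerivAt_const w z)
    rw [hg, h4.fderiv]; simp
  have e2 : ∀ u v, fderiv ℝ (fun z => fderiv ℝ (fderiv ℝ f) z v w) x u = fderiv ℝ (fderiv ℝ g) x u v := by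
    intro u v
    have h3 : HasFDerivAt (fderiv ℝ g) (fderiv ℝ (fderiv ℝ g) x) x := (diff_fderiv hgc x).hasFDerivAt
    have h4 := h3.clm_apply (hasFDerivAt_const v x)
    simp only [← e1]
    rw [h4.fderiv]; simp
  rw [e2, e2]
  exact (hgc.contDiffAt.isSymmSndFDerivAt (by simp)) u v

lemma tri_polar {f : ES d → ℝ} (hf : ContDiff ℝ 3 f) (x : ES d) {C : ℝ} (hC0 : 0 ≤ C)
    (hC : ∀ e, ‖e‖ = 1 → |iteratedFDeriv ℝ 3 f x (fun _ => e)| ≤ C) : ‖iteratedFDeriv ℝ 3 f x‖ ≤ 9 / 2 * C := by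
  set T := iteratedFDeriv ℝ 3 f x with hT
  have h1 : ∀ v : ES d, |T ![v, v, v]| ≤ C * ‖v‖ ^ 3 := by
    intro v
    have e0 : (![v, v, v] : Fin 3 → ES d) = fun _ => v := by ext i; fin_cases i <;> rfl
    rw [e0]
    rcases eq_or_ne v 0 with rfl | hv
    · rw [T.map_coord_zero (0 : Fin 3) rfl]; simp
    have hn : 0 < ‖v‖ := norm_pos_iff.2 hv
    have := hC (‖v‖⁻¹ • v) (by rw [norm_smul, norm_inv, norm_norm, inv_mul_cancel₀ hn.ne'])
    have e1 := T.map_smul_univ (fun _ => ‖v‖⁻¹) (fun _ => v)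
    rw [e1] at this
    simp only [Finset.prod_const, Finset.card_univ, Fintype.card_fin, smul_eq_mul] at this
    rw [abs_mul, abs_of_pos (by positivity), inv_pow, inv_mul_le_iff₀ (by positivity)] at this
    linarith
  have key : ∀ a b c : ES d, ‖a‖ ≤ 1 → ‖b‖ ≤ 1 → ‖c‖ ≤ 1 → |T ![a, b, c]| ≤ 9 / 2 * C := by
    intro a b c ha hb hc
    have id := tri_id (g := fun u v w => T ![u, v, w]) (fun u u' v w => T.cons_add ![v, w] u u')
      (fun u v w => by
        have := T.cons_smul ![v, w] (-1) u
        simpa using this)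
      (it3_s12 hf x) (it3_s23 hf x) a b c
    have h2 : ∀ u v w : ES d, ‖u‖ ≤ 1 → ‖v‖ ≤ 1 → ‖w‖ ≤ 1 →
        |T ![u + v + w, u + v + w, u + v + w]| ≤ C * 27 := by
      intro u v w hu hv hw
      refine (h1 _).trans ?_
      have : ‖u + v + w‖ ≤ 3 := (norm_add₃_le).trans (by linarith)
      have : ‖u + v + w‖ ^ 3 ≤ 3 ^ 3 := by gcongr
      gcongr
      linarith
    have i1 := abs_le.1 (h2 a b c ha hb hc)
    have i2 := abs_le.1 (h2 a b (-c) ha hb (by simpa))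
    have i3 := abs_le.1 (h2 a (-b) c ha (by simpa) hc)
    have i4 := abs_le.1 (h2 (-a) b c (by simpa) hb hc)
    rw [abs_le]; constructor <;> linarith [i1.1, i1.2, i2.1, i2.2, i3.1, i3.2, i4.1, i4.2]
  refine T.opNorm_le_bound (by positivity) fun m => ?_
  have e1 := T.map_smul_univ (fun i => ‖m i‖) (fun i => ‖m i‖⁻¹ • m i)
  have e2 : (fun i => ‖m i‖ • ‖m i‖⁻¹ • m i) = m := by
    ext1 i
    rcases eq_or_ne (m i) 0 with h | h
    · simp [h]
    · rw [smul_smul, mul_inv_cancel₀ (norm_ne_zero_iff.2 h), one_smul]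
  have hle : ∀ i, ‖‖m i‖⁻¹ • m i‖ ≤ 1 := by
    intro i
    rw [norm_smul, norm_inv, norm_norm]
    exact inv_mul_le_one
  rw [e2] at e1
  have h3 := key _ _ _ (hle 0) (hle 1) (hle 2)
  have e3 : (![‖m 0‖⁻¹ • m 0, ‖m 1‖⁻¹ • m 1, ‖m 2‖⁻¹ • m 2] : Fin 3 → ES d) = fun i => ‖m i‖⁻¹ • m i := by
    ext1 i; fin_cases i <;> rfl
  rw [e3] at h3
  rw [e1, smul_eq_mul, norm_mul, Real.norm_of_nonneg (Finset.prod_nonneg fun i _ => norm_nonneg _), mul_comm]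
  gcongr
  exact h3

lemma it3_diff {f : ES d → ℝ} (hf : ContDiff ℝ 3 f) (e : ES d) :
    ContDiff ℝ 1 (fun z => fderiv ℝ (fderiv ℝ f) z e e) := by
  have h1 : ContDiff ℝ 1 (fderiv ℝ (fderiv ℝ f)) :=
    (hf.fderiv_right (m := 2) (by norm_num)).fderiv_right (m := 1) (by norm_num)
  fun_prop
end
end

open MeasureTheory Real Set
open scoped ENNReal
noncomputable section
section
variable {d : ℕ} {V : ES d → ℝ} {W : ℝ → ℝ} {ν lam T : ℝ} {h : ℝ → ES d → ℝ}

lemma lapl_lip {f : ES d → ℝ} {N : ℝ} (y y' : ES d)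
    (hN : ‖fderiv ℝ (fderiv ℝ f) y - fderiv ℝ (fderiv ℝ f) y'‖ ≤ N * ‖y - y'‖) :
    |lapl f y - lapl f y'| ≤ d * (N * ‖y - y'‖) := by
  rw [lapl_eq, lapl_eq, ← Finset.sum_sub_distrib]
  refine (Finset.abs_sum_le_sum_abs _ _).trans ?_
  refine (Finset.sum_le_card_nsmul _ _ (N * ‖y - y'‖) fun i _ => ?_).trans (by simp)
  have := (fderiv ℝ (fderiv ℝ f) y - fderiv ℝ (fderiv ℝ f) y').le_opNorm₂ (bv i) (bv i)
  rw [bv_norm, mul_one, mul_one] at this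
  exact this.trans hN

lemma time_lip (hV : IsDepositionRate d V W) (hS : Sol ν lam T V h) (hν : 0 < ν) (hlam : 0 < lam)
    {s t K M N : ℝ} (hs0 : 0 < s) (hst : s ≤ t) (htT : t ≤ T) (hK0 : 0 ≤ K) (hM0 : 0 ≤ M) (hN0 : 0 ≤ N)
    (hK : ∀ r ∈ Icc s t, ∀ y, ‖fderiv ℝ (h r) y‖ ≤ K)
    (hM : ∀ r ∈ Icc s t, ∀ y, ‖fderiv ℝ (fderiv ℝ (h r)) y‖ ≤ M)
    (hN : ∀ r ∈ Icc s t, ∀ y, ‖iteratedFDeriv ℝ 3 (h r) y‖ ≤ N) (x : ES d) :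
    ‖gradient (h s) x - gradient (h t) x‖ ≤ (ν * (d * N) + 4 * lam * K * M) * (t - s) := by
  set L := ν * (d * N) + 4 * lam * K * M with hL
  have hL0 : 0 ≤ L := by positivity
  have hsub : ∀ r ∈ Icc s t, r ∈ Ioc 0 T := fun r hr => ⟨hs0.trans_le hr.1, hr.2.trans htT⟩
  have key : ∀ y y', ‖(h s y - h t y) - (h s y' - h t y')‖ ≤ L * (t - s) * ‖y - y'‖ := by
    intro y y'
    have := Convex.norm_image_sub_le_of_norm_hasDerivWithin_le (f := fun r => h r y - h r y')
      (f' := fun r => (ν * lapl (h r) y + lam * V (gradient (h r) y)) - (ν * lapl (h r) y' + lam * V (gradient (h r) y')))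
      (C := L * ‖y - y'‖) (s := Icc s t)
      (fun r hr => ((hS.ht r (hsub r hr) y).sub (hS.ht r (hsub r hr) y')).hasDerivWithinAt)
      (fun r hr => ?_) (convex_Icc s t) (right_mem_Icc.2 hst) (left_mem_Icc.2 hst)
    · rw [Real.norm_eq_abs (s - t), abs_of_nonpos (by linarith)] at this
      calc _ = ‖(h s y - h s y') - (h t y - h t y')‖ := by congr 1; ring
        _ ≤ _ := this
        _ = _ := by ring
    · have h1 := lapl_lip y y' (lip_of_it3 (h r) (hS.c3 r (hsub r hr)) N (hN r hr) y y')
      have h2 := V_lip hV (p := gradient (h r) y) (p' := gradient (h r) y') (R := K)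
        (by rw [norm_grad]; exact hK r hr _) (by rw [norm_grad]; exact hK r hr _)
      rw [grad_sub_norm] at h2
      have h3 := fderiv_lip (hS.c2 r (hsub r hr)) (hM r hr) y' y
      have h4 : |V (gradient (h r) y) - V (gradient (h r) y')| ≤ 4 * K * (M * ‖y - y'‖) := h2.trans (by gcongr)
      have e1 : (ν * lapl (h r) y + lam * V (gradient (h r) y)) - (ν * lapl (h r) y' + lam * V (gradient (h r) y'))
        = ν * (lapl (h r) y - lapl (h r) y') + lam * (V (gradient (h r) y) - V (gradient (h r) y')) := by ring
      rw [e1]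
      refine (norm_add_le _ _).trans ?_
      rw [norm_mul, norm_mul, Real.norm_of_nonneg hν.le, Real.norm_of_nonneg hlam.le, Real.norm_eq_abs, Real.norm_eq_abs]
      calc _ ≤ ν * (d * (N * ‖y - y'‖)) + lam * (4 * K * (M * ‖y - y'‖)) := by gcongr
        _ = _ := by rw [hL]; ring
  have hds := (hS.c2 s (hsub s ⟨le_rfl, hst⟩)).differentiable (by norm_num)
  have hdt := (hS.c2 t (hsub t ⟨hst, le_rfl⟩)).differentiable (by norm_num)
  have e2 : ‖gradient (h s) x - gradient (h t) x‖ = ‖fderiv ℝ (h s) x - fderiv ℝ (h t) x‖ := by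
    simp only [gradient, ← map_sub, LinearIsometryEquiv.norm_map]
  rw [e2, ← fderiv_fun_sub (hds x) (hdt x)]
  have := (((hds x).sub (hdt x)).hasFDerivAt).le_of_lip' (C := L * (t - s)) (mul_nonneg hL0 (by linarith))
    (Filter.Eventually.of_forall fun y => key y x)
  exact this

lemma sin_bd (u : ℝ) : |sin u - u| ≤ 2 * u ^ 2 := by
  rcases le_or_gt |u| 1 with hu | hu
  · have h1 := abs_le.1 (Real.sin_bound hu)
    have h2 : u ^ 2 = |u| ^ 2 := (sq_abs u).symm
    have h0 := abs_nonneg u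
    have h3 : |u ^ 3| = |u| ^ 3 := abs_pow u 3
    have h4 := abs_le.1 h3.le
    have h5 : |u| ^ 3 ≤ |u| ^ 2 := pow_le_pow_of_le_one h0 hu (by norm_num)
    have h6 : |u| ^ 4 ≤ |u| ^ 2 := pow_le_pow_of_le_one h0 hu (by norm_num)
    rw [h2, abs_le]
    constructor <;> nlinarith [h1.1, h1.2, h4.1, h4.2]
  · have h1 := Real.abs_sin_le_one u
    have h2 := abs_sub (sin u) u
    have h3 : u ^ 2 = |u| ^ 2 := (sq_abs u).symm
    nlinarith [abs_sub_abs_le_abs_sub (sin u) u]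

def th (K r : ℝ) : ℝ := K * sin (r / K)

lemma th_bd {K : ℝ} (hK : 0 < K) (r : ℝ) : |th K r| ≤ K := by
  unfold th
  rw [abs_mul, abs_of_pos hK]
  have := Real.abs_sin_le_one (r / K)
  nlinarith

lemma th_sub {K : ℝ} (hK : 0 < K) (r : ℝ) : |th K r - r| ≤ 2 * r ^ 2 / K := by
  have := sin_bd (r / K)
  have e : th K r - r = K * (sin (r / K) - r / K) := by unfold th; field_simp
  rw [e, abs_mul, abs_of_pos hK]
  calc _ ≤ K * (2 * (r / K) ^ 2) := by gcongr
    _ = _ := by field_simp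

/-- ridge function -/
def rid (V : ES d → ℝ) (K b : ℝ) (n w y : ES d) : ℝ := V ((b + th K (inner ℝ w y)) • n)

lemma V_approx (hV : IsDepositionRate d V W) {K M N τ L : ℝ} (hK : 0 < K) {n q w p p' y : ES d} {b : ℝ}
    (hn : ‖n‖ = 1) (hq : q = b • n) (hqK : ‖q‖ ≤ K) (hpK : ‖p‖ ≤ K) (hpK' : ‖p'‖ ≤ K) (hM : 0 ≤ M) (hN : 0 ≤ N)
    (h1 : ‖p - p'‖ ≤ L * τ) (h2 : ‖p' - q‖ ≤ M * ‖y‖) (hw : ‖w‖ ≤ M)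
    (h3 : |(inner ℝ p' n : ℝ) - b - inner ℝ w y| ≤ N * ‖y‖ ^ 2) :
    |V p - rid V K b n w y| ≤ 4 * K * L * τ + (20 * M ^ 2 + 8 * K * N) * ‖y‖ ^ 2 := by
  have i1 := V_lip hV hpK hpK'
  have i2 := V_iso hV p' n hn
  have i3 : ‖p'‖ ^ 2 - (inner ℝ p' n : ℝ) ^ 2 ≤ ‖p' - q‖ ^ 2 := by
    rw [hq, norm_sub_sq_real, norm_smul, hn, mul_one, inner_smul_right, Real.norm_eq_abs, sq_abs]
    nlinarith [sq_nonneg ((inner ℝ p' n : ℝ) - b)]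
  have i4 : ‖p' - q‖ ^ 2 ≤ (M * ‖y‖) ^ 2 := by gcongr
  have hb : |b| ≤ K := by rw [hq, norm_smul, hn, mul_one] at hqK; exact hqK
  have i5 : |(inner ℝ p' n : ℝ)| ≤ K := by
    have := abs_real_inner_le_norm p' n
    rw [hn, mul_one] at this; linarith
  have i6 := th_bd hK (inner ℝ w y)
  have i7 := V_lip hV (p := (inner ℝ p' n : ℝ) • n) (p' := (b + th K (inner ℝ w y)) • n) (R := 2 * K)
    (by rw [norm_smul, hn, mul_one, Real.norm_eq_abs]; linarith)
    (by rw [norm_smul, hn, mul_one, Real.norm_eq_abs]; linarith [abs_add_le b (th K (inner ℝ w y))])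
  rw [← sub_smul, norm_smul, hn, mul_one, Real.norm_eq_abs] at i7
  have i8 := th_sub hK (inner ℝ w y)
  have i9 : (inner ℝ w y : ℝ) ^ 2 ≤ (M * ‖y‖) ^ 2 := by
    rw [← sq_abs]
    have := (abs_real_inner_le_norm w y).trans (mul_le_mul_of_nonneg_right hw (norm_nonneg y))
    gcongr
  have i10 : |(inner ℝ p' n : ℝ) - (b + th K (inner ℝ w y))| ≤ N * ‖y‖ ^ 2 + 2 * (M * ‖y‖) ^ 2 / K := by
    have : 2 * (inner ℝ w y : ℝ) ^ 2 / K ≤ 2 * (M * ‖y‖) ^ 2 / K := by gcongr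
    have h4 := abs_le.1 h3
    have h5 := abs_le.1 i8
    rw [abs_le]; constructor <;> linarith [h4.1, h4.2, h5.1, h5.2]
  have i11 : 4 * (2 * K) * |(inner ℝ p' n : ℝ) - (b + th K (inner ℝ w y))| ≤ 8 * K * N * ‖y‖ ^ 2 + 16 * (M * ‖y‖) ^ 2 := by
    calc _ ≤ 4 * (2 * K) * (N * ‖y‖ ^ 2 + 2 * (M * ‖y‖) ^ 2 / K) := by gcongr
      _ = _ := by field_simp; ring
  have i12 : 4 * K * ‖p - p'‖ ≤ 4 * K * L * τ := by
    calc _ ≤ 4 * K * (L * τ) := by gcongr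
      _ = _ := by ring
  unfold rid
  have j1 := abs_le.1 i1
  have j2 := abs_le.1 i2
  have j3 := abs_le.1 i7
  rw [abs_le]
  constructor <;> nlinarith [j1.1, j1.2, j2.1, j2.2, j3.1, j3.2]

end
end

open MeasureTheory Real Set
open scoped ENNReal
noncomputable section
section
variable {d : ℕ} {V : ES d → ℝ} {W : ℝ → ℝ} {ν lam T : ℝ} {h : ℝ → ES d → ℝ}

lemma rg1 {φ : ℝ → ℝ} (hφ : ContDiff ℝ 2 φ) (w y : ES d) :
    fderiv ℝ (fun y => φ (inner ℝ w y)) y = deriv φ (inner ℝ w y) • innerSL ℝ w := by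
  have h1 : HasFDerivAt (fun y : ES d => (inner ℝ w y : ℝ)) (innerSL ℝ w) y := (innerSL ℝ w).hasFDerivAt
  have h2 := ((hφ.differentiable (by norm_num)) (inner ℝ w y)).hasDerivAt
  exact (h2.comp_hasFDerivAt y h1).fderiv

lemma rg2 {φ : ℝ → ℝ} (hφ : ContDiff ℝ 2 φ) (w y : ES d) :
    fderiv ℝ (fderiv ℝ (fun y => φ (inner ℝ w y))) y =
      (deriv (deriv φ) (inner ℝ w y) • innerSL ℝ w).smulRight (innerSL ℝ w) := by
  have e : fderiv ℝ (fun y => φ (inner ℝ w y)) = fun y => deriv φ (inner ℝ w y) • innerSL ℝ w := by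
    ext1 y; exact rg1 hφ w y
  rw [e]
  have h1 : HasFDerivAt (fun y : ES d => (inner ℝ w y : ℝ)) (innerSL ℝ w) y := (innerSL ℝ w).hasFDerivAt
  have hd : ContDiff ℝ 1 (deriv φ) := hφ.iterate_deriv' 1 1
  have h2 := ((hd.differentiable (by norm_num)) (inner ℝ w y)).hasDerivAt
  exact ((h2.comp_hasFDerivAt y h1).smul_const (innerSL ℝ w)).fderiv

lemma rg2' {φ : ℝ → ℝ} (hφ : ContDiff ℝ 2 φ) (w y u v : ES d) :
    fderiv ℝ (fderiv ℝ (fun y => φ (inner ℝ w y))) y u v =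
      deriv (deriv φ) (inner ℝ w y) * inner ℝ w u * inner ℝ w v := by
  rw [rg2 hφ]; simp

lemma rg_lapl {φ : ℝ → ℝ} (hφ : ContDiff ℝ 2 φ) (w y : ES d) :
    lapl (fun y => φ (inner ℝ w y)) y = deriv (deriv φ) (inner ℝ w y) * ‖w‖ ^ 2 := by
  rw [lapl_eq, ← sum_bv_sq, Finset.mul_sum]
  refine Finset.sum_congr rfl fun i _ => ?_
  rw [rg2' hφ]; ring

def rphi (V : ES d → ℝ) (K b : ℝ) (n : ES d) (r : ℝ) : ℝ := V ((b + th K r) • n)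

lemma rphi_diff (hV : IsDepositionRate d V W) (K b : ℝ) (n : ES d) : ContDiff ℝ 2 (rphi V K b n) := by
  unfold rphi th
  have h1 : ContDiff ℝ 2 fun r : ℝ => (b + K * sin (r / K)) • n := by fun_prop
  exact hV.smooth.comp h1

lemma rphi_bd (hV : IsDepositionRate d V W) {K b : ℝ} (hK : 0 < K) (hb : |b| ≤ K) {n : ES d} (hn : ‖n‖ = 1) (r : ℝ) :
    |rphi V K b n r| ≤ (2 * K) ^ 2 := by
  unfold rphi
  have h1 := V_le hV ((b + th K r) • n)
  have h2 := V_nonneg hV ((b + th K r) • n)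
  rw [abs_of_nonneg h2]
  refine h1.trans ?_
  have : ‖(b + th K r) • n‖ ≤ 2 * K := by
    rw [norm_smul, hn, mul_one, Real.norm_eq_abs]
    linarith [abs_add_le b (th K r), th_bd hK r]
  gcongr

lemma rphi_d1 (hV : IsDepositionRate d V W) {K b : ℝ} (hK : 0 < K) (hb : |b| ≤ K) {n : ES d} (hn : ‖n‖ = 1) (r : ℝ) :
    |deriv (rphi V K b n) r| ≤ 8 * K := by
  have hh := (((rphi_diff hV K b n).differentiable (by norm_num)) r).hasDerivAt
  have := hh.le_of_lip' (C := 8 * K) (by positivity) (Filter.Eventually.of_forall fun s => ?_)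
  · exact this
  have nb : ∀ r, ‖(b + th K r) • n‖ ≤ 2 * K := fun r => by
    rw [norm_smul, hn, mul_one, Real.norm_eq_abs]
    linarith [abs_add_le b (th K r), th_bd hK r]
  have h1 := V_lip hV (nb s) (nb r)
  rw [← sub_smul, norm_smul, hn, mul_one, Real.norm_eq_abs] at h1
  have h2 : |b + th K s - (b + th K r)| ≤ |s - r| := by
    have e : b + th K s - (b + th K r) = K * (sin (s / K) - sin (r / K)) := by unfold th; ring
    rw [e, abs_mul, abs_of_pos hK]
    calc _ ≤ K * |s / K - r / K| := mul_le_mul_of_nonneg_left (Real.abs_sin_sub_sin_le _ _) hK.le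
      _ = _ := by rw [← sub_div, abs_div, abs_of_pos hK]; field_simp
  rw [Real.norm_eq_abs, Real.norm_eq_abs]
  unfold rphi
  refine h1.trans ?_
  calc _ ≤ 4 * (2 * K) * |s - r| := by gcongr
    _ = _ := by ring

lemma per_deriv {f : ℝ → ℝ} {c : ℝ} (hf : Function.Periodic f c) : Function.Periodic (deriv f) c := by
  intro x
  rw [← deriv_comp_add_const]
  congr 1
  ext y; exact hf y

lemma rphi_d2 (hV : IsDepositionRate d V W) {K b : ℝ} (hK : 0 < K) (n : ES d) :
    ∃ B, 0 ≤ B ∧ ∀ r, |deriv (deriv (rphi V K b n)) r| ≤ B := by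
  have hp : Function.Periodic (rphi V K b n) (2 * π * K) := by
    intro x
    unfold rphi th
    rw [add_div, mul_div_cancel_right₀ _ hK.ne', Real.sin_add_two_pi]
  have hp2 := per_deriv (per_deriv hp)
  have hc : Continuous (deriv (deriv (rphi V K b n))) := by
    have := (rphi_diff hV K b n).iterate_deriv' 0 2
    exact this.continuous
  have hcp := (hp2.compact_of_continuous (by positivity) hc).isBounded
  obtain ⟨B, hB⟩ := hcp.exists_norm_le
  exact ⟨B, (norm_nonneg _).trans (hB _ ⟨0, rfl⟩), fun r => hB _ ⟨r, rfl⟩⟩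

lemma int_bd2 {σ : ℝ} (hσ : 0 < σ) (e : ES d) (he : ‖e‖ = 1)
    {F : ES d → ℝ} {A B : ℝ} (hA : 0 ≤ A) (hB0 : 0 ≤ B) (hB : ∀ y, |F y| ≤ A * σ + B * ‖y‖ ^ 2) :
    |∫ y, Kn 3 σ e y * F y| ≤ (A + B) * Zc d * (1 / √σ) := by
  set s := √σ with hs
  have hs0 : 0 < s := Real.sqrt_pos.2 hσ
  have hss : σ = s ^ 2 := (Real.sq_sqrt hσ.le).symm
  rw [hss]
  have e0 : (A + B) * Zc d * (1 / s) = ∫ y : ES d, (A + B) * (1 / s) * domf (s ^ 2) (s ^ 2) y := by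
    rw [integral_const_mul, domf_integral hs0]; ring
  rw [e0, ← Real.norm_eq_abs]
  have hs2 : 0 < s ^ 2 := by positivity
  refine norm_integral_le_of_norm_le (μ := (volume : Measure (ES d))) ((domf_int (d := d) hs2 hs2).const_mul _)
    (Filter.Eventually.of_forall fun y => ?_)
  have k0 := Kn_bd hs0 (j := 3) (by norm_num) (m := 0) (by norm_num) e he y
  have k2 := Kn_bd hs0 (j := 3) (by norm_num) (m := 2) (by norm_num) e he y
  rw [pow_zero, mul_one, pow_zero, one_mul] at k0
  rw [Real.norm_eq_abs, abs_mul]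
  have hy := hB y
  rw [hss] at hy
  calc |Kn 3 (s ^ 2) e y| * |F y| ≤ |Kn 3 (s ^ 2) e y| * (A * s ^ 2 + B * ‖y‖ ^ 2) := by gcongr
    _ = A * s ^ 2 * |Kn 3 (s ^ 2) e y| + B * (|Kn 3 (s ^ 2) e y| * ‖y‖ ^ 2) := by ring
    _ ≤ A * s ^ 2 * ((1 / s) ^ 3 * domf (s ^ 2) (s ^ 2) y) + B * (s ^ 2 * (1 / s) ^ 3 * domf (s ^ 2) (s ^ 2) y) := by
      gcongr
    _ = _ := by field_simp

lemma taylor2 {f : ES d → ℝ} (hf : ContDiff ℝ 3 f) {N : ℝ} (hN : ∀ y, ‖iteratedFDeriv ℝ 3 f y‖ ≤ N)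
    {n : ES d} (hn : ‖n‖ = 1) (x y : ES d) :
    |fderiv ℝ f (y + x) n - fderiv ℝ f x n - fderiv ℝ (fderiv ℝ f) x y n| ≤ N * ‖y‖ ^ 2 := by
  have hN0 : 0 ≤ N := (norm_nonneg _).trans (hN x)
  have hd : Differentiable ℝ (fderiv ℝ f) := (hf.fderiv_right (m := 2) (by norm_num)).differentiable (by norm_num)
  have h1 := Convex.norm_image_sub_le_of_norm_fderiv_le' (𝕜 := ℝ) (f := fderiv ℝ f) (φ := fderiv ℝ (fderiv ℝ f) x)
    (s := Metric.closedBall x ‖y‖) (C := N * ‖y‖) (x := x) (y := y + x) (fun z _ => hd z)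
    (fun z hz => ?_) (convex_closedBall _ _) (by simp) (by simp)
  · rw [add_sub_cancel_right] at h1
    have h2 := (fderiv ℝ f (y + x) - fderiv ℝ f x - fderiv ℝ (fderiv ℝ f) x y).le_opNorm n
    rw [hn, mul_one] at h2
    refine (h2.trans h1).trans (le_of_eq (by ring))
  · refine (lip_of_it3 f hf N hN z x).trans ?_
    have : ‖z - x‖ ≤ ‖y‖ := by simpa [dist_eq_norm] using hz
    gcongr

end
end

open MeasureTheory Real Set
open scoped ENNReal
noncomputable section
section
variable {d : ℕ} {V : ES d → ℝ} {W : ℝ → ℝ} {ν lam T : ℝ} {h : ℝ → ES d → ℝ}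

/-- ridge data at a point -/
lemma ridge_pt {f : ES d → ℝ} (hf : ContDiff ℝ 3 f) {K M N : ℝ} (x : ES d) {e : ES d} (he : ‖e‖ = 1)
    (hK : ∀ y, ‖fderiv ℝ f y‖ ≤ K) (hM : ∀ y, ‖fderiv ℝ (fderiv ℝ f) y‖ ≤ M)
    (hN : ∀ y, ‖iteratedFDeriv ℝ 3 f y‖ ≤ N) :
    ∃ (b : ℝ) (n w : ES d), ‖n‖ = 1 ∧ |b| ≤ K ∧ gradient f x = b • n ∧ ‖w‖ ≤ M ∧
      ∀ y, |(inner ℝ (gradient f (y + x)) n : ℝ) - b - inner ℝ w y| ≤ N * ‖y‖ ^ 2 := by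
  obtain ⟨n, hn, hq⟩ : ∃ n : ES d, ‖n‖ = 1 ∧ gradient f x = ‖gradient f x‖ • n := by
    rcases eq_or_ne (gradient f x) 0 with h0 | h0
    · exact ⟨e, he, by simp [h0]⟩
    · have hp : ‖gradient f x‖ ≠ 0 := norm_ne_zero_iff.2 h0
      refine ⟨‖gradient f x‖⁻¹ • gradient f x, ?_, ?_⟩
      · rw [norm_smul, norm_inv, norm_norm, inv_mul_cancel₀ hp]
      · rw [smul_smul, mul_inv_cancel₀ hp, one_smul]
  have hf2 : ContDiff ℝ 2 f := hf.of_le (by norm_num)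
  refine ⟨‖gradient f x‖, n, (InnerProductSpace.toDual ℝ (ES d)).symm (fderiv ℝ (fderiv ℝ f) x n), hn, ?_, hq, ?_, ?_⟩
  · rw [abs_norm, norm_grad]; exact hK x
  · rw [LinearIsometryEquiv.norm_map]
    have := (fderiv ℝ (fderiv ℝ f) x).le_opNorm n
    rw [hn, mul_one] at this
    exact this.trans (hM x)
  · intro y
    rw [InnerProductSpace.toDual_symm_apply, inner_grad]
    have e1 : ‖gradient f x‖ = fderiv ℝ f x n := by
      rw [← inner_grad]
      conv_rhs => rw [hq]
      rw [real_inner_smul_left, real_inner_self_eq_norm_sq, hn]; ring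
    rw [e1, (hf2.contDiffAt.isSymmSndFDerivAt (by simp)) n y]
    exact taylor2 hf hN hn x y

set_option maxHeartbeats 2000000 in
lemma step3 (hV : IsDepositionRate d V W) (hS : Sol ν lam T V h) (hν : 0 < ν) (hlam : 0 < lam)
    {a t K M N r : ℝ} (ha : 0 < a) (hat : a < t) (htT : t ≤ T) (hr : 0 < r) (hra : ν * (t - a) = r ^ 2)
    {e : ES d} (he : ‖e‖ = 1) (x : ES d)
    (hK0 : 0 < K) (hM0 : 0 ≤ M) (hN0 : 0 ≤ N)
    (hK : ∀ s ∈ Icc a t, ∀ y, ‖fderiv ℝ (h s) y‖ ≤ K)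
    (hM : ∀ s ∈ Icc a t, ∀ y, ‖fderiv ℝ (fderiv ℝ (h s)) y‖ ≤ M)
    (hN : ∀ s ∈ Icc a t, ∀ y, ‖iteratedFDeriv ℝ 3 (h s) y‖ ≤ N) :
    Z0 d * |iteratedFDeriv ℝ 3 (h t) x (fun _ => e)| ≤
      (M / r * Zc d + 16 * lam / ν * (K * M) * Zc d) +
      2 * (lam * (4 * K * (ν * (d * N) + 4 * lam * K * M) / ν + (20 * M ^ 2 + 8 * K * N)) * Zc d) / ν * r := by
  obtain ⟨C, hC0, hC⟩ := hS.b0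
  have hsub : ∀ s ∈ Icc a t, s ∈ Ioc 0 T := fun s hs => ⟨ha.trans_le hs.1, hs.2.trans htT⟩
  have htt : t ∈ Icc a t := ⟨hat.le, le_rfl⟩
  have haa : a ∈ Icc a t := ⟨le_rfl, hat.le⟩
  have ht := hsub t htt
  have hZ := Zc_pos (d := d)
  obtain ⟨b, n, w, hn, hb, hq, hw, htay⟩ := ridge_pt (hS.c3 t ht) x he (hK t htt) (hM t htt) (hN t htt)
  set φ := rphi V K b n with hφd
  have hφ : ContDiff ℝ 2 φ := rphi_diff hV K b n
  obtain ⟨B2, hB2, hφ2⟩ := rphi_d2 hV (b := b) hK0 n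
  have hφ1 := fun r => rphi_d1 hV hK0 hb hn r
  have hφ0 := fun r => rphi_bd hV hK0 hb hn r
  set F : ES d → ℝ := fun y => φ (inner ℝ w y) with hF
  have hFc : ContDiff ℝ 2 F := by
    have : ContDiff ℝ 2 fun y : ES d => (inner ℝ w y : ℝ) := (innerSL ℝ w).contDiff
    exact hφ.comp this
  have hF0 : ∀ y, |F y| ≤ (2 * K) ^ 2 := fun y => hφ0 _
  have hF1 : ∀ y, ‖fderiv ℝ F y‖ ≤ 8 * K * M := fun y => by
    rw [hF, rg1 hφ, norm_smul, innerSL_apply_norm]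
    exact mul_le_mul (hφ1 _) hw (norm_nonneg _) (by positivity)
  have hF2 : ∀ y, ‖fderiv ℝ (fderiv ℝ F) y‖ ≤ B2 * M * M := fun y => by
    rw [hF, rg2 hφ, ContinuousLinearMap.norm_smulRight_apply, norm_smul, innerSL_apply_norm]
    have := hφ2 (inner ℝ w y)
    rw [← Real.norm_eq_abs] at this
    gcongr
  set c2 := (inner ℝ w e : ℝ) ^ 2 / ‖w‖ ^ 2 with hc2
  have hc20 : 0 ≤ c2 := by positivity
  have hin : (inner ℝ w e : ℝ) ^ 2 ≤ ‖w‖ ^ 2 := by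
    have := abs_real_inner_le_norm w e
    rw [he, mul_one] at this
    rw [← sq_abs]; gcongr
  have hc21 : c2 ≤ 1 := div_le_one_of_le₀ hin (by positivity)
  have hc2w : c2 * ‖w‖ ^ 2 = (inner ℝ w e : ℝ) ^ 2 := by
    rcases eq_or_ne ‖w‖ 0 with h0 | h0
    · rw [h0] at hin ⊢; nlinarith [sq_nonneg (inner ℝ w e : ℝ)]
    · rw [hc2]; field_simp
  set L := ν * (d * N) + 4 * lam * K * M with hL
  have hL0 : 0 ≤ L := by positivity
  set D := lam * (4 * K * L / ν + (20 * M ^ 2 + 8 * K * N)) * Zc d with hD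
  have hD0 : 0 ≤ D := by positivity
  have hgb : ∀ s ∈ Icc a t, ∀ p, ‖gradient (h s) p‖ ≤ K := fun s hs p => by rw [norm_grad]; exact hK s hs p
  set f3 : ES d → ℝ := fun y => iteratedFDeriv ℝ 3 (h t) (y + x) (fun _ => e) with hf3
  have hd3 := it3_diff (hS.c3 t ht) e
  have hf3b : ∀ y, |f3 y| ≤ N := fun y => by
    have := (iteratedFDeriv ℝ 3 (h t) (y + x)).le_opNorm (fun _ => e)
    simp only [he, Finset.prod_const_one, mul_one] at this
    exact this.trans (hN t htt _)
  have hf3e : ∀ y, f3 y = fderiv ℝ (fun z => fderiv ℝ (fderiv ℝ (h t)) z e e) (y + x) e := fun y =>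
    (it3_eq (hS.c3 t ht) _ e).symm
  have hf3c : Continuous f3 := by
    have h1 := hd3.continuous_fderiv (by norm_num)
    have : f3 = fun y => fderiv ℝ (fun z => fderiv ℝ (fderiv ℝ (h t)) z e e) (y + x) e := funext hf3e
    rw [this]
    fun_prop
  have main := lim_bd (f := f3) (B := N) (S := M / r * Zc d + 16 * lam / ν * (K * M) * Zc d) (c := 2 * D / ν)
    (b := r ^ 2) hf3c hf3b ?_
  · rw [Real.sqrt_sq hr.le] at main
    simpa [hf3] using main
  intro s hs
  have hε : 0 < s ^ 2 := by positivity
  -- the value at time t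
  have e1 := int_Kn2 (hS.c2 t ht) (fun y => hC t (Ioc_subset_Icc_self ht) y) (hK t htt) (hM t htt) (j := 1) (by norm_num)
    hε he x
  have e2 := ibp1 (F := fun y => fderiv ℝ (fderiv ℝ (h t)) (y + x) e e) (F' := f3) hε (j := 0) (by norm_num) he
    ((cont_fdd (hS.c2 t ht) e).comp (continuous_id.add continuous_const)) hf3c (fun y => ap2 (hM t htt _) he) hf3b
    (fun y => by
      have hsh : Differentiable ℝ fun z => fderiv ℝ (fderiv ℝ (h t)) (z + x) e e :=
        (hd3.differentiable (by norm_num)).comp (differentiable_id.add_const x)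
      have := line1 hsh e y
      rw [hf3e]
      have e3 := fderiv_shift (fun z => fderiv ℝ (fderiv ℝ (h t)) z e e) x y
      rwa [e3] at this)
  simp only [Kn_zero, zero_add, Nat.reduceAdd] at e1 e2
  rw [e2] at e1
  -- the ridge integral
  have Rbd : ∀ σ, 0 < σ → |∫ y, Kn 1 σ e y * F y| ≤ 8 * K * M * Zc d := by
    intro σ hσ
    have q1 := int_Kn1 hFc hF0 hF1 (j := 0) (by norm_num) hσ he 0
    simp only [add_zero, zero_add] at q1
    rw [q1, abs_neg]
    have q2 := int_bd' hσ (j := 0) (by norm_num) (m := 0) (by norm_num) e he (F := fun y => fderiv ℝ F y e)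
      (B := 8 * K * M) (by positivity) (fun y => by simpa using ap1 (hF1 y) he)
    simpa using q2
  have hcmp := duh_cmp (D := D)
    (m := fun s' => (∫ y, Kn 3 (ν * (t - s') + s ^ 2) e y * h s' (y + x)) +
      lam * c2 / ν * ∫ y, Kn 1 (ν * (t - s') + s ^ 2) e y * F y)
    (m' := fun s' => (∫ y, Kn 3 (ν * (t - s') + s ^ 2) e y * (lam * V (gradient (h s') (y + x)))) +
      lam * c2 / ν * ∫ y, Kn 1 (ν * (t - s') + s ^ 2) e y * (0 - ν * lapl F y)) hν hε hat.le hD0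
    ((duh_cont hS hν hε ha.le hat.le htT (j := 3) (by norm_num) he x).add
      ((heat_cont (u := fun _ => F) hν hε (j := 1) (by norm_num) he hat.le (fun _ _ => hFc.continuous)
        (fun _ _ => hF0) (fun _ => continuousOn_const)).const_smul (lam * c2 / ν)))
    (fun s' hs' => (duh_deriv hV hS hν hlam hε ha.le htT (by norm_num) he x hs').add
      ((heat_deriv (u := fun _ => F) (ut := fun _ _ => 0) hν hε hs' (j := 1) (by norm_num) he
        (fun _ _ => hFc) (fun _ _ => hF0) (fun _ _ => hF1) (fun _ _ => hF2) (Bt := 0) (by simp) (by fun_prop)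
        (fun s _ y => hasDerivAt_const s _)).const_mul (lam * c2 / ν))) ?_
  · simp only [sub_self, mul_zero, zero_add, e1, hra] at hcmp
    have hσ1 : 0 < r ^ 2 + s ^ 2 := by positivity
    have b1 := Rbd (s ^ 2) hε
    have b2 := Rbd (r ^ 2 + s ^ 2) hσ1
    have b3 : |∫ y, Kn 3 (r ^ 2 + s ^ 2) e y * h a (y + x)| ≤ M / r * Zc d := by
      have haT := hsub a haa
      have q1 := int_Kn2 (hS.c2 a haT) (fun y => hC a (Ioc_subset_Icc_self haT) y) (hK a haa) (hM a haa) (j := 1)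
        (by norm_num) hσ1 he x
      simp only [Nat.reduceAdd] at q1
      rw [q1]
      have q2 := int_bd' hσ1 (j := 1) (by norm_num) (m := 0) (by norm_num) e he
        (F := fun y => fderiv ℝ (fderiv ℝ (h a)) (y + x) e e)
        hM0 (fun y => by simpa using ap2 (hM a haa (y + x)) he)
      refine q2.trans ?_
      have : r ≤ √(r ^ 2 + s ^ 2) := Real.le_sqrt_of_sq_le (by linarith)
      rw [pow_zero, one_mul, pow_one, mul_one_div]
      gcongr
    have hcc : 0 ≤ lam * c2 / ν := by positivity
    have hcc1 : lam * c2 / ν ≤ lam / ν := by gcongr; nlinarith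
    have c1 : ∀ X : ℝ, |X| ≤ 8 * K * M * Zc d → |lam * c2 / ν * X| ≤ 8 * lam / ν * (K * M) * Zc d := by
      intro X hX
      rw [abs_mul, abs_of_nonneg hcc]
      calc _ ≤ lam / ν * (8 * K * M * Zc d) := by gcongr
        _ = _ := by ring
    have d1 := abs_le.1 (c1 _ b1)
    have d2 := abs_le.1 (c1 _ b2)
    have d3 := abs_le.1 b3
    have d4 := abs_le.1 hcmp
    have d5 : 16 * lam / ν * (K * M) * Zc d = 8 * lam / ν * (K * M) * Zc d + 8 * lam / ν * (K * M) * Zc d := by ring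
    rw [abs_le]
    constructor <;> linarith [d1.1, d1.2, d2.1, d2.2, d3.1, d3.2, d4.1, d4.2]
  · intro s' hs'
    have hs'' : s' ∈ Icc a t := Ioo_subset_Icc_self hs'
    have hsT := hsub s' hs''
    have hσν : ν * (t - s') ≤ ν * (t - s') + s ^ 2 := by linarith
    have hσ : 0 < ν * (t - s') + s ^ 2 := by have := mul_pos hν (sub_pos.2 hs'.2); linarith
    set σ := ν * (t - s') + s ^ 2 with hσd
    have hgc := grad_cont (hS.c2 s' hsT)
    have hVc := hV.smooth.continuous
    have hb' : ∀ p, |lam * V (gradient (h s') p)| ≤ lam * K ^ 2 := by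
      intro p
      have h2 := V_le hV (gradient (h s') p)
      have h3 := V_nonneg hV (gradient (h s') p)
      have h4 := hgb s' hs'' p
      rw [abs_mul, abs_of_pos hlam, abs_of_nonneg h3]
      have h5 : ‖gradient (h s') p‖ ^ 2 ≤ K ^ 2 := by gcongr
      gcongr
      linarith
    have i1 := Kn_int hσ (j := 3) (by norm_num) e he (F := fun y => lam * V (gradient (h s') (y + x))) (by fun_prop)
      (fun y => hb' _)
    have i2 := Kn_int hσ (j := 3) (by norm_num) e he (F := fun y => lam * F y) (B := lam * (2 * K) ^ 2)
      (by have := hFc.continuous; fun_prop)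
      (fun y => by rw [abs_mul, abs_of_pos hlam]; exact mul_le_mul_of_nonneg_left (hF0 y) hlam.le)
    have e4 : lam * c2 / ν * ∫ y, Kn 1 σ e y * (0 - ν * lapl F y) = - ∫ y, Kn 3 σ e y * (lam * F y) := by
      have q1 := int_Kn2 hFc hF0 hF1 hF2 (j := 1) (by norm_num) hσ he 0
      simp only [add_zero, Nat.reduceAdd] at q1
      have q2 : ∫ y, Kn 3 σ e y * (lam * F y) = lam * ∫ y, Kn 3 σ e y * F y := by
        rw [← integral_const_mul]; congr 1; ext y; ring
      rw [q2, q1, ← integral_const_mul, ← integral_const_mul, ← integral_neg]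
      congr 1; ext y
      rw [hF, rg_lapl hφ, rg2' hφ]
      have : lam * c2 / ν * (Kn 1 σ e y * (0 - ν * (deriv (deriv φ) (inner ℝ w y) * ‖w‖ ^ 2))) =
        - (lam * Kn 1 σ e y * deriv (deriv φ) (inner ℝ w y) * (c2 * ‖w‖ ^ 2)) := by field_simp; ring
      rw [this, hc2w]; ring
    rw [e4, ← sub_eq_add_neg, ← integral_sub i1 i2]
    have e5 : ∀ y, Kn 3 σ e y * (lam * V (gradient (h s') (y + x))) - Kn 3 σ e y * (lam * F y) =
      Kn 3 σ e y * (lam * (V (gradient (h s') (y + x)) - F y)) := fun y => by ring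
    simp only [e5]
    have hA : 0 ≤ lam * (4 * K * L / ν) := by positivity
    have hB : 0 ≤ lam * (20 * M ^ 2 + 8 * K * N) := by positivity
    refine (int_bd2 hσ e he (F := fun y => lam * (V (gradient (h s') (y + x)) - F y)) hA hB (fun y => ?_)).trans
      (le_of_eq (by rw [hD]; ring))
    have htl := time_lip hV hS hν hlam (hsT.1) hs'.2.le htT hK0.le hM0 hN0
      (fun r hr => hK r ⟨hs''.1.trans hr.1, hr.2⟩) (fun r hr => hM r ⟨hs''.1.trans hr.1, hr.2⟩)
      (fun r hr => hN r ⟨hs''.1.trans hr.1, hr.2⟩) (y + x)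
    have h2 : ‖gradient (h t) (y + x) - gradient (h t) x‖ ≤ M * ‖y‖ := by
      rw [grad_sub_norm]
      have := fderiv_lip (hS.c2 t ht) (hM t htt) x (y + x)
      rwa [add_sub_cancel_right] at this
    have h3 := V_approx hV hK0 hn hq (hgb t htt x) (hgb s' hs'' (y + x)) (hgb t htt (y + x)) hM0 hN0 htl h2 hw (htay y)
    have h4 : 4 * K * L * (t - s') ≤ 4 * K * L / ν * σ := by
      calc _ = 4 * K * L / ν * (ν * (t - s')) := by field_simp
        _ ≤ _ := by gcongr
    rw [abs_mul, abs_of_pos hlam]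
    calc _ ≤ lam * (4 * K * L * (t - s') + (20 * M ^ 2 + 8 * K * N) * ‖y‖ ^ 2) := mul_le_mul_of_nonneg_left h3 hlam.le
      _ ≤ lam * (4 * K * L / ν * σ + (20 * M ^ 2 + 8 * K * N) * ‖y‖ ^ 2) := by gcongr
      _ = _ := by ring

end
end

open MeasureTheory Real Set
open scoped ENNReal
noncomputable section
section
variable {d : ℕ} {V : ES d → ℝ} {W : ℝ → ℝ} {ν lam T : ℝ} {h : ℝ → ES d → ℝ}

lemma sol_d3 (hV : IsDepositionRate d V W) (hS : Sol ν lam T V h) (hν : 0 < ν) (hlam : 0 < lam) (hT : 0 < T)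
    {k k2 β ρ g a0 : ℝ} (hρ : ρ = Zc d / Z0 d) (hβ : β = 9 / 2 * ρ * (2 * lam / ν) * (4 * d + 8) * 8)
    (hk : 0 < k) (hk2 : 0 ≤ k2) (hg : g = √(2 / ν) + 2 * β * k)
    (ha0 : a0 = 9 / 2 * ρ * (2 * k2 * g + 64 * lam / ν * (k * k2) +
      2 * lam / ν * (128 * lam / ν * k ^ 2 * k2 + 80 * k2 ^ 2) * (1 / √(2 / ν))))
    (hG : ∀ t ∈ Ioc (0:ℝ) T, ∀ x, ‖fderiv ℝ (h t) x‖ ≤ k / √t)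
    (hH : ∀ t ∈ Ioc (0:ℝ) T, ∀ x, ‖fderiv ℝ (fderiv ℝ (h t)) x‖ ≤ k2 / t) :
    ∀ t ∈ Ioc (0:ℝ) T, ∀ x, ‖iteratedFDeriv ℝ 3 (h t) x‖ ≤ 2 * a0 / (t * √t) := by
  have hZ := Zc_pos (d := d)
  have hZ0 := Z0_pos (d := d)
  have hρ0 : 0 < ρ := by rw [hρ]; positivity
  have hβ0 : 0 < β := by rw [hβ]; positivity
  obtain ⟨M3, hM30, hM3⟩ := hS.b3
  have hsν : 0 < √(2 / ν) := Real.sqrt_pos.2 (by positivity)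
  have hg0 : 0 < g := by rw [hg]; positivity
  set r := 1 / g with hr
  have hr0 : 0 < r := by positivity
  have hrk : β * k * r ≤ 1 / 2 := by
    rw [hr, mul_one_div, div_le_div_iff₀ (by positivity) (by norm_num), hg]
    nlinarith
  have hrs : r ≤ 1 / √(2 / ν) := by
    rw [hr]; gcongr; rw [hg]; nlinarith [mul_pos hβ0 hk]
  have hrν : r ^ 2 / ν ≤ 1 / 2 := by
    have h1 : r * √(2 / ν) ≤ 1 := by rwa [le_div_iff₀ hsν] at hrs
    have h2 : (r * √(2 / ν)) ^ 2 ≤ 1 := pow_le_one₀ (by positivity) h1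
    rw [mul_pow, Real.sq_sqrt (by positivity)] at h2
    have : r ^ 2 * (2 / ν) = 2 * (r ^ 2 / ν) := by ring
    linarith
  have : Nonempty (Ioc (0:ℝ) T × ES d) := ⟨⟨⟨T, hT, le_rfl⟩, 0⟩⟩
  have hpos : ∀ t ∈ Ioc (0:ℝ) T, 0 < t * √t := fun t ht => mul_pos ht.1 (Real.sqrt_pos.2 ht.1)
  have := absorb (ι := Ioc (0:ℝ) T × ES d) (f := fun i => (i.1 * √i.1) * ‖iteratedFDeriv ℝ 3 (h i.1) i.2‖)
    (a := a0) ⟨(T * √T) * M3, fun i => ?_⟩ ?_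
  · intro t ht x
    rw [le_div_iff₀ (hpos t ht), mul_comm]
    exact this (⟨t, ht⟩, x)
  · have h1 := i.1.2.2
    have h2 := Real.sqrt_le_sqrt h1
    have h3 := i.1.2.1.le
    exact mul_le_mul (mul_le_mul h1 h2 (Real.sqrt_nonneg _) hT.le) (hM3 i.1 i.1.2 i.2) (norm_nonneg _) (by positivity)
  rintro N hN ⟨⟨t, ht⟩, x⟩
  have ht0 := ht.1
  have hN' : ∀ t ∈ Ioc (0:ℝ) T, ∀ x, ‖iteratedFDeriv ℝ 3 (h t) x‖ ≤ N / (t * √t) := fun t ht x => by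
    rw [le_div_iff₀ (hpos t ht), mul_comm]
    exact hN (⟨t, ht⟩, x)
  have hN0 : 0 ≤ N := (mul_nonneg (hpos t ht).le (norm_nonneg _)).trans (hN (⟨t, ht⟩, x))
  simp only
  rw [mul_comm, ← le_div_iff₀ (hpos t ht)]
  have hst0 : 0 < √t := Real.sqrt_pos.2 ht0
  have ha00 : 0 ≤ a0 := by rw [ha0]; positivity
  have tp := tri_polar (hS.c3 t ht) x (C := 2 / 9 * ((a0 + N / 2) / (t * √t))) (by positivity) fun e he => ?_
  · refine tp.trans (le_of_eq (by ring))
  set a := t - r ^ 2 / ν * t with ha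
  have hνa : ν * (t - a) = (r * √t) ^ 2 := by
    rw [ha, mul_pow, Real.sq_sqrt ht0.le]; field_simp; ring
  have ha2 : t / 2 ≤ a := by rw [ha]; nlinarith
  have hap : 0 < a := by linarith
  have hat : a < t := by rw [ha]; linarith [show 0 < r ^ 2 / ν * t by positivity]
  have hsub : ∀ s ∈ Icc a t, s ∈ Ioc 0 T := fun s hs => ⟨hap.trans_le hs.1, hs.2.trans ht.2⟩
  have hq1 : ∀ s ∈ Icc a t, 1 / √s ≤ 2 / √t := fun s hs => sqrt_half ht0 (ha2.trans hs.1)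
  have hq2 : ∀ s ∈ Icc a t, 1 / s ≤ 2 / t := fun s hs => by
    rw [div_le_div_iff₀ (hsub s hs).1 ht0]; linarith [hs.1]
  have h1 := step3 hV hS hν hlam (a := a) (t := t) (K := 2 * k / √t) (M := 2 * k2 / t) (N := 4 * N / (t * √t))
    (r := r * √t) hap hat ht.2 (by positivity) hνa he x (by positivity) (by positivity) (by positivity)
    (fun s hs y => by
      refine (hG s (hsub s hs) y).trans ?_
      have := mul_le_mul_of_nonneg_left (hq1 s hs) hk.le
      calc k / √s = k * (1 / √s) := by ring
        _ ≤ _ := this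
        _ = _ := by ring)
    (fun s hs y => by
      refine (hH s (hsub s hs) y).trans ?_
      have := mul_le_mul_of_nonneg_left (hq2 s hs) hk2
      calc k2 / s = k2 * (1 / s) := by ring
        _ ≤ _ := this
        _ = _ := by ring)
    (fun s hs y => by
      refine (hN' s (hsub s hs) y).trans ?_
      have hs0 := (hsub s hs).1
      have : (1 / s) * (1 / √s) ≤ (2 / t) * (2 / √t) :=
        mul_le_mul (hq2 s hs) (hq1 s hs) (by positivity) (by positivity)
      calc N / (s * √s) = N * ((1 / s) * (1 / √s)) := by field_simp
        _ ≤ N * ((2 / t) * (2 / √t)) := by gcongr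
        _ = _ := by field_simp; ring)
  set X := |iteratedFDeriv ℝ 3 (h t) x (fun _ => e)| with hX
  obtain ⟨q, hq⟩ : ∃ q, q = √t := ⟨_, rfl⟩
  have hq0 : 0 < q := hq ▸ hst0
  have hqt : t = q ^ 2 := by rw [hq, Real.sq_sqrt ht0.le]
  rw [← hq] at h1 ⊢
  have e0 : (2 * k2 / t / (r * q) * Zc d + 16 * lam / ν * (2 * k / q * (2 * k2 / t)) * Zc d) +
      2 * (lam * (4 * (2 * k / q) * (ν * (d * (4 * N / (t * q))) + 4 * lam * (2 * k / q) * (2 * k2 / t)) / ν +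
        (20 * (2 * k2 / t) ^ 2 + 8 * (2 * k / q) * (4 * N / (t * q)))) * Zc d) / ν * (r * q) =
      Z0 d * (2 / 9 * ((9 / 2 * ρ * (2 * k2 * g + 64 * lam / ν * (k * k2) +
      2 * lam / ν * (128 * lam / ν * k ^ 2 * k2 + 80 * k2 ^ 2) * r) + β * k * r * N) / (t * q))) := by
    have : g = 1 / r := by rw [hr, one_div_one_div]
    rw [hβ, hρ, this, hqt]
    clear_value r
    field_simp
    ring
  rw [e0] at h1
  refine (le_of_mul_le_mul_left h1 hZ0).trans ?_
  gcongr
  · rw [ha0]; gcongr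
  · have := mul_le_mul_of_nonneg_right hrk hN0
    linarith
end
end

open MeasureTheory Real Set
open scoped ENNReal
noncomputable section
section

def NNc {σ : Type*} (P : MvPolynomial σ ℝ) : Prop := ∀ m, 0 ≤ P.coeff m

lemma NNc.add {σ : Type*} {P Q : MvPolynomial σ ℝ} (hP : NNc P) (hQ : NNc Q) : NNc (P + Q) := fun m => by
  rw [MvPolynomial.coeff_add]; exact add_nonneg (hP m) (hQ m)

lemma NNc.mul {σ : Type*} {P Q : MvPolynomial σ ℝ} (hP : NNc P) (hQ : NNc Q) : NNc (P * Q) := fun m => by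
  classical
  rw [MvPolynomial.coeff_mul]; exact Finset.sum_nonneg fun i _ => mul_nonneg (hP _) (hQ _)

lemma NNc.const {σ : Type*} {c : ℝ} (hc : 0 ≤ c) : NNc (MvPolynomial.C c : MvPolynomial σ ℝ) := fun m => by
  classical
  rw [MvPolynomial.coeff_C]; split_ifs <;> simp [hc]

lemma NNc.var {σ : Type*} (i : σ) : NNc (MvPolynomial.X i : MvPolynomial σ ℝ) := fun m => by
  classical
  rw [MvPolynomial.coeff_X']; split_ifs <;> simp

lemma poly_k {σ : Type*} (i : σ) {s κ ρ : ℝ} (hs : 0 ≤ s) (hκ : 0 ≤ κ) (hρ : 0 ≤ ρ) :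
    ∃ Pk P2 : MvPolynomial σ ℝ, NNc Pk ∧ NNc P2 ∧ (∀ v, MvPolynomial.eval v Pk = s * (v i + 1)) ∧
      ∀ v, MvPolynomial.eval v P2 = 2 * (2 * ρ * (s * (v i + 1)) * (s + 8 * κ * (s * (v i + 1)))) := by
  have h1 : NNc (MvPolynomial.C s * (MvPolynomial.X i + MvPolynomial.C 1) : MvPolynomial σ ℝ) :=
    (NNc.const hs).mul ((NNc.var i).add (NNc.const zero_le_one))
  refine ⟨MvPolynomial.C s * (MvPolynomial.X i + MvPolynomial.C 1),
    MvPolynomial.C (4 * ρ) * (MvPolynomial.C s * (MvPolynomial.X i + MvPolynomial.C 1)) *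
      (MvPolynomial.C s + MvPolynomial.C (8 * κ) * (MvPolynomial.C s * (MvPolynomial.X i + MvPolynomial.C 1))),
    h1, ((NNc.const (by positivity)).mul h1).mul ((NNc.const hs).add ((NNc.const (by positivity)).mul h1)), fun v => ?_,
    fun v => ?_⟩
  · simp
  · simp; ring

lemma poly_one {s κ ρ : ℝ} (hs : 0 ≤ s) (hκ : 0 ≤ κ) (hρ : 0 ≤ ρ) :
    ∃ P : MvPolynomial (Fin 3) ℝ, (∀ m, 0 ≤ P.coeff m) ∧ ∀ A G H : ℝ, MvPolynomial.eval ![A, G, H] P =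
      2 * (2 * (ρ * (H + G * (1 + 2 * κ * G))) + 2 * (2 * ρ * (s * (A + 1)) * (s + 8 * κ * (s * (A + 1))))) := by
  obtain ⟨Pk, P2, hPk, hP2, ek, e2⟩ := poly_k (0 : Fin 3) hs hκ hρ
  refine ⟨MvPolynomial.C 2 * (MvPolynomial.C (2 * ρ) * (MvPolynomial.X 2 + MvPolynomial.X 1 *
    (MvPolynomial.C 1 + MvPolynomial.C (2 * κ) * MvPolynomial.X 1)) + P2), ?_, fun A G H => ?_⟩
  · exact (NNc.const (by norm_num)).mul (((NNc.const (by positivity)).mul ((NNc.var _).add ((NNc.var _).mul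
      ((NNc.const (by norm_num)).add ((NNc.const (by positivity)).mul (NNc.var _)))))).add hP2)
  · simp [e2]; ring

lemma poly_two {s κ ρ β c1 c2 c3 : ℝ} (hs : 0 ≤ s) (hκ : 0 ≤ κ) (hρ : 0 ≤ ρ) (hβ : 0 ≤ β)
    (h1 : 0 ≤ c1) (h2 : 0 ≤ c2) (h3 : 0 ≤ c3) :
    ∃ P : MvPolynomial (Fin 4) ℝ, (∀ m, 0 ≤ P.coeff m) ∧ ∀ A G H N k k2 : ℝ, k = s * (A + 1) →
      k2 = 2 * (2 * ρ * k * (s + 8 * κ * k)) → MvPolynomial.eval ![A, G, H, N] P =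
      4 * (2 * (9 / 2 * ρ * (2 * k2 * (s + 2 * β * k) + c1 * (k * k2) + (c2 * (k ^ 2 * k2) + c3 * k2 ^ 2)))) := by
  obtain ⟨Pk, P2, hPk, hP2, ek, e2⟩ := poly_k (0 : Fin 4) hs hκ hρ
  refine ⟨MvPolynomial.C (36 * ρ) * (MvPolynomial.C 2 * P2 * (MvPolynomial.C s + MvPolynomial.C (2 * β) * Pk) +
    MvPolynomial.C c1 * (Pk * P2) + (MvPolynomial.C c2 * (Pk * Pk * P2) + MvPolynomial.C c3 * (P2 * P2))), ?_, ?_⟩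
  · exact (NNc.const (by positivity)).mul (((((NNc.const (by norm_num)).mul hP2).mul ((NNc.const hs).add
      ((NNc.const (by positivity)).mul hPk))).add ((NNc.const h1).mul (hPk.mul hP2))).add
      (((NNc.const h2).mul ((hPk.mul hPk).mul hP2)).add ((NNc.const h3).mul (hP2.mul hP2))))
  · intro A G H N k k2 hk hk2
    simp only [map_mul, map_add, MvPolynomial.eval_C, ek, e2, Matrix.cons_val_zero, ← hk, ← hk2]
    ring

lemma log_half {t : ℝ} (ht : 0 < t) (h1 : t ≤ 1) : 1 / 2 ≤ Real.log (1 + t) / t := by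
  have := Real.one_sub_inv_le_log_of_pos (show 0 < 1 + t by linarith)
  rw [le_div_iff₀ ht]
  refine le_trans ?_ this
  have e : 1 - (1 + t)⁻¹ = t / (1 + t) := by field_simp; ring
  rw [e, le_div_iff₀ (by linarith)]
  nlinarith

lemma log_half' {t : ℝ} (h1 : 1 ≤ t) : 1 / 2 ≤ Real.log (1 + t) := by
  have := Real.one_sub_inv_le_log_of_pos (show 0 < 1 + t by linarith)
  refine le_trans ?_ this
  have : (1 + t)⁻¹ ≤ 2⁻¹ := inv_anti₀ (by norm_num) (by linarith)
  norm_num at this ⊢; linarith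

/-- Bounds on higher derivatives: there are polynomials `P₁` (3 variables) and
`P₂` (4 variables) with nonnegative coefficients, depending only on `d`, `ν`, `λ`, such that for
every classical solution with `h₀ ∈ W^{3,∞}` which is `C³` in space with bounded derivatives of
order `≤ 3`: `‖∇²h(t,·)‖_∞ ≤ P₁(‖h₀‖_∞,‖∇h₀‖_∞,‖∇²h₀‖_∞) ln(1+t)/t` on `(0,T]` and
`‖∇³h(t,·)‖_∞ ≤ P₂(‖h₀‖_∞,‖∇h₀‖_∞,‖∇²h₀‖_∞,‖∇³h₀‖_∞) ln²(1+t)/t^{3/2}` on `[1,T]`. -/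
theorem statement7 {d : ℕ} (hd : 1 ≤ d) (ν lam : ℝ) (hν : 0 < ν) (hlam : 0 < lam) :
    ∃ P₁ : MvPolynomial (Fin 3) ℝ, ∃ P₂ : MvPolynomial (Fin 4) ℝ,
      (∀ m, 0 ≤ P₁.coeff m) ∧ (∀ m, 0 ≤ P₂.coeff m) ∧
      ∀ (V : EuclideanSpace ℝ (Fin d) → ℝ) (W : ℝ → ℝ), IsDepositionRate d V W →
      ∀ (T : ℝ), 0 < T →
      ∀ (h₀ : EuclideanSpace ℝ (Fin d) → ℝ) (h : ℝ → EuclideanSpace ℝ (Fin d) → ℝ),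
        ContDiff ℝ 3 h₀ →
        (∀ k : ℕ, k ≤ 3 → ∃ C, ∀ x, ‖iteratedFDeriv ℝ k h₀ x‖ ≤ C) →
        IsClassicalSolution ν lam T V h₀ h →
        (∀ t ∈ Set.Ioc (0:ℝ) T, ContDiff ℝ 3 (h t)) →
        (∀ k : ℕ, k ≤ 3 → ∃ C, ∀ t ∈ Set.Ioc (0:ℝ) T, ∀ x, ‖iteratedFDeriv ℝ k (h t) x‖ ≤ C) →
        (∀ t ∈ Set.Ioc (0:ℝ) T,
          (⨆ x, ‖iteratedFDeriv ℝ 2 (h t) x‖) ≤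
            MvPolynomial.eval
              ![⨆ x, |h₀ x|, ⨆ x, ‖gradient h₀ x‖, ⨆ x, ‖iteratedFDeriv ℝ 2 h₀ x‖] P₁ *
              (Real.log (1 + t) / t)) ∧
        (∀ t ∈ Set.Icc (1:ℝ) T,
          (⨆ x, ‖iteratedFDeriv ℝ 3 (h t) x‖) ≤
            MvPolynomial.eval
              ![⨆ x, |h₀ x|, ⨆ x, ‖gradient h₀ x‖, ⨆ x, ‖iteratedFDeriv ℝ 2 h₀ x‖,
                ⨆ x, ‖iteratedFDeriv ℝ 3 h₀ x‖] P₂ *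
              ((Real.log (1 + t)) ^ 2 / t ^ ((3:ℝ)/2))) := by
  have hZ := Zc_pos (d := d)
  have hZ0 := Z0_pos (d := d)
  obtain ⟨κ, hκ⟩ : ∃ κ, κ = 8 * lam * Zc d / (ν * Z0 d) := ⟨_, rfl⟩
  obtain ⟨ρ, hρ⟩ : ∃ ρ, ρ = Zc d / Z0 d := ⟨_, rfl⟩
  have hκ0 : 0 < κ := by rw [hκ]; positivity
  have hρ0 : 0 < ρ := by rw [hρ]; positivity
  obtain ⟨β, hβ⟩ : ∃ β, β = 9 / 2 * ρ * (2 * lam / ν) * (4 * d + 8) * 8 := ⟨_, rfl⟩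
  have hβ0 : 0 < β := by rw [hβ]; positivity
  obtain ⟨sq, hsq⟩ : ∃ sq, sq = √(2 / ν) := ⟨_, rfl⟩
  have hsq0 : 0 < sq := by rw [hsq]; exact Real.sqrt_pos.2 (by positivity)
  obtain ⟨P₁, hP₁, e₁⟩ := poly_one hsq0.le hκ0.le hρ0.le
  obtain ⟨P₂, hP₂, e₂⟩ := poly_two (c1 := 64 * lam / ν) (c2 := 2 * lam / ν * (128 * lam / ν) * (1 / sq))
    (c3 := 2 * lam / ν * 80 * (1 / sq)) hsq0.le hκ0.le hρ0.le hβ0.le (by positivity) (by positivity) (by positivity)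
  refine ⟨P₁, P₂, hP₁, hP₂, ?_⟩
  intro V W hV T hT h₀ h hc0 hb0 hcl hc3 hb
  have h00 : h 0 = h₀ := funext hcl.init
  -- bounds
  have bpos : ∀ {C : ℝ}, C ≤ max C 0 := fun {C} => le_max_left _ _
  obtain ⟨C0, hC0⟩ := hcl.bdd
  obtain ⟨C1, hC1⟩ := hcl.grad_bdd
  obtain ⟨C2, hC2⟩ := hb 2 (by norm_num)
  obtain ⟨C3, hC3⟩ := hb 3 le_rfl
  have hS : Sol ν lam T V h := by
    refine ⟨hcl.cont, hc3, fun t ht x => ?_, ⟨max C0 0, le_max_right _ _, fun t ht x => (hC0 t ht x).trans bpos⟩,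
      ⟨max C1 0, le_max_right _ _, fun t ht x => ?_⟩, ⟨max C2 0, le_max_right _ _, fun t ht x => ?_⟩,
      ⟨max C3 0, le_max_right _ _, fun t ht x => (hC3 t ht x).trans bpos⟩⟩
    · rw [← hcl.pde t ht x]; exact (hcl.time_reg x t ht).hasDerivAt
    · rw [← norm_grad]; exact (hC1 t (Ioc_subset_Icc_self ht) x).trans bpos
    · rw [← norm_it2]; exact (hC2 t ht x).trans bpos
  obtain ⟨B2, hB2⟩ := hb0 2 (by norm_num)
  set A := ⨆ x, |h₀ x| with hA
  set G := ⨆ x, ‖gradient h₀ x‖ with hG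
  set H := ⨆ x, ‖iteratedFDeriv ℝ 2 h₀ x‖ with hH
  have h0m : (0:ℝ) ∈ Icc (0:ℝ) T := ⟨le_rfl, hT.le⟩
  have hA1 : ∀ x, |h 0 x| ≤ A := fun x => by
    rw [h00]
    exact le_ciSup (f := fun x => |h₀ x|) ⟨C0, by rintro _ ⟨y, rfl⟩; simpa [h00] using hC0 0 h0m y⟩ x
  have hG1 : ∀ x, ‖fderiv ℝ (h 0) x‖ ≤ G := fun x => by
    rw [h00, ← norm_grad]
    exact le_ciSup (f := fun x => ‖gradient h₀ x‖) ⟨C1, by rintro _ ⟨y, rfl⟩; simpa [h00] using hC1 0 h0m y⟩ x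
  have hH1 : ∀ x, ‖fderiv ℝ (fderiv ℝ (h 0)) x‖ ≤ H := fun x => by
    rw [h00, ← norm_it2]
    exact le_ciSup (f := fun x => ‖iteratedFDeriv ℝ 2 h₀ x‖) ⟨B2, by rintro _ ⟨y, rfl⟩; exact hB2 y⟩ x
  have hA0 : 0 ≤ A := (abs_nonneg _).trans (hA1 0)
  have hG0 : 0 ≤ G := (norm_nonneg _).trans (hG1 0)
  have hH0 : 0 ≤ H := (ContinuousLinearMap.opNorm_nonneg _).trans (hH1 0)
  obtain ⟨k, hk⟩ : ∃ k, k = sq * (A + 1) := ⟨_, rfl⟩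
  have hk0 : 0 < k := by rw [hk]; positivity
  obtain ⟨k2, hk2⟩ : ∃ k2, k2 = 2 * (2 * ρ * k * (sq + 8 * κ * k)) := ⟨_, rfl⟩
  have hk20 : 0 ≤ k2 := by rw [hk2]; positivity
  have g1 : ∀ t ∈ Ioc (0:ℝ) T, ∀ x, ‖fderiv ℝ (h t) x‖ ≤ k / √t := fun t ht x => by
    refine (sol_decay hV hν hlam hS hA1 t ht x).trans ?_
    rw [hk, ← hsq]
    gcongr
    linarith
  have g2 : ∀ t ∈ Ioc (0:ℝ) T, ∀ x, ‖fderiv ℝ (fderiv ℝ (h t)) x‖ ≤ k2 / t := by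
    rw [hk2, hsq]
    exact sol_d2b hV hS hν hlam hT hκ hρ hk0.le g1
  have g2' := sol_d2a hV hS hν hlam hT hκ hρ (h00 ▸ hc0.of_le (by norm_num)) hG1 hH1
  have g3 := sol_d3 hV hS hν hlam hT (β := β) (k := k) (k2 := k2) hρ hβ hk0 hk20 rfl rfl g1 g2
  refine ⟨fun t ht => ciSup_le fun x => ?_, fun t ht => ciSup_le fun x => ?_⟩
  · rw [norm_it2, e₁, ← hk, ← hk2]
    set U := 2 * (ρ * (H + G * (1 + 2 * κ * G))) with hU
    have hU0 : 0 ≤ U := by positivity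
    rcases le_total t 1 with h1 | h1
    · refine (g2' t ht x).trans ?_
      have := mul_le_mul_of_nonneg_left (log_half ht.1 h1) (show 0 ≤ 2 * (U + k2) by positivity)
      linarith
    · refine (g2 t ht x).trans ?_
      have h2 := log_half' h1
      rw [mul_div_assoc']
      have ht0 := ht.1
      gcongr
      nlinarith
  · have ht0 : 0 < t := by linarith [ht.1]
    refine (g3 t ⟨ht0, ht.2⟩ x).trans ?_
    rw [e₂ A G H _ k k2 hk hk2]
    have e3 : t ^ ((3:ℝ)/2) = t * √t := by
      rw [Real.sqrt_eq_rpow, show (3:ℝ)/2 = 1 + 1/2 by norm_num, Real.rpow_add ht0, Real.rpow_one]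
    rw [e3, ← hsq, ← mul_div_assoc (_ * _) (Real.log (1 + t) ^ 2)]
    have h2 := log_half' ht.1
    have h3 : 1 ≤ 4 * Real.log (1 + t) ^ 2 := by nlinarith
    have hst : 0 < √t := Real.sqrt_pos.2 ht0
    refine div_le_div_of_nonneg_right ?_ (mul_pos ht0 hst).le
    set Y := 2 * (9 / 2 * ρ * (2 * k2 * (sq + 2 * β * k) + 64 * lam / ν * (k * k2) +
      (2 * lam / ν * (128 * lam / ν) * (1 / sq) * (k ^ 2 * k2) + 2 * lam / ν * 80 * (1 / sq) * k2 ^ 2))) with hY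
    have hY0 : 0 ≤ Y := by positivity
    calc _ = Y * 1 := by rw [hY]; ring
      _ ≤ Y * (4 * Real.log (1 + t) ^ 2) := by gcongr
      _ = _ := by ring
end
end
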